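/- Fix β > −1, T > 0, C₁ > 0. Let u, a, b, f be functions of (ρ,θ,t) on {0 < ρ < 1}×ℝ×[0,T], 2π-periodic in θ, with u bounded, twice continuously differentiable in (ρ,θ) and once in t, solving pointwise ∂_t u = a △̃u + b u + f, where a > 0 and a + 1/a + |∂_t a| + |b| + |f| ≤ C₁. Assume max_{t∈[0,T]} ∫₀^{2π}∫₀¹ |∇̃u|² dṼ + ∫₀^T ∫₀^{2π}∫₀¹ |∂_t u|² dṼ dt < ∞. Then for every δ ∈ (0,1) there exist α' > 0, depending only on β and C₁, and C₂ depending only on δ, C₁ and sup|u|, such that for all ρ₁, ρ₂ ∈ (0,1−δ], all θ₁, θ₂, and all t, s ∈ [δ,T]: |u(ρ₁,θ₁,t) − u(ρ₂,θ₂,s)| ≤ C₂ ( |P(ρ₁,θ₁) − P(ρ₂,θ₂)| + √|t−s| )^{α'}, where P(ρ,θ) = (ρ cos θ, ρ sin θ) ∈ ℝ². -/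

import Mathlib

open Real MeasureTheory Set

open scoped ENNReal

/-- The cone Laplacian `△̃ = ∂²/∂ρ² + ρ⁻¹ ∂/∂ρ + (β+1)⁻² ρ⁻² ∂²/∂θ²` applied to the
spatial slice of a function `u(ρ,θ,t)`. -/
noncomputable def coneLapT (β : ℝ) (u : ℝ → ℝ → ℝ → ℝ) (ρ θ t : ℝ) : ℝ :=
  deriv (fun r => deriv (fun r' => u r' θ t) r) ρ
    + ρ⁻¹ * deriv (fun r => u r θ t) ρ
    + ((β + 1) ^ 2)⁻¹ * (ρ ^ 2)⁻¹ * deriv (fun s => deriv (fun s' => u ρ s' t) s) θ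

/-- `|∇̃u|² = |∂_ρ u|² + ((β+1)ρ)⁻² |∂_θ u|²` for the cone metric. -/
noncomputable def gradSq (β : ℝ) (u : ℝ → ℝ → ℝ → ℝ) (ρ θ t : ℝ) : ℝ :=
  (deriv (fun r => u r θ t) ρ) ^ 2
    + (((β + 1) * ρ) ^ 2)⁻¹ * (deriv (fun s => u ρ s t) θ) ^ 2

/-- Time derivative on `[0,T]` (one-sided at the endpoints). -/
noncomputable def dtime (T : ℝ) (h : ℝ → ℝ) (t : ℝ) : ℝ :=
  derivWithin h (Set.Icc 0 T) t

section
open Real MeasureTheory Set Filter Topology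
open scoped ENNReal

namespace ConeH

/-- polar measure `ρ dρ dθ` on `(0,∞) × (0,2π]`. -/
noncomputable def mu : Measure (ℝ × ℝ) :=
  (volume.restrict (Ioi (0:ℝ) ×ˢ Ioc (0:ℝ) (2 * π))).withDensity (fun x => ENNReal.ofReal x.1)

def B (r : ℝ) : Set (ℝ × ℝ) := Ioo (0:ℝ) r ×ˢ univ

lemma mem_B {r : ℝ} {x : ℝ × ℝ} : x ∈ B r ↔ 0 < x.1 ∧ x.1 < r := by simp [B]

lemma B_open (r : ℝ) : IsOpen (B r) := isOpen_Ioo.prod isOpen_univ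

lemma B_meas (r : ℝ) : MeasurableSet (B r) := (B_open r).measurableSet

lemma B_mono {r s : ℝ} (h : r ≤ s) : B r ⊆ B s := by
  intro x hx; rw [mem_B] at *; exact ⟨hx.1, hx.2.trans_le h⟩

/-- the rectangle -/
def Rc (r : ℝ) : Set (ℝ × ℝ) := Ioo (0:ℝ) r ×ˢ Ioc (0:ℝ) (2 * π)

lemma Rc_meas (r : ℝ) : MeasurableSet (Rc r) := measurableSet_Ioo.prod measurableSet_Ioc

lemma B_inter (r : ℝ) : B r ∩ (Ioi (0:ℝ) ×ˢ Ioc (0:ℝ) (2 * π)) = Rc r := by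
  ext x; simp only [B, Rc, mem_inter_iff, mem_prod, mem_Ioo, mem_univ, mem_Ioi, mem_Ioc]; tauto

lemma mu_restrict (r : ℝ) : mu.restrict (B r) =
    (volume.restrict (Rc r)).withDensity (fun x => ENNReal.ofReal x.1) := by
  rw [mu, restrict_withDensity (B_meas r), Measure.restrict_restrict (B_meas r), B_inter]

lemma lint_B (r : ℝ) (f : ℝ × ℝ → ℝ≥0∞) (hf : AEMeasurable f (volume.restrict (Rc r))) :
    ∫⁻ x in B r, f x ∂mu = ∫⁻ x in Rc r, ENNReal.ofReal x.1 * f x := by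
  rw [mu_restrict, lintegral_withDensity_eq_lintegral_mul₀ (by fun_prop) hf]
  rfl

lemma integrableOn_B {r : ℝ} {f : ℝ × ℝ → ℝ} :
    IntegrableOn f (B r) mu ↔ IntegrableOn (fun x => x.1 * f x) (Rc r) := by
  rw [IntegrableOn, mu_restrict, integrable_withDensity_iff_integrable_smul' (by fun_prop)
    (by simp), IntegrableOn]
  apply integrable_congr
  filter_upwards [ae_restrict_mem (Rc_meas r)] with x hx
  rw [ENNReal.toReal_ofReal hx.1.1.le]; rfl

lemma int_B0 (r : ℝ) (f : ℝ × ℝ → ℝ) :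
    ∫ x in B r, f x ∂mu = ∫ x in Rc r, x.1 * f x := by
  rw [mu_restrict, integral_withDensity_eq_integral_toReal_smul (by fun_prop) (by simp)]
  apply integral_congr_ae
  filter_upwards [ae_restrict_mem (Rc_meas r)] with x hx
  rw [ENNReal.toReal_ofReal hx.1.1.le]; rfl

lemma Rc_vol (r : ℝ) : (volume.restrict (Rc r) : Measure (ℝ × ℝ)) =
    (volume.restrict (Ioo (0:ℝ) r)).prod (volume.restrict (Ioc (0:ℝ) (2*π))) := by
  rw [Measure.prod_restrict]; rfl

lemma int_B {r : ℝ} (hr : 0 ≤ r) {f : ℝ × ℝ → ℝ} (hf : IntegrableOn f (B r) mu) :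
    ∫ x in B r, f x ∂mu = ∫ ρ in (0:ℝ)..r, ∫ θ in (0:ℝ)..(2*π), ρ * f (ρ, θ) := by
  rw [int_B0]
  rw [integrableOn_B, IntegrableOn, Rc_vol] at hf
  rw [Rc_vol, integral_prod _ hf, intervalIntegral.integral_of_le hr, integral_Ioc_eq_integral_Ioo]
  simp_rw [intervalIntegral.integral_of_le (by positivity : (0:ℝ) ≤ 2 * π)]

lemma int_B_ii {r : ℝ} (hr : 0 ≤ r) {f : ℝ × ℝ → ℝ} (hf : IntegrableOn f (B r) mu) :
    IntervalIntegrable (fun ρ => ∫ θ in (0:ℝ)..(2*π), ρ * f (ρ, θ)) volume 0 r := by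
  rw [integrableOn_B, IntegrableOn, Rc_vol] at hf
  have := hf.integral_prod_left
  rw [intervalIntegrable_iff_integrableOn_Ioo_of_le hr]
  simp_rw [intervalIntegral.integral_of_le (by positivity : (0:ℝ) ≤ 2 * π)]
  exact this

lemma mu_B {r : ℝ} (hr : 0 ≤ r) : mu (B r) = ENNReal.ofReal (π * r^2) := by
  have h1 : mu (B r) = ∫⁻ x in B r, 1 ∂mu := by simp
  rw [h1, lint_B r _ (by fun_prop), Rc_vol,
    lintegral_prod _ (by fun_prop)]
  simp only [mul_one, lintegral_const, Measure.restrict_apply_univ, Real.volume_Ioc, sub_zero]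
  rw [lintegral_mul_const _ (by fun_prop)]
  rw [← ofReal_integral_eq_lintegral_ofReal]
  · rw [← integral_Ioc_eq_integral_Ioo, ← intervalIntegral.integral_of_le hr, integral_id,
      ← ENNReal.ofReal_mul (by norm_num; positivity)]
    congr 1; ring
  · rw [← IntegrableOn, ← intervalIntegrable_iff_integrableOn_Ioo_of_le hr]
    exact intervalIntegral.intervalIntegrable_id
  · filter_upwards [ae_restrict_mem measurableSet_Ioo] with x hx using hx.1.le

instance fin_B (r : ℝ) : IsFiniteMeasure (mu.restrict (B r)) := by
  constructor
  rw [Measure.restrict_apply_univ]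
  rcases le_total 0 r with h | h
  · rw [mu_B h]; exact ENNReal.ofReal_lt_top
  · have : B r = ∅ := by
      ext x; rw [mem_B]; constructor
      · rintro ⟨a, b⟩; linarith
      · intro h; exact h.elim
    simp [this]

instance sf_mu : SFinite mu := by unfold mu; infer_instance

lemma mu_B_real {r : ℝ} (hr : 0 ≤ r) : mu.real (B r) = π * r^2 := by
  rw [Measure.real, mu_B hr, ENNReal.toReal_ofReal (by positivity)]

structure Sl1 (R : ℝ) (f fr ft : ℝ × ℝ → ℝ) : Prop where
  per : ∀ x ∈ B R, f (x.1, x.2 + 2 * π) = f x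
  hr : ∀ x ∈ B R, HasDerivAt (fun r => f (r, x.2)) (fr x) x.1
  ht : ∀ x ∈ B R, HasDerivAt (fun s => f (x.1, s)) (ft x) x.2
  c0 : ContinuousOn f (B R)
  cr : ContinuousOn fr (B R)
  ct : ContinuousOn ft (B R)

structure Sl (R : ℝ) (f fr ft frr ftt : ℝ × ℝ → ℝ) : Prop extends Sl1 R f fr ft where
  hrr : ∀ x ∈ B R, HasDerivAt (fun r => fr (r, x.2)) (frr x) x.1
  htt : ∀ x ∈ B R, HasDerivAt (fun s => ft (x.1, s)) (ftt x) x.2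
  crr : ContinuousOn frr (B R)
  ctt : ContinuousOn ftt (B R)

noncomputable def q (κ : ℝ) (fr ft : ℝ × ℝ → ℝ) (x : ℝ × ℝ) : ℝ :=
  fr x ^ 2 + (κ ^ 2 * x.1 ^ 2)⁻¹ * ft x ^ 2

noncomputable def lap (κ : ℝ) (fr frr ftt : ℝ × ℝ → ℝ) (x : ℝ × ℝ) : ℝ :=
  frr x + x.1⁻¹ * fr x + (κ ^ 2)⁻¹ * (x.1 ^ 2)⁻¹ * ftt x

lemma q_nonneg (κ : ℝ) (fr ft : ℝ × ℝ → ℝ) (x : ℝ × ℝ) : 0 ≤ q κ fr ft x := by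
  unfold q; positivity

lemma contOn_fst_inv {R : ℝ} : ContinuousOn (fun x : ℝ × ℝ => x.1⁻¹) (B R) :=
  continuousOn_fst.inv₀ (fun x hx => (mem_B.1 hx).1.ne')

lemma Sl.contOn_lap {R κ : ℝ} {f fr ft frr ftt : ℝ × ℝ → ℝ} (h : Sl R f fr ft frr ftt) :
    ContinuousOn (lap κ fr frr ftt) (B R) := by
  unfold lap
  refine (h.crr.add (contOn_fst_inv.mul h.cr)).add
    ((continuousOn_const.mul ?_).mul h.ctt)
  simp_rw [← inv_pow]; exact contOn_fst_inv.pow 2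

lemma Sl1.contOn_q {R κ : ℝ} {f fr ft : ℝ × ℝ → ℝ} (h : Sl1 R f fr ft) :
    ContinuousOn (q κ fr ft) (B R) := by
  unfold q
  refine (h.cr.pow 2).add (ContinuousOn.mul ?_ (h.ct.pow 2))
  simp_rw [mul_inv, ← inv_pow]; exact continuousOn_const.mul (contOn_fst_inv.pow 2)

lemma Sl1.per_t {R : ℝ} {f fr ft : ℝ × ℝ → ℝ} (h : Sl1 R f fr ft) :
    ∀ x ∈ B R, ft (x.1, x.2 + 2 * π) = ft x := by
  intro x hx
  have h1 := (h.ht (x.1, x.2 + 2*π) (by rw [mem_B] at *; exact hx)).comp_add_const x.2 (2*π)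
  have h2 : (fun s => f (x.1, s + 2 * π)) = fun s => f (x.1, s) := by
    funext s; exact h.per (x.1, s) (by rw [mem_B] at *; exact hx)
  dsimp only at h1
  rw [h2] at h1
  exact h1.unique (h.ht x hx)

lemma slice_r {R : ℝ} {f : ℝ × ℝ → ℝ} (h : ContinuousOn f (B R)) (θ : ℝ) {a b : ℝ} (ha : 0 < a)
    (hb : b < R) : ContinuousOn (fun r => f (r, θ)) (Icc a b) :=
  h.comp (by fun_prop) (fun x hx => mem_B.2 ⟨ha.trans_le hx.1, hx.2.trans_lt hb⟩)

lemma slice_t {R : ℝ} {f : ℝ × ℝ → ℝ} (h : ContinuousOn f (B R)) {ρ : ℝ} (h0 : 0 < ρ) (h1 : ρ < R) :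
    Continuous (fun θ => f (ρ, θ)) :=
  h.comp_continuous (by fun_prop) (fun _ => mem_B.2 ⟨h0, h1⟩)

lemma rect_int {R : ℝ} {f : ℝ × ℝ → ℝ} (h : ContinuousOn f (B R)) {a b : ℝ} (ha : 0 < a)
    (hb : b < R) : IntegrableOn f (Icc a b ×ˢ Icc 0 (2*π)) :=
  (h.mono (fun x hx => mem_B.2 ⟨ha.trans_le hx.1.1, hx.1.2.trans_lt hb⟩)).integrableOn_compact
    (isCompact_Icc.prod isCompact_Icc)

lemma rect_swap {R : ℝ} {f : ℝ × ℝ → ℝ} (h : ContinuousOn f (B R)) {a b : ℝ} (ha : 0 < a)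
    (hab : a ≤ b) (hb : b < R) :
    ∫ ρ in a..b, ∫ θ in (0:ℝ)..(2*π), f (ρ, θ) = ∫ θ in (0:ℝ)..(2*π), ∫ ρ in a..b, f (ρ, θ) := by
  have h2 : (0:ℝ) ≤ 2 * π := by positivity
  simp_rw [intervalIntegral.integral_of_le hab, intervalIntegral.integral_of_le h2]
  apply integral_integral_swap
  rw [Measure.prod_restrict]
  exact (rect_int h ha hb).mono_set (prod_mono Ioc_subset_Icc_self Ioc_subset_Icc_self)

lemma rect_ii {R : ℝ} {f : ℝ × ℝ → ℝ} (h : ContinuousOn f (B R)) {a b : ℝ} (ha : 0 < a)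
    (hab : a ≤ b) (hb : b < R) :
    IntervalIntegrable (fun ρ => ∫ θ in (0:ℝ)..(2*π), f (ρ, θ)) volume a b := by
  have h2 : (0:ℝ) ≤ 2 * π := by positivity
  have := (rect_int h ha hb).mono_set (prod_mono Ioc_subset_Icc_self Ioc_subset_Icc_self :
    Ioc a b ×ˢ Ioc 0 (2*π) ⊆ _)
  rw [IntegrableOn, Measure.volume_eq_prod, ← Measure.prod_restrict] at this
  have := this.integral_prod_left
  rw [intervalIntegrable_iff_integrableOn_Ioc_of_le hab]
  simp_rw [intervalIntegral.integral_of_le h2]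
  exact this

lemma rect_ibp {κ R : ℝ} {f fr ft frr ftt p pr pt : ℝ × ℝ → ℝ}
    (hf : Sl R f fr ft frr ftt) (hp : Sl1 R p pr pt) {a b : ℝ} (ha : 0 < a)
    (hab : a ≤ b) (hb : b < R) :
    ∫ ρ in a..b, ∫ θ in (0:ℝ)..(2*π), ρ * (fr (ρ,θ) * pr (ρ,θ)
        + (κ^2*ρ^2)⁻¹ * (ft (ρ,θ) * pt (ρ,θ)) + p (ρ,θ) * lap κ fr frr ftt (ρ,θ))
      = (∫ θ in (0:ℝ)..(2*π), b * (p (b,θ) * fr (b,θ)))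
        - ∫ θ in (0:ℝ)..(2*π), a * (p (a,θ) * fr (a,θ)) := by
  set gA : ℝ × ℝ → ℝ := fun x => p x * fr x + x.1 * (pr x * fr x + p x * frr x) with hgA
  set gB : ℝ × ℝ → ℝ := fun x => (κ^2)⁻¹ * x.1⁻¹ * (pt x * ft x + p x * ftt x) with hgB
  have cA : ContinuousOn gA (B R) :=
    (hp.c0.mul hf.cr).add (continuousOn_fst.mul ((hp.cr.mul hf.cr).add (hp.c0.mul hf.crr)))
  have cB : ContinuousOn gB (B R) :=
    (continuousOn_const.mul contOn_fst_inv).mul ((hp.ct.mul hf.ct).add (hp.c0.mul hf.ctt))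
  have e1 : ∀ ρ ∈ uIcc a b, ∫ θ in (0:ℝ)..(2*π), ρ * (fr (ρ,θ) * pr (ρ,θ)
        + (κ^2*ρ^2)⁻¹ * (ft (ρ,θ) * pt (ρ,θ)) + p (ρ,θ) * lap κ fr frr ftt (ρ,θ))
        = ∫ θ in (0:ℝ)..(2*π), gA (ρ, θ) := by
    intro ρ hρ
    rw [uIcc_of_le hab] at hρ
    have h0 : 0 < ρ := ha.trans_le hρ.1
    have h1 : ρ < R := hρ.2.trans_lt hb
    have z : ∫ θ in (0:ℝ)..(2*π), gB (ρ, θ) = 0 := by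
      have : ∀ θ ∈ uIcc 0 (2*π), HasDerivAt (fun θ => (κ^2)⁻¹ * ρ⁻¹ * (p (ρ,θ) * ft (ρ, θ)))
          (gB (ρ,θ)) θ := by
        intro θ _
        have hm : (ρ,θ) ∈ B R := mem_B.2 ⟨h0,h1⟩
        exact ((hp.ht _ hm).mul (hf.htt _ hm)).const_mul _
      rw [intervalIntegral.integral_eq_sub_of_hasDerivAt this
        ((slice_t cB h0 h1).intervalIntegrable _ _)]
      have hm : (ρ,(0:ℝ)) ∈ B R := mem_B.2 ⟨h0,h1⟩
      have := hp.per _ hm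
      have := hf.toSl1.per_t _ hm
      simp_all
    have z2 := intervalIntegral.integral_add (μ := volume) (a := 0) (b := 2*π)
      ((slice_t cA h0 h1).intervalIntegrable _ _) ((slice_t cB h0 h1).intervalIntegrable _ _)
    rw [z, add_zero] at z2
    rw [← z2]
    congr 1; funext θ
    simp only [hgA, hgB, lap]
    have : ρ ≠ 0 := h0.ne'
    rw [mul_inv]
    generalize (κ^2)⁻¹ = k
    field_simp
    ring
  rw [intervalIntegral.integral_congr e1, rect_swap cA ha hab hb]
  have e2 : ∀ θ ∈ uIcc 0 (2*π), ∫ ρ in a..b, gA (ρ,θ) = b * (p (b,θ) * fr (b,θ))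
      - a * (p (a,θ) * fr (a,θ)) := by
    intro θ _
    apply intervalIntegral.integral_eq_sub_of_hasDerivAt
      (f := fun ρ => ρ * (p (ρ,θ) * fr (ρ,θ)))
    · intro ρ hρ
      rw [uIcc_of_le hab] at hρ
      have hm : (ρ,θ) ∈ B R := mem_B.2 ⟨ha.trans_le hρ.1, hρ.2.trans_lt hb⟩
      have := (hasDerivAt_id ρ).mul ((hp.hr _ hm).mul (hf.hrr _ hm))
      refine HasDerivAt.congr_deriv (f := fun ρ => ρ * (p (ρ,θ) * fr (ρ,θ))) this ?_
      simp only [hgA, id, one_mul]; rfl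
    · apply ContinuousOn.intervalIntegrable
      rw [uIcc_of_le hab]
      exact slice_r cA θ ha hb
  rw [intervalIntegral.integral_congr e2, intervalIntegral.integral_sub]
  · exact (((slice_t (hp.c0.mul hf.cr) (ha.trans_le hab) hb).const_mul b)).intervalIntegrable _ _
  · exact (((slice_t (hp.c0.mul hf.cr) ha (hab.trans_lt hb)).const_mul a)).intervalIntegrable _ _

end ConeH
end

section
open Real MeasureTheory Set Filter Topology
open scoped ENNReal

namespace ConeH

lemma aesm_B {R : ℝ} {f : ℝ × ℝ → ℝ} (h : ContinuousOn f (B R)) :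
    AEStronglyMeasurable f (mu.restrict (B R)) := h.aestronglyMeasurable (B_meas R)

lemma intB_of_le {R : ℝ} {f g : ℝ × ℝ → ℝ} (hg : IntegrableOn g (B R) mu)
    (hf : ContinuousOn f (B R)) (h : ∀ x ∈ B R, |f x| ≤ g x) : IntegrableOn f (B R) mu := by
  refine Integrable.mono' hg (aesm_B hf) ?_
  filter_upwards [ae_restrict_mem (B_meas R)] with x hx using h x hx

lemma contOn_k {R κ : ℝ} : ContinuousOn (fun x : ℝ × ℝ => (κ^2*x.1^2)⁻¹) (B R) := by
  simp_rw [mul_inv, ← inv_pow]; exact continuousOn_const.mul (contOn_fst_inv.pow 2)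

/-- the gradient product -/
noncomputable def qq (κ : ℝ) (fr ft pr pt : ℝ × ℝ → ℝ) (x : ℝ × ℝ) : ℝ :=
  fr x * pr x + (κ^2*x.1^2)⁻¹ * (ft x * pt x)

lemma qq_self (κ : ℝ) (fr ft : ℝ × ℝ → ℝ) (x : ℝ × ℝ) : qq κ fr ft fr ft x = q κ fr ft x := by
  unfold qq q; ring

lemma abs_qq_le (κ : ℝ) (fr ft pr pt : ℝ × ℝ → ℝ) (x : ℝ × ℝ) :
    |qq κ fr ft pr pt x| ≤ q κ fr ft x + q κ pr pt x := by
  unfold qq q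
  have hk : 0 ≤ (κ^2*x.1^2)⁻¹ := by positivity
  rw [abs_le]
  constructor <;>
  nlinarith [sq_nonneg (fr x + pr x), sq_nonneg (fr x - pr x), mul_nonneg hk (sq_nonneg (ft x + pt x)),
    mul_nonneg hk (sq_nonneg (ft x - pt x)), mul_nonneg hk (sq_nonneg (ft x)), mul_nonneg hk (sq_nonneg (pt x)),
    sq_nonneg (fr x), sq_nonneg (pr x)]

lemma contOn_qq {κ R : ℝ} {f fr ft p pr pt : ℝ × ℝ → ℝ}
    (hf : Sl1 R f fr ft) (hp : Sl1 R p pr pt) : ContinuousOn (qq κ fr ft pr pt) (B R) :=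
  (hf.cr.mul hp.cr).add (contOn_k.mul (hf.ct.mul hp.ct))

lemma int_qq {κ R : ℝ} {f fr ft p pr pt : ℝ × ℝ → ℝ}
    (hf : Sl1 R f fr ft) (hp : Sl1 R p pr pt)
    (qf : IntegrableOn (q κ fr ft) (B R) mu) (qp : IntegrableOn (q κ pr pt) (B R) mu) :
    IntegrableOn (qq κ fr ft pr pt) (B R) mu :=
  intB_of_le (qf.add qp) (contOn_qq hf hp) (fun x _ => abs_qq_le _ _ _ _ _ _)

lemma int_pw {κ R M : ℝ} {f fr ft frr ftt p pr pt : ℝ × ℝ → ℝ}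
    (hf : Sl R f fr ft frr ftt) (hp : Sl1 R p pr pt) (hM : ∀ x ∈ B R, |p x| ≤ M)
    (hw : IntegrableOn (fun x => lap κ fr frr ftt x ^ 2) (B R) mu) :
    IntegrableOn (fun x => p x * lap κ fr frr ftt x) (B R) mu := by
  refine intB_of_le (g := fun x => M^2 + lap κ fr frr ftt x ^ 2) ?_ (hp.c0.mul hf.contOn_lap) ?_
  · exact (integrable_const (M^2)).add hw
  · intro x hx
    have := hM x hx
    have h1 : p x ^2 ≤ M^2 := sq_le_sq' (abs_le.1 this).1 (abs_le.1 this).2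
    rw [abs_le]
    constructor <;> nlinarith [sq_nonneg (p x + lap κ fr frr ftt x),
      sq_nonneg (p x - lap κ fr frr ftt x), sq_nonneg (p x), sq_nonneg (lap κ fr frr ftt x)]

lemma ibp {κ R M : ℝ} {f fr ft frr ftt p pr pt : ℝ × ℝ → ℝ}
    (hf : Sl R f fr ft frr ftt) (hp : Sl1 R p pr pt) {r : ℝ} (hr0 : 0 < r)
    (hrR : r < R) (hM : ∀ x ∈ B R, |p x| ≤ M)
    (qf : IntegrableOn (q κ fr ft) (B R) mu) (qp : IntegrableOn (q κ pr pt) (B R) mu)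
    (hw : IntegrableOn (fun x => lap κ fr frr ftt x ^ 2) (B R) mu) :
    ∫ x in B r, (qq κ fr ft pr pt x + p x * lap κ fr frr ftt x) ∂mu
      = ∫ θ in (0:ℝ)..(2*π), r * (p (r,θ) * fr (r,θ)) := by
  have hsub : B r ⊆ B R := B_mono hrR.le
  have hi : IntegrableOn (fun x => qq κ fr ft pr pt x + p x * lap κ fr frr ftt x) (B r) mu :=
    ((int_qq hf.toSl1 hp qf qp).add (int_pw hf hp hM hw)).mono_set hsub
  rw [int_B hr0.le hi]
  have hii := int_B_ii hr0.le hi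
  set h : ℝ → ℝ := fun ρ => ∫ θ in (0:ℝ)..(2*π), ρ * (qq κ fr ft pr pt (ρ,θ)
    + p (ρ,θ) * lap κ fr frr ftt (ρ,θ)) with hh
  set b : ℝ → ℝ := fun ρ => ∫ θ in (0:ℝ)..(2*π), ρ * (p (ρ,θ) * fr (ρ,θ)) with hb
  have key : ∀ ε, 0 < ε → ε ≤ r → b ε = b r - ∫ ρ in ε..r, h ρ := by
    intro ε h0 h1
    have := rect_ibp (κ := κ) hf hp h0 h1 hrR
    simp only [hh, hb, qq]
    rw [this]; ring
  have lim : Tendsto b (𝓝[>] 0) (𝓝 (b r - ∫ ρ in (0:ℝ)..r, h ρ)) := by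
    have c : ContinuousOn (fun ε => ∫ ρ in ε..r, h ρ) (Icc 0 r) := by
      have := intervalIntegral.continuousOn_primitive_interval_left (μ := volume) (f := h)
        (a := 0) (b := r) (by rw [uIcc_of_le hr0.le, integrableOn_Icc_iff_integrableOn_Ioo,
          ← intervalIntegrable_iff_integrableOn_Ioo_of_le hr0.le]; exact hii)
      rwa [uIcc_of_le hr0.le] at this
    have c1 : Tendsto (fun ε => ∫ ρ in ε..r, h ρ) (𝓝[>] 0) (𝓝 (∫ ρ in (0:ℝ)..r, h ρ)) := by
      have := (c 0 (left_mem_Icc.2 hr0.le)).mono (Ioc_subset_Icc_self)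
      rw [ContinuousWithinAt, nhdsWithin_Ioc_eq_nhdsGT hr0] at this
      exact this
    refine (tendsto_const_nhds.sub c1).congr' ?_
    filter_upwards [Ioc_mem_nhdsGT hr0] with ε hε
    rw [key ε hε.1 hε.2]
  -- the limit vanishes
  by_contra hne
  set l := b r - ∫ ρ in (0:ℝ)..r, h ρ with hl
  have hl0 : l ≠ 0 := by
    intro h0; apply hne; rw [hl] at h0; linarith
  have hla : 0 < |l| := abs_pos.2 hl0
  have ev : ∀ᶠ ε in 𝓝[>] (0:ℝ), |l|/2 < |b ε| := by
    have := (continuous_abs.tendsto _).comp lim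
    exact this.eventually (lt_mem_nhds (by linarith))
  obtain ⟨s, hs0, hs⟩ := mem_nhdsGT_iff_exists_Ioo_subset.1 (ev.and (Ioc_mem_nhdsGT hr0))
  have hs0 : 0 < s := hs0
  -- p integrable
  have qi : IntegrableOn (fun x => fr x ^2) (B r) mu := by
    refine (intB_of_le qf (hf.cr.pow 2) ?_).mono_set hsub
    intro x _
    rw [abs_of_nonneg (sq_nonneg _)]; unfold q
    have : 0 ≤ (κ^2*x.1^2)⁻¹ * ft x ^2 := by positivity
    simp only [Pi.pow_apply]; linarith
  have pii := int_B_ii hr0.le qi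
  set c1 : ℝ := |l| / (8*π) with hc1
  have hc1p : 0 < c1 := by positivity
  set N : ℝ := M^2/(4*c1) with hN
  have bound : ∀ ρ ∈ Ioo 0 s, |l|/4 ≤ N * (ρ * ∫ θ in (0:ℝ)..(2*π), ρ * fr (ρ,θ)^2) := by
    intro ρ hρ
    obtain ⟨h1, h2⟩ := hs hρ
    have hρR : ρ < R := h2.2.trans_lt hrR
    have hc := (slice_t hf.cr hρ.1 hρR)
    have hcp := (slice_t hp.c0 hρ.1 hρR)
    have : |b ρ| ≤ ∫ θ in (0:ℝ)..(2*π), (c1 + N * (ρ * (ρ * fr (ρ,θ)^2))) := by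
      simp only [hb]
      refine (intervalIntegral.abs_integral_le_integral_abs (by positivity)).trans ?_
      apply intervalIntegral.integral_mono_on (by positivity)
      · exact (continuous_const.mul (hcp.mul hc)).abs.intervalIntegrable _ _
      · exact (continuous_const.add (continuous_const.mul (continuous_const.mul
          (continuous_const.mul (hc.pow 2))))).intervalIntegrable _ _
      · intro θ _
        have hp1 := hM (ρ,θ) (mem_B.2 ⟨hρ.1, hρR⟩)
        rw [abs_mul, abs_mul, abs_of_pos hρ.1]
        have hsq : fr (ρ,θ)^2 = |fr (ρ,θ)|^2 := (sq_abs _).symm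
        rw [hsq]
        set A := |fr (ρ,θ)|
        have hA : 0 ≤ A := abs_nonneg _
        have e : N * (ρ * (ρ * A^2)) = (M*ρ*A)^2/(4*c1) := by rw [hN]; ring
        rw [e]
        have : ρ * (|p (ρ,θ)| * A) ≤ M*ρ*A := by
          have := mul_le_mul_of_nonneg_right hp1 (mul_nonneg hρ.1.le hA)
          linarith
        refine this.trans ?_
        have : c1 + (M*ρ*A)^2/(4*c1) - M*ρ*A = (M*ρ*A - 2*c1)^2/(4*c1) := by
          field_simp; ring
        have : 0 ≤ (M*ρ*A - 2*c1)^2/(4*c1) := by positivity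
        linarith
    have hcc : IntervalIntegrable (fun θ => N * (ρ * (ρ * fr (ρ,θ)^2))) volume 0 (2*π) :=
      (continuous_const.mul (continuous_const.mul
          (continuous_const.mul (hc.pow 2)))).intervalIntegrable _ _
    rw [intervalIntegral.integral_add (by simp) hcc, intervalIntegral.integral_const,
      intervalIntegral.integral_const_mul, intervalIntegral.integral_const_mul] at this
    have h3 : (2*π - 0) • c1 = |l|/4 := by rw [hc1, smul_eq_mul]; field_simp; ring
    rw [h3] at this
    linarith
  have : IntegrableOn (fun x : ℝ => x ^ (-1:ℝ)) (Ioo 0 s) := by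
    have hsr : s ≤ r := by
      by_contra hc
      push Not at hc
      have := (hs ⟨by linarith, (by linarith : (r+s)/2 < s)⟩ : _ ∧ _).2.2
      linarith
    have pi2 : IntegrableOn (fun ρ => ∫ θ in (0:ℝ)..(2*π), ρ * fr (ρ,θ)^2) (Ioo 0 s) :=
      ((intervalIntegrable_iff_integrableOn_Ioo_of_le hr0.le).1 pii).mono_set
        (Ioo_subset_Ioo_right hsr)
    refine Integrable.mono' (pi2.const_mul (4 * N / |l|)) (by fun_prop) ?_
    filter_upwards [ae_restrict_mem measurableSet_Ioo] with ρ hρ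
    have := bound ρ hρ
    rw [Real.rpow_neg_one, norm_of_nonneg (by have := hρ.1; positivity)]
    have h0 := hρ.1
    rw [inv_le_iff_one_le_mul₀ h0]
    rw [div_mul_eq_mul_div, div_mul_eq_mul_div, le_div_iff₀ hla]
    linarith
  rw [intervalIntegral.integrableOn_Ioo_rpow_iff hs0] at this
  linarith

end ConeH
end

section
open Real MeasureTheory Set Filter Topology
open scoped ENNReal

namespace ConeH

lemma cs1 {g : ℝ → ℝ} {a b : ℝ} (hab : a ≤ b) (hg : ContinuousOn g (Icc a b)) :
    (∫ x in a..b, g x)^2 ≤ (b - a) * ∫ x in a..b, g x ^ 2 := by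
  rcases hab.eq_or_lt with h | h
  · subst h; simp
  set m := (∫ x in a..b, g x) / (b - a) with hm
  have hba : 0 < b - a := by linarith
  have hg' : ContinuousOn g (uIcc a b) := by rwa [uIcc_of_le hab]
  have h0 : 0 ≤ ∫ x in a..b, (g x - m)^2 :=
    intervalIntegral.integral_nonneg hab (fun x _ => sq_nonneg _)
  have e : ∫ x in a..b, (g x - m)^2 = (∫ x in a..b, g x ^2) - 2 * m * (∫ x in a..b, g x)
      + (b-a) * m^2 := by
    have : ∀ x, (g x - m)^2 = (g x ^2 - 2 * m * g x) + m^2 := by intro x; ring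
    simp_rw [this]
    rw [intervalIntegral.integral_add, intervalIntegral.integral_sub,
      intervalIntegral.integral_const_mul, intervalIntegral.integral_const, smul_eq_mul]
    · exact (hg'.pow 2).intervalIntegrable
    · exact (continuousOn_const.mul hg').intervalIntegrable
    · exact ((hg'.pow 2).sub (continuousOn_const.mul hg')).intervalIntegrable
    · simp
  rw [e] at h0
  have h2 : (∫ x in a..b, g x) = m * (b-a) := by rw [hm]; field_simp
  rw [h2] at h0 ⊢
  nlinarith

lemma fth_sq {f f' : ℝ → ℝ} {a b : ℝ} (hab : a ≤ b)
    (hf : ∀ x ∈ Icc a b, HasDerivAt f (f' x) x) (hc : ContinuousOn f' (Icc a b)) :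
    (f b - f a)^2 ≤ (b - a) * ∫ x in a..b, f' x ^ 2 := by
  rw [← intervalIntegral.integral_eq_sub_of_hasDerivAt (f' := f')]
  · exact cs1 hab hc
  · rwa [uIcc_of_le hab]
  · apply ContinuousOn.intervalIntegrable; rwa [uIcc_of_le hab]

lemma circ_sq {R : ℝ} {f fr ft : ℝ × ℝ → ℝ} (h : Sl1 R f fr ft) {r : ℝ} (h0 : 0 < r) (h1 : r < R)
    {θ : ℝ} (hθ : θ ∈ Icc 0 (2*π)) :
    (f (r,θ) - f (r,0))^2 ≤ 2*π * ∫ s in (0:ℝ)..(2*π), ft (r,s)^2 := by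
  have c : Continuous fun s => ft (r,s)^2 := (slice_t h.ct h0 h1).pow 2
  have := fth_sq (f := fun s => f (r,s)) (f' := fun s => ft (r,s)) hθ.1
    (fun x _ => h.ht (r,x) (mem_B.2 ⟨h0,h1⟩)) (slice_t h.ct h0 h1).continuousOn
  refine this.trans ?_
  have hm : ∫ s in (0:ℝ)..θ, ft (r,s)^2 ≤ ∫ s in (0:ℝ)..(2*π), ft (r,s)^2 := by
    apply intervalIntegral.integral_mono_interval le_rfl hθ.1 hθ.2
    · exact Eventually.of_forall (fun x => sq_nonneg _)
    · exact c.intervalIntegrable _ _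
  have h3 : 0 ≤ ∫ s in (0:ℝ)..θ, ft (r,s)^2 :=
    intervalIntegral.integral_nonneg hθ.1 (fun x _ => sq_nonneg _)
  have := hθ.1; have := hθ.2
  nlinarith

/-- radial difference -/
lemma rad_sq {R : ℝ} {f fr ft : ℝ × ℝ → ℝ} (h : Sl1 R f fr ft) {ρ r : ℝ} (h0 : 0 < ρ) (hr : ρ ≤ r)
    (h1 : r < R) (θ : ℝ) :
    ρ * (f (ρ,θ) - f (r,θ))^2 ≤ (r - ρ) * ∫ s in ρ..r, s * fr (s,θ)^2 := by
  have c := slice_r h.cr θ h0 h1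
  have := fth_sq (f := fun s => f (s,θ)) (f' := fun s => fr (s,θ)) hr
    (fun x hx => h.hr (x,θ) (mem_B.2 ⟨h0.trans_le hx.1,hx.2.trans_lt h1⟩)) c
  have h2 : ρ * ∫ s in ρ..r, fr (s,θ)^2 ≤ ∫ s in ρ..r, s * fr (s,θ)^2 := by
    rw [← intervalIntegral.integral_const_mul]
    apply intervalIntegral.integral_mono_on hr
    · apply ContinuousOn.intervalIntegrable; rw [uIcc_of_le hr]
      exact continuousOn_const.mul (c.pow 2)
    · apply ContinuousOn.intervalIntegrable; rw [uIcc_of_le hr]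
      exact continuousOn_id.mul (c.pow 2)
    · intro x hx
      exact mul_le_mul_of_nonneg_right hx.1 (sq_nonneg _)
  have e : (f (ρ,θ) - f (r,θ))^2 = (f (r,θ) - f (ρ,θ))^2 := by ring
  rw [e]
  have := mul_le_mul_of_nonneg_left this h0.le
  have := mul_le_mul_of_nonneg_left h2 (sub_nonneg.2 hr)
  linarith

lemma fr_sq_le_q (κ : ℝ) (fr ft : ℝ × ℝ → ℝ) (x : ℝ × ℝ) : fr x ^ 2 ≤ q κ fr ft x := by
  unfold q
  have : 0 ≤ (κ^2*x.1^2)⁻¹ * ft x ^2 := by positivity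
  linarith

/-- `∫_{B_r} q` between radii. -/
lemma shell_le {κ R : ℝ} {f fr ft : ℝ × ℝ → ℝ} (h : Sl1 R f fr ft) {a r : ℝ} (h0 : 0 < a)
    (hr : a ≤ r) (h1 : r < R) (qf : IntegrableOn (q κ fr ft) (B R) mu) :
    ∫ ρ in a..r, ∫ θ in (0:ℝ)..(2*π), ρ * q κ fr ft (ρ,θ) ≤ ∫ x in B r, q κ fr ft x ∂mu := by
  have qi := qf.mono_set (B_mono h1.le)
  rw [int_B (h0.le.trans hr) qi]
  apply intervalIntegral.integral_mono_interval h0.le hr le_rfl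
  · filter_upwards [ae_restrict_mem measurableSet_Ioc] with ρ hρ
    apply intervalIntegral.integral_nonneg (by positivity)
    intro x _
    exact mul_nonneg hρ.1.le (q_nonneg _ _ _ _)
  · exact int_B_ii (h0.le.trans hr) qi

lemma rad_int {κ R : ℝ} {f fr ft : ℝ × ℝ → ℝ} (h : Sl1 R f fr ft) {ρ r : ℝ} (h0 : 0 < ρ) (hr : ρ ≤ r)
    (h1 : r < R) (qf : IntegrableOn (q κ fr ft) (B R) mu) :
    ∫ θ in (0:ℝ)..(2*π), ρ * (f (ρ,θ) - f (r,θ))^2 ≤ (r - ρ) * ∫ x in B r, q κ fr ft x ∂mu := by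
  have hρR := hr.trans_lt h1
  have cg : ContinuousOn (fun x : ℝ × ℝ => x.1 * fr x ^2) (B R) :=
    continuousOn_fst.mul (h.cr.pow 2)
  have cq : ContinuousOn (fun x : ℝ × ℝ => x.1 * q κ fr ft x) (B R) :=
    continuousOn_fst.mul h.contOn_q
  have e1 : ∫ θ in (0:ℝ)..(2*π), ρ * (f (ρ,θ) - f (r,θ))^2
      ≤ ∫ θ in (0:ℝ)..(2*π), (r-ρ) * ∫ s in ρ..r, s * q κ fr ft (s,θ) := by
    apply intervalIntegral.integral_mono_on (by positivity)
    · exact (continuous_const.mul (((slice_t h.c0 h0 hρR).sub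
        (slice_t h.c0 (h0.trans_le hr) h1)).pow 2)).intervalIntegrable _ _
    · apply IntervalIntegrable.const_mul
      have h2 : (0:ℝ) ≤ 2 * π := by positivity
      have := (rect_int cq h0 h1).mono_set (prod_mono Ioc_subset_Icc_self Ioc_subset_Icc_self :
        Ioc ρ r ×ˢ Ioc 0 (2*π) ⊆ _)
      rw [IntegrableOn, Measure.volume_eq_prod, ← Measure.prod_restrict] at this
      have := this.integral_prod_right
      rw [intervalIntegrable_iff_integrableOn_Ioc_of_le h2]
      simp_rw [intervalIntegral.integral_of_le hr]
      exact this
    · intro θ _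
      refine (rad_sq h h0 hr h1 θ).trans (mul_le_mul_of_nonneg_left ?_ (sub_nonneg.2 hr))
      apply intervalIntegral.integral_mono_on hr
      · apply ContinuousOn.intervalIntegrable; rw [uIcc_of_le hr]
        exact slice_r cg θ h0 h1
      · apply ContinuousOn.intervalIntegrable; rw [uIcc_of_le hr]
        exact slice_r cq θ h0 h1
      · intro s hs
        exact mul_le_mul_of_nonneg_left (fr_sq_le_q _ _ _ _) (h0.le.trans hs.1)
  refine e1.trans ?_
  rw [intervalIntegral.integral_const_mul]
  have := rect_swap cq h0 hr h1
  dsimp only at this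
  rw [← this]
  exact mul_le_mul_of_nonneg_left (shell_le h h0 hr h1 qf) (sub_nonneg.2 hr)

lemma gl_point {κ R M : ℝ} (hκ : 0 < κ) {f fr ft frr ftt : ℝ × ℝ → ℝ}
    (hf : Sl R f fr ft frr ftt) (hM : ∀ x ∈ B R, |f x| ≤ M)
    (qf : IntegrableOn (q κ fr ft) (B R) mu)
    (hw : IntegrableOn (fun x => lap κ fr frr ftt x ^ 2) (B R) mu) {r : ℝ} (h0 : 0 < r) (h1 : r < R) :
    ∫ x in B r, q κ fr ft x ∂mu ≤ (2*π*κ + 2*π^2*κ^2) * (r * ∫ θ in (0:ℝ)..(2*π), r * q κ fr ft (r,θ))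
      + 2 * r^2 * ∫ x in B r, lap κ fr frr ftt x ^2 ∂mu := by
  set c := f (r,0) with hc
  set w := lap κ fr frr ftt with hwd
  set A := ∫ s in (0:ℝ)..(2*π), ft (r,s)^2 with hA
  set F := ∫ s in (0:ℝ)..(2*π), fr (r,s)^2 with hF
  have hA0 : 0 ≤ A := intervalIntegral.integral_nonneg (by positivity) (fun x _ => sq_nonneg _)
  have hF0 : 0 ≤ F := intervalIntegral.integral_nonneg (by positivity) (fun x _ => sq_nonneg _)
  have cft := slice_t hf.ct h0 h1
  have cfr := slice_t hf.cr h0 h1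
  have cf := slice_t hf.c0 h0 h1
  have hP : r * ∫ θ in (0:ℝ)..(2*π), r * q κ fr ft (r,θ) = r^2 * F + (κ^2)⁻¹ * A := by
    have : ∀ θ, r * q κ fr ft (r,θ) = r * fr (r,θ)^2 + (r * (κ^2*r^2)⁻¹) * ft (r,θ)^2 := by
      intro θ; unfold q; ring
    simp_rw [this]
    rw [intervalIntegral.integral_add, intervalIntegral.integral_const_mul,
      intervalIntegral.integral_const_mul, ← hF, ← hA]
    · field_simp
    · exact (continuous_const.mul (cfr.pow 2)).intervalIntegrable _ _
    · exact (continuous_const.mul (cft.pow 2)).intervalIntegrable _ _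
  rw [hP]
  have hp : Sl1 R (fun x => f x - c) fr ft :=
    { per := fun x hx => by simp only [hf.per x hx]
      hr := fun x hx => (hf.hr x hx).sub_const c
      ht := fun x hx => (hf.ht x hx).sub_const c
      c0 := hf.c0.sub continuousOn_const
      cr := hf.cr
      ct := hf.ct }
  have hcM : |c| ≤ M := hM _ (mem_B.2 ⟨h0,h1⟩)
  have hpM : ∀ x ∈ B R, |f x - c| ≤ 2*M := fun x hx => by
    have := abs_sub (f x) c; have := hM x hx; linarith
  have I := ibp hf hp h0 h1 hpM qf qf hw
  have iq := qf.mono_set (B_mono h1.le)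
  have ipw := (int_pw hf hp hpM hw).mono_set (B_mono h1.le)
  have iw := hw.mono_set (B_mono h1.le)
  have ip2 : IntegrableOn (fun x => (f x - c)^2) (B R) mu := by
    refine intB_of_le (g := fun _ => (2*M)^2) (integrable_const _) (hp.c0.pow 2) ?_
    intro x hx
    rw [abs_of_nonneg (sq_nonneg _)]
    exact sq_le_sq' (abs_le.1 (hpM x hx)).1 (abs_le.1 (hpM x hx)).2
  have ip2' := ip2.mono_set (B_mono h1.le)
  simp_rw [qq_self] at I
  rw [integral_add iq ipw] at I
  set φ := ∫ x in B r, q κ fr ft x ∂mu with hφ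
  set W := ∫ x in B r, w x ^2 ∂mu with hW
  -- term 1
  have t1 : ∫ θ in (0:ℝ)..(2*π), r * ((f (r,θ) - c) * fr (r,θ)) ≤ π * κ * (r^2*F + (κ^2)⁻¹*A) := by
    have : ∫ θ in (0:ℝ)..(2*π), r * ((f (r,θ) - c) * fr (r,θ)) ≤
        ∫ θ in (0:ℝ)..(2*π), (A/(2*κ) + π*κ*r^2 * fr (r,θ)^2) := by
      apply intervalIntegral.integral_mono_on (by positivity)
      · exact (continuous_const.mul ((cf.sub continuous_const).mul cfr)).intervalIntegrable _ _
      · exact (continuous_const.add (continuous_const.mul (cfr.pow 2))).intervalIntegrable _ _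
      · intro θ hθ
        have h2 := circ_sq hf.toSl1 h0 h1 hθ
        rw [← hA, ← hc] at h2
        have e : A/(2*κ) = 2*π*A/(4*π*κ) := by field_simp; ring
        rw [e]
        have h3 : (f (r,θ) - c)^2/(4*π*κ) ≤ 2*π*A/(4*π*κ) := by gcongr
        have h4 : (f (r,θ) - c)^2/(4*π*κ) + π*κ*r^2 * fr (r,θ)^2 - r * ((f (r,θ) - c) * fr (r,θ))
          = ((f (r,θ) - c) - 2*π*κ*r*fr (r,θ))^2/(4*π*κ) := by field_simp; ring
        have h5 : 0 ≤ ((f (r,θ) - c) - 2*π*κ*r*fr (r,θ))^2/(4*π*κ) := by positivity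
        linarith
    refine this.trans (le_of_eq ?_)
    have i2 : IntervalIntegrable (fun θ => π*κ*r^2 * fr (r,θ)^2) volume 0 (2*π) :=
      (continuous_const.mul (cfr.pow 2)).intervalIntegrable _ _
    rw [intervalIntegral.integral_add (by simp) i2, intervalIntegral.integral_const,
      intervalIntegral.integral_const_mul, smul_eq_mul, ← hF]
    field_simp; ring
  -- term 2
  have t2 : ∫ x in B r, (f x - c)^2 ∂mu ≤ 2*r^2*φ + 4*π^2*r^2*A := by
    rw [int_B h0.le ip2']
    have : ∫ ρ in (0:ℝ)..r, ∫ θ in (0:ℝ)..(2*π), ρ * (f (ρ,θ) - c)^2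
        ≤ ∫ ρ in (0:ℝ)..r, (2*r*φ + 8*π^2*A*ρ) := by
      apply intervalIntegral.integral_mono_on_of_le_Ioo h0.le (int_B_ii h0.le ip2')
      · exact Continuous.intervalIntegrable (by fun_prop) _ _
      · intro ρ hρ
        have hρR := hρ.2.trans h1
        have h2 := rad_int hf.toSl1 hρ.1 hρ.2.le h1 qf
        rw [← hφ] at h2
        have c1 : Continuous fun θ => ρ * (f (ρ,θ) - f (r,θ))^2 :=
          continuous_const.mul (((slice_t hf.c0 hρ.1 hρR).sub cf).pow 2)
        have : ∫ θ in (0:ℝ)..(2*π), ρ * (f (ρ,θ) - c)^2 ≤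
            ∫ θ in (0:ℝ)..(2*π), (2 * (ρ * (f (ρ,θ) - f (r,θ))^2) + 4*π*A*ρ) := by
          apply intervalIntegral.integral_mono_on (by positivity)
          · exact (continuous_const.mul (((slice_t hf.c0 hρ.1 hρR).sub continuous_const).pow 2)).intervalIntegrable _ _
          · exact ((continuous_const.mul c1).add continuous_const).intervalIntegrable _ _
          · intro θ hθ
            have h2 := circ_sq hf.toSl1 h0 h1 hθ
            rw [← hA, ← hc] at h2
            have h3 : (f (ρ,θ) - c)^2 ≤ 2 * (f (ρ,θ) - f (r,θ))^2 + 2 * (f (r,θ) - c)^2 := by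
              nlinarith [sq_nonneg ((f (ρ,θ) - f (r,θ)) - (f (r,θ) - c))]
            have h4 := mul_le_mul_of_nonneg_left h3 hρ.1.le
            have h5 := mul_le_mul_of_nonneg_left h2 hρ.1.le
            linarith
        refine this.trans ?_
        have i1 : IntervalIntegrable (fun θ => 2 * (ρ * (f (ρ,θ) - f (r,θ))^2)) volume 0 (2*π) :=
          (continuous_const.mul c1).intervalIntegrable _ _
        rw [intervalIntegral.integral_add i1 (by simp), intervalIntegral.integral_const,
          intervalIntegral.integral_const_mul, smul_eq_mul]
        have hφ0 : 0 ≤ φ := setIntegral_nonneg (B_meas r) (fun x _ => q_nonneg _ _ _ _)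
        nlinarith [mul_nonneg hρ.1.le hφ0]
    refine this.trans (le_of_eq ?_)
    rw [intervalIntegral.integral_add (by simp) (Continuous.intervalIntegrable (by fun_prop) _ _),
      intervalIntegral.integral_const, intervalIntegral.integral_const_mul, integral_id, smul_eq_mul]
    ring
  -- combine
  have t3 : - ∫ x in B r, (f x - c) * w x ∂mu ≤ (4*r^2)⁻¹ * (∫ x in B r, (f x - c)^2 ∂mu) + r^2 * W := by
    rw [← integral_neg, hW, ← integral_const_mul, ← integral_const_mul, ← integral_add
      (ip2'.const_mul _) (iw.const_mul _)]
    apply integral_mono ipw.neg ((ip2'.const_mul _).add (iw.const_mul _))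
    intro x
    have h4 : (4*r^2)⁻¹ * (f x - c)^2 + r^2 * w x ^2 - (-((f x - c) * w x))
          = ((f x - c) + 2*r^2* w x)^2/(4*r^2) := by field_simp; ring
    have h5 : 0 ≤ ((f x - c) + 2*r^2* w x)^2/(4*r^2) := by positivity
    change -((f x - c) * w x) ≤ (4*r^2)⁻¹ * (f x - c)^2 + r^2 * w x ^2
    linarith
  have t4 : (4*r^2)⁻¹ * (∫ x in B r, (f x - c)^2 ∂mu) ≤ φ/2 + π^2*A := by
    have : φ/2 + π^2*A = (4*r^2)⁻¹ * (2*r^2*φ + 4*π^2*r^2*A) := by field_simp; ring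
    rw [this]
    exact mul_le_mul_of_nonneg_left t2 (by positivity)
  have hAk : π^2*A ≤ π^2*κ^2*(r^2*F + (κ^2)⁻¹*A) := by
    have : π^2*κ^2*(r^2*F + (κ^2)⁻¹*A) = π^2*κ^2*(r^2*F) + π^2*A := by field_simp
    rw [this]; have : 0 ≤ π^2*κ^2*(r^2*F) := by positivity
    linarith
  linarith

/-- growth lemma -/
lemma growth {κ R M : ℝ} (hκ : 0 < κ) {f fr ft frr ftt : ℝ × ℝ → ℝ}
    (hf : Sl R f fr ft frr ftt) (hM : ∀ x ∈ B R, |f x| ≤ M)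
    (qf : IntegrableOn (q κ fr ft) (B R) mu)
    (hw : IntegrableOn (fun x => lap κ fr frr ftt x ^ 2) (B R) mu) {r1 r2 : ℝ} (h0 : 0 < r1)
    (h12 : r1 ≤ r2) (h1 : r2 < R) :
    (∫ x in B r1, q κ fr ft x ∂mu) * Real.log (r2/r1) ≤
      (2*π*κ + 2*π^2*κ^2) * (∫ x in B r2, q κ fr ft x ∂mu)
      + r2^2 * ∫ x in B r2, lap κ fr frr ftt x ^2 ∂mu := by
  set W := ∫ x in B r2, lap κ fr frr ftt x ^2 ∂mu with hW
  have hW0 : 0 ≤ W := setIntegral_nonneg (B_meas r2) (fun x _ => sq_nonneg _)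
  set φ := ∫ x in B r1, q κ fr ft x ∂mu with hφ
  set P : ℝ → ℝ := fun r => ∫ θ in (0:ℝ)..(2*π), r * q κ fr ft (r,θ) with hP
  have cq : ContinuousOn (fun x : ℝ × ℝ => x.1 * q κ fr ft x) (B R) :=
    continuousOn_fst.mul hf.contOn_q
  have key : ∀ r ∈ Icc r1 r2, φ * r⁻¹ ≤ (2*π*κ + 2*π^2*κ^2) * P r + 2 * W * r := by
    intro r hr
    have hr0 := h0.trans_le hr.1
    have hrR := hr.2.trans_lt h1
    have k := gl_point hκ hf hM qf hw hr0 hrR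
    have k1 : φ ≤ ∫ x in B r, q κ fr ft x ∂mu :=
      setIntegral_mono_set (qf.mono_set (B_mono hrR.le)) (Eventually.of_forall (fun x => q_nonneg _ _ _ _))
        (B_mono hr.1).eventuallyLE
    have k2 : ∫ x in B r, lap κ fr frr ftt x ^2 ∂mu ≤ W :=
      setIntegral_mono_set (hw.mono_set (B_mono h1.le)) (Eventually.of_forall (fun x => sq_nonneg _))
        (B_mono hr.2).eventuallyLE
    rw [← div_eq_mul_inv, div_le_iff₀ hr0]
    have k3 := mul_le_mul_of_nonneg_left k2 (by positivity : 0 ≤ 2*r^2)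
    simp only [hP]
    nlinarith
  have hPi : IntervalIntegrable P volume r1 r2 := rect_ii cq h0 h12 h1
  have inv : IntervalIntegrable (fun r : ℝ => r⁻¹) volume r1 r2 := by
    apply ContinuousOn.intervalIntegrable
    rw [uIcc_of_le h12]
    exact continuousOn_id.inv₀ (fun x hx => (h0.trans_le hx.1).ne')
  have := intervalIntegral.integral_mono_on h12 (inv.const_mul φ)
    ((hPi.const_mul (2*π*κ + 2*π^2*κ^2)).add
    ((intervalIntegral.intervalIntegrable_id (μ := volume)).const_mul (2*W))) key
  rw [intervalIntegral.integral_const_mul, integral_inv_of_pos h0 (h0.trans_le h12),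
    intervalIntegral.integral_add (hPi.const_mul _)
      ((intervalIntegral.intervalIntegrable_id (μ := volume)).const_mul (2*W)),
    intervalIntegral.integral_const_mul, intervalIntegral.integral_const_mul, integral_id] at this
  have s := shell_le hf.toSl1 h0 h12 h1 qf
  have s2 := mul_le_mul_of_nonneg_left s (by positivity : 0 ≤ 2*π*κ + 2*π^2*κ^2)
  simp only [hP] at this
  nlinarith [mul_nonneg hW0 (sq_nonneg r1)]

end ConeH
end

section
open Real MeasureTheory Set Filter Topology
open scoped ENNReal

namespace ConeH

/-- difference quotient of the primitive of `v` -/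
noncomputable def DQ (v : ℝ → ℝ) (h τ : ℝ) : ℝ := h⁻¹ * ∫ σ in τ..(τ+h), v σ

lemma DQ_cont {v : ℝ → ℝ} (hv : Continuous v) (h : ℝ) : Continuous (DQ v h) := by
  unfold DQ
  apply continuous_const.mul
  have e : ∀ τ, ∫ σ in τ..(τ+h), v σ = (∫ σ in (0:ℝ)..(τ+h), v σ) - ∫ σ in (0:ℝ)..τ, v σ := by
    intro τ
    rw [eq_sub_iff_add_eq, add_comm, intervalIntegral.integral_add_adjacent_intervals] <;>
    exact hv.intervalIntegrable _ _
  simp_rw [e]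
  have c : Continuous fun t => ∫ σ in (0:ℝ)..t, v σ :=
    intervalIntegral.continuous_primitive (fun a b => hv.intervalIntegrable a b) 0
  exact (c.comp (continuous_id.add continuous_const)).sub c

lemma DQ_tendsto {v : ℝ → ℝ} (hv : Continuous v) (τ : ℝ) {h : ℕ → ℝ}
    (h0 : ∀ n, h n ≠ 0) (hl : Tendsto h atTop (𝓝 0)) :
    Tendsto (fun n => DQ v (h n) τ) atTop (𝓝 (v τ)) := by
  have d : HasDerivAt (fun t => ∫ σ in τ..t, v σ) (v τ) τ :=
    intervalIntegral.integral_hasDerivAt_right (hv.intervalIntegrable _ _)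
      (hv.stronglyMeasurableAtFilter _ _) hv.continuousAt
  have := d.tendsto_slope_zero.comp (tendsto_nhdsWithin_iff.2 ⟨hl, Eventually.of_forall h0⟩)
  simpa [DQ, Function.comp_def] using this

lemma DQ_sq {v : ℝ → ℝ} (hv : Continuous v) {h : ℝ} (h0 : 0 < h) (τ : ℝ) :
    DQ v h τ ^ 2 ≤ h⁻¹ * ∫ σ in (0:ℝ)..h, v (τ + σ)^2 := by
  have := cs1 (g := v) (a := τ) (b := τ + h) (by linarith) hv.continuousOn
  have e : ∫ σ in (0:ℝ)..h, v (τ + σ)^2 = ∫ σ in τ..(τ+h), v σ^2 := by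
    rw [intervalIntegral.integral_comp_add_left (fun x => v x ^2)]; simp
  rw [e, DQ, mul_pow]
  have h2 := mul_le_mul_of_nonneg_left this (by positivity : 0 ≤ (h⁻¹)^2)
  refine h2.trans (le_of_eq ?_)
  field_simp
  ring

lemma DQ_sq_int {v : ℝ → ℝ} (hv : Continuous v) {h s t T : ℝ} (h0 : 0 < h) (hs : 0 ≤ s) (hst : s ≤ t)
    (ht : t + h ≤ T) : ∫ τ in s..t, DQ v h τ ^ 2 ≤ ∫ τ in (0:ℝ)..T, v τ ^2 := by
  have c2 : Continuous fun p : ℝ × ℝ => v (p.1 + p.2)^2 := by fun_prop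
  have e1 : ∫ τ in s..t, DQ v h τ ^ 2 ≤ ∫ τ in s..t, h⁻¹ * ∫ σ in (0:ℝ)..h, v (τ + σ)^2 := by
    apply intervalIntegral.integral_mono_on hst
    · exact ((DQ_cont hv h).pow 2).intervalIntegrable _ _
    · apply Continuous.intervalIntegrable
      apply continuous_const.mul
      exact intervalIntegral.continuous_parametric_intervalIntegral_of_continuous' (by exact c2) _ _
    · intro τ _; exact DQ_sq hv h0 τ
  refine e1.trans ?_
  rw [intervalIntegral.integral_const_mul, intervalIntegral_intervalIntegral_swap]
  · have : ∫ σ in (0:ℝ)..h, ∫ τ in s..t, v (τ + σ)^2 ≤ ∫ σ in (0:ℝ)..h, (∫ τ in (0:ℝ)..T, v τ ^2) := by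
      apply intervalIntegral.integral_mono_on h0.le
      · apply Continuous.intervalIntegrable
        exact intervalIntegral.continuous_parametric_intervalIntegral_of_continuous'
          (f := fun σ τ => v (τ+σ)^2) (by unfold Function.uncurry; fun_prop) _ _
      · simp
      · intro σ hσ
        rw [intervalIntegral.integral_comp_add_right (fun x => v x ^2)]
        apply intervalIntegral.integral_mono_interval
        · linarith [hσ.1]
        · linarith
        · linarith [hσ.2]
        · exact Eventually.of_forall (fun x => sq_nonneg _)
        · exact (hv.pow 2).intervalIntegrable _ _
    have := mul_le_mul_of_nonneg_left this (by positivity : 0 ≤ h⁻¹)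
    refine this.trans (le_of_eq ?_)
    rw [intervalIntegral.integral_const, smul_eq_mul]; field_simp; ring
  · have := (c2.continuousOn (s := uIcc s t ×ˢ uIcc 0 h)).integrableOn_compact
      (μ := volume) (isCompact_uIcc.prod isCompact_uIcc)
    have := this.mono_set (prod_mono uIoc_subset_uIcc uIoc_subset_uIcc)
    exact this

lemma DQ_bdd {v : ℝ → ℝ} (hv : Continuous v) (T : ℝ) : ∃ V, 0 ≤ V ∧
    ∀ h τ, 0 < h → 0 ≤ τ → τ + h ≤ T → |DQ v h τ| ≤ V := by
  obtain ⟨V, hV⟩ := isCompact_Icc.exists_bound_of_continuousOn (hv.continuousOn (s := Icc 0 T))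
  refine ⟨|V|, abs_nonneg _, fun h τ h0 h1 h2 => ?_⟩
  rw [DQ, abs_mul, abs_of_pos (inv_pos.2 h0), inv_mul_le_iff₀ h0]
  have := intervalIntegral.norm_integral_le_of_norm_le_const (a := τ) (b := τ+h) (f := v) (C := |V|)
    (by
      intro x hx
      rw [uIoc_of_le (by linarith)] at hx
      exact (hV x ⟨by linarith [hx.1], by linarith [hx.2]⟩).trans (le_abs_self _))
  rw [add_sub_cancel_left, abs_of_pos h0, mul_comm] at this
  exact this

lemma young_int {f g : ℝ → ℝ} {a b c d : ℝ} (hab : a ≤ b)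
    (f2 : IntervalIntegrable (fun x => f x ^2) volume a b)
    (g2 : IntervalIntegrable (fun x => g x ^2) volume a b)
    (hf : AEStronglyMeasurable f (volume.restrict (Ioc a b)))
    (hg : AEStronglyMeasurable g (volume.restrict (Ioc a b)))
    (hc : ∫ x in a..b, f x ^2 ≤ c) (hd : ∫ x in a..b, g x ^2 ≤ d) :
    IntervalIntegrable (fun x => f x * g x) volume a b ∧ ∫ x in a..b, |f x * g x| ≤ (c+d)/2 := by
  have hb : ∀ x, |f x * g x| ≤ (f x ^2 + g x ^2) * (1/2) := by
    intro x
    rw [abs_le]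
    constructor <;> nlinarith [sq_nonneg (f x + g x), sq_nonneg (f x - g x)]
  have i1 : IntervalIntegrable (fun x => (f x ^2 + g x ^2) * (1/2)) volume a b :=
    (f2.add g2).mul_const _
  have i2 : IntervalIntegrable (fun x => f x * g x) volume a b := by
    rw [intervalIntegrable_iff_integrableOn_Ioc_of_le hab] at i1 ⊢
    exact Integrable.mono' i1 (hf.mul hg) (Eventually.of_forall hb)
  refine ⟨i2, ?_⟩
  have := intervalIntegral.integral_mono_on hab i2.abs i1 (fun x _ => hb x)
  rw [intervalIntegral.integral_mul_const, intervalIntegral.integral_add f2 g2] at this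
  linarith

section perx
variable {v K : ℝ → ℝ} {s t T : ℝ} 

lemma px_a (hv : Continuous v) (hK : Measurable K) (K2 : IntegrableOn (fun τ => K τ ^2) (Icc 0 T))
    (hs : 0 ≤ s) (hst : s ≤ t) {h : ℝ} (h0 : 0 < h) (ht : t + h ≤ T) :
    IntervalIntegrable (fun τ => DQ v h τ * K τ) volume s t ∧
    ∫ τ in s..t, |DQ v h τ * K τ| ≤ ((∫ τ in (0:ℝ)..T, v τ ^2) + ∫ τ in (0:ℝ)..T, K τ ^2)/2 := by
  have iK : IntervalIntegrable (fun τ => K τ ^2) volume 0 T := by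
    rw [intervalIntegrable_iff_integrableOn_Icc_of_le (by linarith)]; exact K2
  apply young_int hst (((DQ_cont hv h).pow 2).intervalIntegrable _ _) 
  · apply iK.mono_set
    rw [uIcc_of_le hst, uIcc_of_le (by linarith)]
    exact Icc_subset_Icc hs (by linarith)
  · exact (DQ_cont hv h).aestronglyMeasurable
  · exact hK.aestronglyMeasurable
  · exact DQ_sq_int hv h0 hs hst ht
  · exact intervalIntegral.integral_mono_interval hs hst (by linarith)
      (Eventually.of_forall (fun x => sq_nonneg _)) iK

lemma px_b (hv : Continuous v) (hK : Measurable K) (K2 : IntegrableOn (fun τ => K τ ^2) (Icc 0 T))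
    (hs : 0 ≤ s) (hst : s ≤ t) {h : ℝ} (h0 : 0 < h) (ht : t + h ≤ T) :
    IntervalIntegrable (fun τ => DQ v h τ * K (τ + h)) volume s t ∧
    ∫ τ in s..t, |DQ v h τ * K (τ + h)| ≤ ((∫ τ in (0:ℝ)..T, v τ ^2) + ∫ τ in (0:ℝ)..T, K τ ^2)/2 := by
  have iK : IntervalIntegrable (fun τ => K τ ^2) volume 0 T := by
    rw [intervalIntegrable_iff_integrableOn_Icc_of_le (by linarith)]; exact K2
  have iK2 : IntervalIntegrable (fun τ => K τ ^2) volume (s+h) (t+h) := by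
    apply iK.mono_set
    rw [uIcc_of_le (by linarith), uIcc_of_le (by linarith)]
    exact Icc_subset_Icc (by linarith) (by linarith)
  apply young_int hst (((DQ_cont hv h).pow 2).intervalIntegrable _ _) 
  · have := iK2.comp_add_right h
    simpa using this
  · exact (DQ_cont hv h).aestronglyMeasurable
  · exact (hK.comp (measurable_id.add_const h)).aestronglyMeasurable
  · exact DQ_sq_int hv h0 hs hst ht
  · rw [intervalIntegral.integral_comp_add_right (fun x => K x ^2)]
    exact intervalIntegral.integral_mono_interval (by linarith) (by linarith) (by linarith)
      (Eventually.of_forall (fun x => sq_nonneg _)) iK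

lemma K_int (hK : Measurable K) (K2 : IntegrableOn (fun τ => K τ ^2) (Icc 0 T)) :
    IntegrableOn K (Icc 0 T) := by
  refine Integrable.mono' (K2.add (integrable_const (1:ℝ))) hK.aestronglyMeasurable ?_
  refine Eventually.of_forall (fun x => ?_)
  simp only [Pi.add_apply, norm_eq_abs]
  rw [abs_le]; constructor <;> nlinarith [sq_nonneg (K x + 1), sq_nonneg (K x - 1)]

lemma px_c (hv : Continuous v) (hK : Measurable K) (K2 : IntegrableOn (fun τ => K τ ^2) (Icc 0 T))
    (hs : 0 ≤ s) (hst : s ≤ t) {h : ℕ → ℝ} (h0 : ∀ n, 0 < h n) (ht : ∀ n, t + h n ≤ T)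
    (hl : Tendsto h atTop (𝓝 0)) :
    Tendsto (fun n => ∫ τ in s..t, DQ v (h n) τ * K τ) atTop (𝓝 (∫ τ in s..t, v τ * K τ)) := by
  obtain ⟨V, hV0, hV⟩ := DQ_bdd hv T
  have iK : IntervalIntegrable K volume s t := by
    rw [intervalIntegrable_iff_integrableOn_Icc_of_le hst]
    exact (K_int hK K2).mono_set (Icc_subset_Icc hs (by linarith [h0 0, ht 0]))
  apply intervalIntegral.tendsto_integral_filter_of_dominated_convergence (fun τ => V * |K τ|)
  · refine Eventually.of_forall (fun n => ?_)
    exact (DQ_cont hv _).aestronglyMeasurable.mul hK.aestronglyMeasurable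
  · refine Eventually.of_forall (fun n => Eventually.of_forall (fun x hx => ?_))
    rw [uIoc_of_le hst] at hx
    rw [norm_mul, norm_eq_abs, norm_eq_abs]
    exact mul_le_mul_of_nonneg_right (hV _ _ (h0 n) (by linarith [hx.1]) (by linarith [hx.2, ht n])) (abs_nonneg _)
  · exact iK.abs.const_mul V
  · refine Eventually.of_forall (fun x _ => ?_)
    exact (DQ_tendsto hv x (fun n => (h0 n).ne') hl).mul_const _

lemma px_d (hv : Continuous v) (hK : Measurable K) (K2 : IntegrableOn (fun τ => K τ ^2) (Icc 0 T))
    (hs : 0 ≤ s) (hst : s ≤ t) {h : ℕ → ℝ} (h0 : ∀ n, 0 < h n) (ht : ∀ n, t + h n ≤ T)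
    (hl : Tendsto h atTop (𝓝 0)) :
    Tendsto (fun n => ∫ τ in s..t, DQ v (h n) τ * K (τ + h n)) atTop (𝓝 (∫ τ in s..t, v τ * K τ)) := by
  obtain ⟨V, hV0, hV⟩ := DQ_bdd hv T
  have hT : 0 ≤ T := by linarith [h0 0, ht 0]
  have hneg : ∀ n τ, DQ v (h n) (τ - h n) = DQ v (-h n) τ := by
    intro n τ
    unfold DQ
    rw [sub_add_cancel, ← sub_eq_add_neg, intervalIntegral.integral_symm (τ - h n) τ, inv_neg]; ring
  have e : ∀ n, ∫ τ in s..t, DQ v (h n) τ * K (τ + h n) =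
      ∫ τ in Icc 0 T, (Ioc (s + h n) (t + h n)).indicator (fun τ => DQ v (h n) (τ - h n) * K τ) τ := by
    intro n
    have := intervalIntegral.integral_comp_add_right (a := s) (b := t)
      (fun τ => DQ v (h n) (τ - h n) * K τ) (h n)
    simp only [add_sub_cancel_right] at this
    rw [this, intervalIntegral.integral_of_le (by linarith), setIntegral_indicator measurableSet_Ioc,
      inter_eq_right.2]
    intro x hx
    exact ⟨by linarith [hx.1, h0 n], by linarith [hx.2, ht n]⟩
  have e2 : ∫ τ in s..t, v τ * K τ = ∫ τ in Icc 0 T, (Ioc s t).indicator (fun τ => v τ * K τ) τ := by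
    rw [intervalIntegral.integral_of_le (by linarith), setIntegral_indicator measurableSet_Ioc,
      inter_eq_right.2]
    intro x hx
    exact ⟨by linarith [hx.1], by linarith [hx.2, ht 0, h0 0]⟩
  simp_rw [e, e2]
  apply tendsto_integral_of_dominated_convergence (fun τ => V * |K τ|)
  · intro n
    refine AEStronglyMeasurable.indicator ?_ measurableSet_Ioc
    exact ((DQ_cont hv _).comp (continuous_id.sub continuous_const)).aestronglyMeasurable.mul
      hK.aestronglyMeasurable
  · exact (K_int hK K2).abs.const_mul V
  · intro n
    refine Eventually.of_forall (fun τ => ?_)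
    by_cases hτ : τ ∈ Ioc (s + h n) (t + h n)
    · rw [indicator_of_mem hτ, norm_mul, norm_eq_abs, norm_eq_abs]
      exact mul_le_mul_of_nonneg_right (hV _ _ (h0 n) (by linarith [hτ.1]) (by linarith [hτ.2, ht n])) (abs_nonneg _)
    · rw [indicator_of_notMem hτ, norm_zero]; positivity
  · have hne : ∀ᵐ τ ∂(volume.restrict (Icc 0 T)), τ ≠ s ∧ τ ≠ t := by
      apply ae_restrict_of_ae
      have h1 : ∀ a : ℝ, ∀ᵐ τ : ℝ, τ ≠ a := fun a => by
        rw [ae_iff]; simp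
      filter_upwards [h1 s, h1 t] with τ a b using ⟨a,b⟩
    filter_upwards [hne] with τ hτ
    have lim := (DQ_tendsto hv τ (h := fun n => - h n) (fun n => by simp [(h0 n).ne'])
      (by simpa using hl.neg)).mul_const (K τ)
    simp_rw [← hneg] at lim
    rcases lt_or_gt_of_ne hτ.1 with h1 | h1
    · rw [indicator_of_notMem (by simp only [mem_Ioc]; intro h; linarith [h.1])]
      apply tendsto_const_nhds.congr
      intro n
      rw [indicator_of_notMem (by simp only [mem_Ioc]; intro h; linarith [h.1, h0 n])]
    · rcases lt_or_gt_of_ne hτ.2 with h2 | h2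
      · rw [indicator_of_mem (by exact ⟨h1, h2.le⟩)]
        apply lim.congr'
        have : ∀ᶠ n in atTop, h n < τ - s := hl.eventually (gt_mem_nhds (by linarith))
        filter_upwards [this] with n hn
        rw [indicator_of_mem]
        exact ⟨by linarith, by linarith [h0 n]⟩
      · rw [indicator_of_notMem (by simp only [mem_Ioc]; intro h; linarith [h.2])]
        apply tendsto_const_nhds.congr'
        have : ∀ᶠ n in atTop, h n < τ - t := hl.eventually (gt_mem_nhds (by linarith))
        filter_upwards [this] with n hn
        rw [indicator_of_notMem (by simp only [mem_Ioc]; intro h; linarith [h.2])]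

end perx

end ConeH
end

section
open Real MeasureTheory Set Filter Topology
open scoped ENNReal

namespace ConeH

lemma DQ_meas {X : Type*} [MeasurableSpace X] {v : X → ℝ → ℝ} (hv : ∀ x, Continuous (v x))
    (mv : Measurable (fun p : X × ℝ => v p.1 p.2)) (h : ℝ) :
    Measurable (fun p : X × ℝ => DQ (v p.1) h p.2) := by
  have : Measurable (Function.uncurry fun (τ : ℝ) (x : X) => DQ (v x) h τ) := by
    apply measurable_uncurry_of_continuous_of_measurable
    · intro x; exact DQ_cont (hv x) h
    · intro τ
      unfold DQ
      apply Measurable.const_mul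
      simp only [intervalIntegral]
      apply Measurable.sub
      · exact (mv.stronglyMeasurable.integral_prod_right (ν := volume.restrict (Ioc τ (τ+h)))).measurable
      · exact (mv.stronglyMeasurable.integral_prod_right (ν := volume.restrict (Ioc (τ+h) τ))).measurable
  exact this.comp measurable_swap

lemma prod_int_of_bound {X : Type*} [MeasurableSpace X] {μ : Measure X} [SFinite μ]
    {G : X × ℝ → ℝ} (mG : Measurable G) {s t : ℝ} (hst : s ≤ t) {b : X → ℝ} (hb : Integrable b μ)
    (h : ∀ᵐ x ∂μ, IntervalIntegrable (fun τ => G (x,τ)) volume s t ∧ ∫ τ in s..t, |G (x,τ)| ≤ b x) :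
    Integrable G (μ.prod (volume.restrict (Ioc s t))) := by
  rw [integrable_prod_iff mG.aestronglyMeasurable]
  constructor
  · filter_upwards [h] with x hx
    rw [intervalIntegrable_iff_integrableOn_Ioc_of_le hst] at hx
    exact hx.1
  · refine Integrable.mono' hb ?_ ?_
    · exact (mG.norm.stronglyMeasurable.integral_prod_right' (ν := volume.restrict (Ioc s t))).aestronglyMeasurable
    · filter_upwards [h] with x hx
      rw [norm_of_nonneg (integral_nonneg (fun _ => norm_nonneg _))]
      rw [intervalIntegral.integral_of_le hst] at hx
      exact hx.2

/-- abstract time lemma -/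
lemma timeLemma {X : Type*} [MeasurableSpace X] {μ : Measure X} [SFinite μ] {T : ℝ} (hT : 0 < T)
    {u v K : X → ℝ → ℝ} {I : ℝ → ℝ}
    (hv : ∀ x, Continuous (v x))
    (hu : ∀ᵐ x ∂μ, ∀ s ∈ Icc 0 T, ∀ t ∈ Icc 0 T, u x t - u x s = ∫ τ in s..t, v x τ)
    (mv : Measurable (fun p : X × ℝ => v p.1 p.2))
    (mK : Measurable (fun p : X × ℝ => K p.1 p.2))
    (v2 : Integrable (fun p : X × ℝ => v p.1 p.2 ^ 2) (μ.prod (volume.restrict (Icc 0 T))))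
    (K2 : Integrable (fun p : X × ℝ => K p.1 p.2 ^ 2) (μ.prod (volume.restrict (Icc 0 T))))
    (Ii : IntegrableOn I (Icc 0 T)) {good : ℝ → Prop}
    (hgood : ∀ᵐ t ∂(volume.restrict (Icc 0 T)), good t)
    (hI : ∀ s ∈ Icc 0 T, ∀ t ∈ Icc 0 T, good s → good t →
      I t - I s = -∫ x, (u x t - u x s) * (K x s + K x t) ∂μ) :
    ∃ good2 : ℝ → Prop, (∀ᵐ t ∂(volume.restrict (Icc 0 T)), good2 t) ∧
      ∀ s ∈ Icc 0 T, ∀ t ∈ Icc 0 T, s ≤ t → good2 s → good2 t →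
        I t - I s = - (2 * ∫ τ in s..t, ∫ x, v x τ * K x τ ∂μ) := by
  have Iii : IntervalIntegrable I volume 0 T := by
    rw [intervalIntegrable_iff_integrableOn_Icc_of_le hT.le]; exact Ii
  refine ⟨fun s => s ∈ Ioo 0 T ∧ HasDerivAt (fun x => ∫ τ in (0:ℝ)..x, I τ) (I s) s, ?_, ?_⟩
  · have h1 := ae_restrict_of_ae (s := Icc 0 T) Iii.ae_hasDerivAt_integral
    have h2 : ∀ᵐ t ∂(volume.restrict (Icc 0 T)), t ∈ Ioo 0 T := by
      rw [← restrict_Ioo_eq_restrict_Icc]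
      exact ae_restrict_mem measurableSet_Ioo
    filter_upwards [h1, h2] with t a b
    have hm : t ∈ uIcc 0 T := by rw [uIcc_of_le hT.le]; exact Ioo_subset_Icc_self b
    exact ⟨b, a hm 0 left_mem_uIcc⟩
  rintro s - t - hst ⟨hs, ds⟩ ⟨ht, dt⟩
  set h : ℕ → ℝ := fun n => (T - t) * (1 / ((n:ℝ) + 1)) with hh
  have hε : 0 < T - t := by linarith [ht.2]
  have h0 : ∀ n, 0 < h n := fun n => by simp only [hh]; positivity
  have hle : ∀ n, t + h n ≤ T := fun n => by
    have : (T - t) * (1 / ((n:ℝ) + 1)) ≤ (T - t) * 1 := by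
      apply mul_le_mul_of_nonneg_left _ hε.le
      rw [div_le_one (by positivity)]; linarith [(Nat.cast_nonneg n : (0:ℝ) ≤ n)]
    simp only [hh]; linarith
  have hl : Tendsto h atTop (𝓝 0) := by
    have := (tendsto_one_div_add_atTop_nhds_zero_nat (𝕜 := ℝ)).const_mul (T - t)
    simpa [hh] using this
  have hl' : Tendsto h atTop (𝓝[≠] 0) :=
    tendsto_nhdsWithin_iff.2 ⟨hl, Eventually.of_forall (fun n => (h0 n).ne')⟩
  have iI : ∀ a b, 0 ≤ a → a ≤ b → b ≤ T → IntervalIntegrable I volume a b := by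
    intro a b h1 h2 h3
    apply Iii.mono_set
    rw [uIcc_of_le h2, uIcc_of_le hT.le]
    exact Icc_subset_Icc h1 h3
  -- left side
  have L : Tendsto (fun n => (h n)⁻¹ * ∫ τ in s..t, (I (τ + h n) - I τ)) atTop (𝓝 (I t - I s)) := by
    have := (dt.tendsto_slope_zero.comp hl').sub (ds.tendsto_slope_zero.comp hl')
    refine this.congr (fun n => ?_)
    have hn := h0 n
    have hn2 := hle n
    simp only [Function.comp, smul_eq_mul]
    rw [← mul_sub]
    congr 1
    have ish : IntervalIntegrable (fun τ => I (τ + h n)) volume s t := by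
      have := (iI (s + h n) (t + h n) (by linarith [hs.1]) (by linarith) hn2).comp_add_right (h n)
      simpa using this
    rw [intervalIntegral.integral_sub ish (iI s t hs.1.le hst ht.2.le),
      intervalIntegral.integral_comp_add_right]
    have a1 := intervalIntegral.integral_add_adjacent_intervals (iI 0 s le_rfl hs.1.le hs.2.le)
      (iI s t hs.1.le hst ht.2.le)
    have a2 := intervalIntegral.integral_add_adjacent_intervals (iI 0 (s + h n) le_rfl (by linarith [hs.1]) (by linarith))
      (iI (s + h n) (t + h n) (by linarith [hs.1]) (by linarith) hn2)
    linarith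
  -- x-wise data
  set m : X → ℝ := fun x => ((∫ τ in (0:ℝ)..T, v x τ ^2) + ∫ τ in (0:ℝ)..T, K x τ ^2)/2 with hm
  have im : Integrable m μ := by
    have a := v2.integral_prod_left
    have b := K2.integral_prod_left
    simp only [integral_Icc_eq_integral_Ioc, ← intervalIntegral.integral_of_le hT.le] at a b
    exact (a.add b).div_const 2
  have K2x : ∀ᵐ x ∂μ, IntegrableOn (fun τ => K x τ ^2) (Icc 0 T) := K2.prod_right_ae
  have mKx : ∀ x, Measurable (K x) := fun x => mK.comp measurable_prodMk_left
  set GA : ℕ → X × ℝ → ℝ := fun n p => DQ (v p.1) (h n) p.2 * K p.1 p.2 with hGA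
  set GB : ℕ → X × ℝ → ℝ := fun n p => DQ (v p.1) (h n) p.2 * K p.1 (p.2 + h n) with hGB
  have mA : ∀ n, Measurable (GA n) := fun n => (DQ_meas hv mv (h n)).mul mK
  have mB : ∀ n, Measurable (GB n) := fun n => (DQ_meas hv mv (h n)).mul
    (mK.comp (measurable_fst.prodMk (measurable_snd.add_const (h n))))
  have pA : ∀ n, ∀ᵐ x ∂μ, IntervalIntegrable (fun τ => GA n (x,τ)) volume s t ∧
      ∫ τ in s..t, |GA n (x,τ)| ≤ m x := fun n => by
    filter_upwards [K2x] with x hx using px_a (hv x) (mKx x) hx hs.1.le hst (h0 n) (hle n)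
  have pB : ∀ n, ∀ᵐ x ∂μ, IntervalIntegrable (fun τ => GB n (x,τ)) volume s t ∧
      ∫ τ in s..t, |GB n (x,τ)| ≤ m x := fun n => by
    filter_upwards [K2x] with x hx using px_b (hv x) (mKx x) hx hs.1.le hst (h0 n) (hle n)
  have iA : ∀ n, Integrable (GA n) (μ.prod (volume.restrict (Ioc s t))) := fun n =>
    prod_int_of_bound (mA n) hst im (pA n)
  have iB : ∀ n, Integrable (GB n) (μ.prod (volume.restrict (Ioc s t))) := fun n =>
    prod_int_of_bound (mB n) hst im (pB n)
  have cnv : ∀ G : ℕ → X × ℝ → ℝ, (∀ n, Measurable (G n)) →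
      (∀ n, ∀ᵐ x ∂μ, IntervalIntegrable (fun τ => G n (x,τ)) volume s t ∧
      ∫ τ in s..t, |G n (x,τ)| ≤ m x) →
      (∀ᵐ x ∂μ, Tendsto (fun n => ∫ τ in s..t, G n (x,τ)) atTop (𝓝 (∫ τ in s..t, v x τ * K x τ))) →
      Tendsto (fun n => ∫ x, (∫ τ in s..t, G n (x,τ)) ∂μ) atTop
        (𝓝 (∫ x, (∫ τ in s..t, v x τ * K x τ) ∂μ)) := by
    intro G mG pG lG
    apply tendsto_integral_of_dominated_convergence m _ im _ lG
    · intro n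
      simp_rw [intervalIntegral.integral_of_le hst]
      exact ((mG n).stronglyMeasurable.integral_prod_right' (ν := volume.restrict (Ioc s t))).aestronglyMeasurable
    · intro n
      filter_upwards [pG n] with x hx
      exact (intervalIntegral.abs_integral_le_integral_abs hst).trans hx.2
  have cA := cnv GA mA pA (by
    filter_upwards [K2x] with x hx using px_c (hv x) (mKx x) hx hs.1.le hst h0 hle hl)
  have cB := cnv GB mB pB (by
    filter_upwards [K2x] with x hx using px_d (hv x) (mKx x) hx hs.1.le hst h0 hle hl)
  -- identify
  have sw : ∀ G : X × ℝ → ℝ, Integrable G (μ.prod (volume.restrict (Ioc s t))) →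
      ∫ τ in s..t, ∫ x, G (x,τ) ∂μ = ∫ x, (∫ τ in s..t, G (x,τ)) ∂μ := by
    intro G hG
    simp_rw [intervalIntegral.integral_of_le hst]
    exact (integral_integral_swap (f := fun x τ => G (x,τ)) hG).symm
  have E : ∀ n, (h n)⁻¹ * ∫ τ in s..t, (I (τ + h n) - I τ) =
      -((∫ x, (∫ τ in s..t, GA n (x,τ)) ∂μ) + ∫ x, (∫ τ in s..t, GB n (x,τ)) ∂μ) := by
    intro n
    have hn := h0 n
    have hn2 := hle n
    rw [← sw _ (iA n), ← sw _ (iB n), ← intervalIntegral.integral_const_mul,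
      ← intervalIntegral.integral_add, ← intervalIntegral.integral_neg]
    rotate_left
    · rw [intervalIntegrable_iff_integrableOn_Ioc_of_le hst]
      exact (iA n).integral_prod_right
    · rw [intervalIntegrable_iff_integrableOn_Ioc_of_le hst]
      exact (iB n).integral_prod_right
    simp_rw [intervalIntegral.integral_of_le hst]
    apply integral_congr_ae
    have hsub : Ioc s t ⊆ Icc 0 T :=
      fun x hx => ⟨by linarith [hs.1, hx.1], by linarith [hx.2, ht.2]⟩
    have g1 : ∀ᵐ τ ∂(volume.restrict (Ioc s t)), good τ :=
      ae_restrict_of_ae_restrict_of_subset hsub hgood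
    have g2 : ∀ᵐ τ ∂(volume.restrict (Ioc s t)), good (τ + h n) := by
      have g3 : ∀ᵐ τ : ℝ, τ ∈ Icc 0 T → good τ := (ae_restrict_iff' measurableSet_Icc).1 hgood
      have g4 := (measurePreserving_add_right (volume : Measure ℝ) (h n)).quasiMeasurePreserving.ae g3
      rw [ae_restrict_iff' measurableSet_Ioc]
      filter_upwards [g4] with τ a b
      exact a ⟨by linarith [hs.1, b.1], by linarith [b.2]⟩
    have a1 := (iA n).prod_left_ae
    have a2 := (iB n).prod_left_ae
    filter_upwards [g1, g2, a1, a2, ae_restrict_mem measurableSet_Ioc] with τ g1 g2 a1 a2 hτ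
    have m1 : τ ∈ Icc 0 T := ⟨by linarith [hs.1, hτ.1], by linarith [hτ.2, ht.2]⟩
    have m2 : τ + h n ∈ Icc 0 T := ⟨by linarith [hs.1, hτ.1], by linarith [hτ.2]⟩
    rw [hI τ m1 (τ + h n) m2 g1 g2, mul_neg, ← integral_add a1 a2, ← integral_const_mul]
    congr 1
    apply integral_congr_ae
    filter_upwards [hu] with x hx
    rw [hx τ m1 (τ + h n) m2]
    simp only [hGA, hGB, DQ]
    ring
  have L2 := (cA.add cB).neg
  have L3 := L.congr E
  rw [tendsto_nhds_unique L3 L2]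
  rw [show (∫ τ in s..t, ∫ x, v x τ * K x τ ∂μ) = ∫ x, (∫ τ in s..t, v x τ * K x τ) ∂μ from
    sw (fun p => v p.1 p.2 * K p.1 p.2) ?_]
  · ring
  · have i1 : Integrable (fun p : X × ℝ => v p.1 p.2 * K p.1 p.2) (μ.prod (volume.restrict (Icc 0 T))) := by
      refine Integrable.mono' (v2.add K2) (mv.mul mK).aestronglyMeasurable (Eventually.of_forall (fun p => ?_))
      simp only [Pi.add_apply, norm_eq_abs]
      rw [abs_le]
      constructor <;> nlinarith [sq_nonneg (v p.1 p.2 + K p.1 p.2), sq_nonneg (v p.1 p.2 - K p.1 p.2),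
        sq_nonneg (v p.1 p.2), sq_nonneg (K p.1 p.2)]
    refine i1.mono_measure (Measure.prod_mono le_rfl (Measure.restrict_mono ?_ le_rfl))
    exact fun x hx => ⟨by linarith [hs.1, hx.1], by linarith [hx.2, ht.2]⟩

end ConeH
end

section
open Real MeasureTheory Set Filter Topology
open scoped ENNReal

namespace ConeH

/-- the abstract system -/
structure Sys (κ R T Λ G M : ℝ) (u ur ut urr utt v : ℝ × ℝ → ℝ → ℝ) : Prop where
  κ0 : 0 < κ
  R0 : 0 < R
  T0 : 0 < T
  Λ0 : 0 < Λ
  G0 : 0 ≤ G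
  M0 : 0 ≤ M
  sl : ∀ t ∈ Icc 0 T, Sl R (fun x => u x t) (fun x => ur x t) (fun x => ut x t)
    (fun x => urr x t) (fun x => utt x t)
  bd : ∀ t ∈ Icc 0 T, ∀ x ∈ B R, |u x t| ≤ M
  vc : ∀ x, Continuous (v x)
  hv : ∀ x ∈ B R, ∀ s ∈ Icc 0 T, ∀ t ∈ Icc 0 T, u x t - u x s = ∫ τ in s..t, v x τ
  e1 : ∀ x ∈ B R, ∀ t ∈ Icc 0 T,
    |lap κ (fun x => ur x t) (fun x => urr x t) (fun x => utt x t) x| ≤ Λ * (|v x t| + G)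
  e2 : ∀ x ∈ B R, ∀ t ∈ Icc 0 T, v x t ^ 2 / (2 * Λ) - Λ * G ^ 2 / 2 ≤
    v x t * lap κ (fun x => ur x t) (fun x => urr x t) (fun x => utt x t) x
  mu' : Measurable (fun p : (ℝ × ℝ) × ℝ => u p.1 p.2)
  mur : Measurable (fun p : (ℝ × ℝ) × ℝ => ur p.1 p.2)
  muth : Measurable (fun p : (ℝ × ℝ) × ℝ => ut p.1 p.2)
  murr : Measurable (fun p : (ℝ × ℝ) × ℝ => urr p.1 p.2)
  mutt : Measurable (fun p : (ℝ × ℝ) × ℝ => utt p.1 p.2)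
  mv : Measurable (fun p : (ℝ × ℝ) × ℝ => v p.1 p.2)
  qi : ∀ t ∈ Icc 0 T, IntegrableOn (q κ (fun x => ur x t) (fun x => ut x t)) (B R) mu
  qE : ∃ E : ℝ, ∀ t ∈ Icc 0 T, ∫ x in B R, q κ (fun x => ur x t) (fun x => ut x t) x ∂mu ≤ E
  v2 : Integrable (fun p : (ℝ × ℝ) × ℝ => v p.1 p.2 ^ 2)
    ((mu.restrict (B R)).prod (volume.restrict (Icc 0 T)))

/-- a radial cutoff -/
structure Cut (a b D : ℝ) (η η' : ℝ → ℝ) : Prop where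
  d : ∀ ρ, HasDerivAt η (η' ρ) ρ
  c : Continuous η'
  nn : ∀ ρ, 0 ≤ η ρ
  le1 : ∀ ρ, η ρ ≤ 1
  one : ∀ ρ, ρ ≤ a → η ρ = 1
  zero : ∀ ρ, b ≤ ρ → η ρ = 0
  zero' : ∀ ρ, b ≤ ρ → η' ρ = 0
  bd : ∀ ρ, |η' ρ| ≤ D

lemma exists_cut : ∃ D : ℝ, 0 < D ∧ ∀ a b : ℝ, a < b → ∃ η η' : ℝ → ℝ, Cut a b (D / (b - a)) η η' := by
  have hd : Differentiable ℝ Real.smoothTransition :=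
    (Real.smoothTransition.contDiff (n := 1)).differentiable (by simp)
  have hc : Continuous (deriv Real.smoothTransition) :=
    (Real.smoothTransition.contDiff (n := 1)).continuous_deriv (by simp)
  obtain ⟨D, hD⟩ := isCompact_Icc.exists_bound_of_continuousOn (hc.continuousOn (s := Icc (0:ℝ) 1))
  have z0 : ∀ x ≤ 0, deriv Real.smoothTransition x = 0 := by
    have : ∀ x < 0, deriv Real.smoothTransition x = 0 := by
      intro x hx
      have : Real.smoothTransition =ᶠ[𝓝 x] fun _ => 0 := by
        filter_upwards [gt_mem_nhds hx] with y hy using Real.smoothTransition.zero_of_nonpos hy.le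
      rw [this.deriv_eq]; simp
    intro x hx
    have hcl : IsClosed {x | deriv Real.smoothTransition x = 0} := isClosed_eq hc continuous_const
    have : Iic (0:ℝ) ⊆ {x | deriv Real.smoothTransition x = 0} := by
      rw [← closure_Iio]; exact hcl.closure_subset_iff.2 (fun y hy => this y hy)
    exact this hx
  have z1 : ∀ x, 1 < x → deriv Real.smoothTransition x = 0 := by
    intro x hx
    have : Real.smoothTransition =ᶠ[𝓝 x] fun _ => 1 := by
      filter_upwards [lt_mem_nhds hx] with y hy using Real.smoothTransition.one_of_one_le hy.le
    rw [this.deriv_eq]; simp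
  have hD' : ∀ x, |deriv Real.smoothTransition x| ≤ |D| + 1 := by
    intro x
    by_cases h : x ∈ Icc (0:ℝ) 1
    · have := hD x h; rw [norm_eq_abs] at this; linarith [le_abs_self D]
    · have : deriv Real.smoothTransition x = 0 := by
        rcases le_or_gt x 0 with h1 | h1
        · exact z0 x h1
        · exact z1 x (by by_contra h2; exact h ⟨h1.le, not_lt.1 h2⟩)
      rw [this, abs_zero]; positivity
  refine ⟨|D| + 1, by positivity, fun a b hab => ?_⟩
  have hba : 0 < b - a := by linarith
  refine ⟨fun ρ => Real.smoothTransition ((b - ρ) / (b - a)),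
    fun ρ => deriv Real.smoothTransition ((b - ρ) / (b - a)) * (-1 / (b - a)), ?_⟩
  constructor
  · intro ρ
    have h1 : HasDerivAt (fun ρ : ℝ => (b - ρ)/(b-a)) (-1/(b-a)) ρ :=
      ((hasDerivAt_id ρ).const_sub b).div_const _
    exact (hd _).hasDerivAt.comp ρ h1
  · exact (hc.comp (by fun_prop)).mul continuous_const
  · intro ρ; exact Real.smoothTransition.nonneg _
  · intro ρ; exact Real.smoothTransition.le_one _
  · intro ρ h; exact Real.smoothTransition.one_of_one_le (by rw [le_div_iff₀ hba]; linarith)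
  · intro ρ h; exact Real.smoothTransition.zero_of_nonpos (div_nonpos_of_nonpos_of_nonneg (by linarith) hba.le)
  · intro ρ h
    rw [z0 _ (div_nonpos_of_nonpos_of_nonneg (by linarith) hba.le), zero_mul]
  · intro ρ
    rw [abs_mul, abs_div, abs_neg, abs_one, abs_of_pos hba, mul_one_div]
    exact div_le_div_of_nonneg_right (hD' _) hba.le

/-- square of a cutoff -/
lemma Cut.sq {a b D : ℝ} {η η' : ℝ → ℝ} (h : Cut a b D η η') :
    Cut a b (2*D) (fun ρ => η ρ ^2) (fun ρ => 2 * η ρ * η' ρ) where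
  d := fun ρ => by
    have := (h.d ρ).mul (h.d ρ)
    have e : (fun ρ => η ρ ^2) = η * η := by ext x; simp [pow_two]
    rw [e]; exact this.congr_deriv (by ring)
  c := by
    have : Continuous η := continuous_iff_continuousAt.2 (fun x => (h.d x).continuousAt)
    exact (continuous_const.mul this).mul h.c
  nn := fun ρ => sq_nonneg _
  le1 := fun ρ => by have := h.nn ρ; have := h.le1 ρ; nlinarith
  one := fun ρ hρ => by simp [h.one ρ hρ]
  zero := fun ρ hρ => by simp [h.zero ρ hρ]
  zero' := fun ρ hρ => by simp [h.zero ρ hρ]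
  bd := fun ρ => by
    rw [abs_mul, abs_mul, abs_of_nonneg (h.nn ρ), abs_two]
    have := h.nn ρ; have := h.le1 ρ; have := h.bd ρ; have := abs_nonneg (η' ρ)
    nlinarith

lemma Cut.cont {a b D : ℝ} {η η' : ℝ → ℝ} (h : Cut a b D η η') : Continuous η :=
  continuous_iff_continuousAt.2 (fun x => (h.d x).continuousAt)

/-- `q` in space-time -/
noncomputable def Q (κ : ℝ) (ur ut : ℝ × ℝ → ℝ → ℝ) (x : ℝ × ℝ) (t : ℝ) : ℝ :=
  q κ (fun x => ur x t) (fun x => ut x t) x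

noncomputable def W (κ : ℝ) (ur urr utt : ℝ × ℝ → ℝ → ℝ) (x : ℝ × ℝ) (t : ℝ) : ℝ :=
  lap κ (fun x => ur x t) (fun x => urr x t) (fun x => utt x t) x

lemma Q_nonneg (κ : ℝ) (ur ut : ℝ × ℝ → ℝ → ℝ) (x : ℝ × ℝ) (t : ℝ) : 0 ≤ Q κ ur ut x t :=
  q_nonneg _ _ _ _

variable {κ R T Λ G M : ℝ} {u ur ut urr utt v : ℝ × ℝ → ℝ → ℝ}

namespace Sys

lemma mQ (S : Sys κ R T Λ G M u ur ut urr utt v) :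
    Measurable (fun p : (ℝ × ℝ) × ℝ => Q κ ur ut p.1 p.2) := by
  have h1 := S.mur
  have h2 := S.muth
  unfold Q q
  exact (h1.pow_const 2).add (Measurable.mul (by fun_prop) (h2.pow_const 2))

lemma mW (S : Sys κ R T Λ G M u ur ut urr utt v) :
    Measurable (fun p : (ℝ × ℝ) × ℝ => W κ ur urr utt p.1 p.2) := by
  have h1 := S.mur
  have h2 := S.murr
  have h3 := S.mutt
  unfold W lap
  exact (h2.add (Measurable.mul (by fun_prop) h1)).add (Measurable.mul (by fun_prop) h3)

/-- a.e. time is good -/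
lemma good (S : Sys κ R T Λ G M u ur ut urr utt v) :
    ∀ᵐ t ∂(volume.restrict (Icc 0 T)), IntegrableOn (fun x => v x t ^2) (B R) mu :=
  S.v2.prod_left_ae

lemma W_sq_le (S : Sys κ R T Λ G M u ur ut urr utt v) {x : ℝ × ℝ} (hx : x ∈ B R) {t : ℝ}
    (ht : t ∈ Icc 0 T) : W κ ur urr utt x t ^2 ≤ 2*Λ^2*(v x t^2 + G^2) := by
  have h := S.e1 x hx t ht
  have h0 : 0 ≤ Λ * (|v x t| + G) := mul_nonneg S.Λ0.le (add_nonneg (abs_nonneg _) S.G0)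
  have h1 : W κ ur urr utt x t ^2 ≤ (Λ * (|v x t| + G))^2 := by
    rw [← sq_abs]; exact pow_le_pow_left₀ (abs_nonneg _) h 2
  refine h1.trans ?_
  have h2 : (|v x t| + G)^2 ≤ 2*(v x t^2+G^2) := by
    rw [← sq_abs (v x t)]; nlinarith [sq_nonneg (|v x t| - G)]
  rw [mul_pow]
  nlinarith [mul_le_mul_of_nonneg_left h2 (sq_nonneg Λ)]

lemma W2_int (S : Sys κ R T Λ G M u ur ut urr utt v) {t : ℝ} (ht : t ∈ Icc 0 T)
    (g : IntegrableOn (fun x => v x t ^2) (B R) mu) :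
    IntegrableOn (fun x => W κ ur urr utt x t ^2) (B R) mu := by
  have h1 : IntegrableOn (fun x => v x t^2 + G^2) (B R) mu := Integrable.add g (integrable_const (G^2))
  refine intB_of_le (g := fun x => 2*Λ^2*(v x t^2 + G^2)) (h1.const_mul _)
    ((S.sl t ht).contOn_lap.pow 2) ?_
  intro x hx
  rw [abs_of_nonneg (sq_nonneg _)]
  exact S.W_sq_le hx ht

end Sys

end ConeH
end

section
open Real MeasureTheory Set Filter Topology
open scoped ENNReal

namespace ConeH

lemma Sl.add {R : ℝ} {f fr ft frr ftt p pr pt prr ptt : ℝ × ℝ → ℝ}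
    (h : Sl R f fr ft frr ftt) (k : Sl R p pr pt prr ptt) :
    Sl R (fun x => f x + p x) (fun x => fr x + pr x) (fun x => ft x + pt x)
      (fun x => frr x + prr x) (fun x => ftt x + ptt x) where
  per := fun x hx => by rw [h.per x hx, k.per x hx]
  hr := fun x hx => (h.hr x hx).add (k.hr x hx)
  ht := fun x hx => (h.ht x hx).add (k.ht x hx)
  c0 := h.c0.add k.c0
  cr := h.cr.add k.cr
  ct := h.ct.add k.ct
  hrr := fun x hx => (h.hrr x hx).add (k.hrr x hx)
  htt := fun x hx => (h.htt x hx).add (k.htt x hx)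
  crr := h.crr.add k.crr
  ctt := h.ctt.add k.ctt

lemma Sl1.sub {R : ℝ} {f fr ft p pr pt : ℝ × ℝ → ℝ}
    (h : Sl1 R f fr ft) (k : Sl1 R p pr pt) :
    Sl1 R (fun x => f x - p x) (fun x => fr x - pr x) (fun x => ft x - pt x) where
  per := fun x hx => by rw [h.per x hx, k.per x hx]
  hr := fun x hx => (h.hr x hx).sub (k.hr x hx)
  ht := fun x hx => (h.ht x hx).sub (k.ht x hx)
  c0 := h.c0.sub k.c0
  cr := h.cr.sub k.cr
  ct := h.ct.sub k.ct

lemma Sl1.cut {R a b D : ℝ} {f fr ft : ℝ × ℝ → ℝ} {η η' : ℝ → ℝ}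
    (h : Sl1 R f fr ft) (k : Cut a b D η η') :
    Sl1 R (fun x => η x.1 * f x) (fun x => η' x.1 * f x + η x.1 * fr x) (fun x => η x.1 * ft x) where
  per := fun x hx => by rw [h.per x hx]
  hr := fun x hx => (k.d x.1).mul (h.hr x hx)
  ht := fun x hx => (h.ht x hx).const_mul (η x.1)
  c0 := (k.cont.comp continuous_fst).continuousOn.mul h.c0
  cr := ((k.c.comp continuous_fst).continuousOn.mul h.c0).add
    ((k.cont.comp continuous_fst).continuousOn.mul h.cr)
  ct := (k.cont.comp continuous_fst).continuousOn.mul h.ct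

lemma q_cut_le {κ a b D M : ℝ} {f fr ft : ℝ × ℝ → ℝ} {η η' : ℝ → ℝ}
    (k : Cut a b D η η') (x : ℝ × ℝ) (hM : |f x| ≤ M) :
    q κ (fun x => η' x.1 * f x + η x.1 * fr x) (fun x => η x.1 * ft x) x
      ≤ 2*D^2*M^2 + 2 * q κ fr ft x := by
  unfold q
  have h1 : (η' x.1 * f x)^2 ≤ D^2*M^2 := by
    rw [mul_pow]
    have h1 : η' x.1^2 ≤ D^2 := by
      rw [← sq_abs]; exact pow_le_pow_left₀ (abs_nonneg _) (k.bd _) 2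
    have h2 : f x^2 ≤ M^2 := by
      rw [← sq_abs]; exact pow_le_pow_left₀ (abs_nonneg _) hM 2
    exact mul_le_mul h1 h2 (sq_nonneg _) (sq_nonneg _)
  have h2 : η x.1 ^2 ≤ 1 := by have := k.nn x.1; have := k.le1 x.1; nlinarith
  have h3 : (η x.1 * fr x)^2 ≤ fr x^2 := by
    rw [mul_pow]; exact mul_le_of_le_one_left (sq_nonneg _) h2
  have h4 : (κ ^ 2 * x.1 ^ 2)⁻¹ * (η x.1 * ft x)^2 ≤ (κ ^ 2 * x.1 ^ 2)⁻¹ * ft x^2 := by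
    refine mul_le_mul_of_nonneg_left ?_ (by positivity)
    rw [mul_pow]; exact mul_le_of_le_one_left (sq_nonneg _) h2
  have h5 : 0 ≤ (κ ^ 2 * x.1 ^ 2)⁻¹ * ft x^2 := by positivity
  nlinarith [sq_nonneg (η' x.1 * f x - η x.1 * fr x)]

lemma q_sub_le (κ : ℝ) (fr ft pr pt : ℝ × ℝ → ℝ) (x : ℝ × ℝ) :
    q κ (fun x => fr x - pr x) (fun x => ft x - pt x) x ≤ 2 * q κ fr ft x + 2 * q κ pr pt x := by
  unfold q
  have h : 0 ≤ (κ ^ 2 * x.1 ^ 2)⁻¹ := by positivity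
  nlinarith [sq_nonneg (fr x + pr x), mul_nonneg h (sq_nonneg (ft x + pt x))]

lemma q_add_le (κ : ℝ) (fr ft pr pt : ℝ × ℝ → ℝ) (x : ℝ × ℝ) :
    q κ (fun x => fr x + pr x) (fun x => ft x + pt x) x ≤ 2 * q κ fr ft x + 2 * q κ pr pt x := by
  unfold q
  have h : 0 ≤ (κ ^ 2 * x.1 ^ 2)⁻¹ := by positivity
  nlinarith [sq_nonneg (fr x - pr x), mul_nonneg h (sq_nonneg (ft x - pt x))]

lemma setInt_B_eq {b R : ℝ} (hb : b ≤ R) {f : ℝ × ℝ → ℝ} (h : ∀ x : ℝ × ℝ, b ≤ x.1 → f x = 0) :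
    ∫ x in B b, f x ∂mu = ∫ x in B R, f x ∂mu := by
  symm
  refine setIntegral_eq_of_subset_of_forall_sdiff_eq_zero (B_meas R) (B_mono hb) ?_
  intro x hx
  refine h x ?_
  by_contra h2
  exact hx.2 (mem_B.2 ⟨(mem_B.1 hx.1).1, not_le.1 h2⟩)

/-- ibp with a cutoff -/
lemma ibp_cut {κ R M a b D : ℝ} {f fr ft frr ftt p pr pt : ℝ × ℝ → ℝ} {η η' : ℝ → ℝ}
    (hf : Sl R f fr ft frr ftt) (hp : Sl1 R p pr pt) (k : Cut a b D η η') (hb0 : 0 < b)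
    (hbR : b < R) (hM : ∀ x ∈ B R, |p x| ≤ M)
    (qf : IntegrableOn (q κ fr ft) (B R) mu) (qp : IntegrableOn (q κ pr pt) (B R) mu)
    (hw : IntegrableOn (fun x => lap κ fr frr ftt x ^ 2) (B R) mu) :
    IntegrableOn (fun x => η x.1 * qq κ fr ft pr pt x + p x *
      (η x.1 * lap κ fr frr ftt x + η' x.1 * fr x)) (B R) mu ∧
    ∫ x in B R, (η x.1 * qq κ fr ft pr pt x + p x *
      (η x.1 * lap κ fr frr ftt x + η' x.1 * fr x)) ∂mu = 0 := by
  have hp' := hp.cut k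
  have hM' : ∀ x ∈ B R, |η x.1 * p x| ≤ M := by
    intro x hx
    rw [abs_mul, abs_of_nonneg (k.nn _)]
    exact (mul_le_of_le_one_left (abs_nonneg _) (k.le1 _)).trans (hM x hx)
  have qp' : IntegrableOn (q κ (fun x => η' x.1 * p x + η x.1 * pr x) (fun x => η x.1 * pt x)) (B R) mu := by
    have h1 : IntegrableOn (fun x => 2*D^2*M^2 + 2 * q κ pr pt x) (B R) mu :=
      Integrable.add (integrable_const _) (Integrable.const_mul qp 2)
    refine intB_of_le h1 hp'.contOn_q ?_
    intro x hx
    rw [abs_of_nonneg (q_nonneg _ _ _ _)]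
    exact q_cut_le k x (hM x hx)
  have e : ∀ x, η x.1 * qq κ fr ft pr pt x + p x * (η x.1 * lap κ fr frr ftt x + η' x.1 * fr x)
      = qq κ fr ft (fun x => η' x.1 * p x + η x.1 * pr x) (fun x => η x.1 * pt x) x
        + (η x.1 * p x) * lap κ fr frr ftt x := by
    intro x; unfold qq; ring
  simp_rw [e]
  refine ⟨(int_qq hf.toSl1 hp' qf qp').add (int_pw hf hp' hM' hw), ?_⟩
  have h := ibp hf hp' hb0 hbR hM' qf qp' hw
  rw [setInt_B_eq hbR.le ?_] at h
  · rw [h]; simp [k.zero b le_rfl]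
  · intro x hx; unfold qq; simp [k.zero _ hx, k.zero' _ hx]

variable {κ R T Λ G M : ℝ} {u ur ut urr utt v : ℝ × ℝ → ℝ → ℝ}

namespace Sys

lemma diffI (S : Sys κ R T Λ G M u ur ut urr utt v) {a b D : ℝ} {η η' : ℝ → ℝ}
    (k : Cut a b D η η') (hb0 : 0 < b) (hbR : b < R) {s t : ℝ} (hs : s ∈ Icc 0 T) (ht : t ∈ Icc 0 T)
    (gs : IntegrableOn (fun x => v x s ^2) (B R) mu) (gt : IntegrableOn (fun x => v x t ^2) (B R) mu) :
    (∫ x in B R, η x.1 * Q κ ur ut x t ∂mu) - ∫ x in B R, η x.1 * Q κ ur ut x s ∂mu =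
      -∫ x in B R, (u x t - u x s) * ((η x.1 * W κ ur urr utt x s + η' x.1 * ur x s) +
        (η x.1 * W κ ur urr utt x t + η' x.1 * ur x t)) ∂mu := by
  have ls := S.sl s hs
  have lt := S.sl t ht
  have hf := ls.add lt
  have hp := lt.toSl1.sub ls.toSl1
  have qs := S.qi s hs
  have qt := S.qi t ht
  have i2 : IntegrableOn (fun x => 2 * q κ (fun x => ur x t) (fun x => ut x t) x +
      2 * q κ (fun x => ur x s) (fun x => ut x s) x) (B R) mu :=
    Integrable.add (Integrable.const_mul qt 2) (Integrable.const_mul qs 2)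
  have i2' : IntegrableOn (fun x => 2 * q κ (fun x => ur x s) (fun x => ut x s) x +
      2 * q κ (fun x => ur x t) (fun x => ut x t) x) (B R) mu :=
    Integrable.add (Integrable.const_mul qs 2) (Integrable.const_mul qt 2)
  have qf := intB_of_le i2' (hf.toSl1.contOn_q (κ := κ)) (fun x hx => by
    rw [abs_of_nonneg (q_nonneg _ _ _ _)]; exact q_add_le _ _ _ _ _ x)
  have qp := intB_of_le i2 (hp.contOn_q (κ := κ)) (fun x hx => by
    rw [abs_of_nonneg (q_nonneg _ _ _ _)]; exact q_sub_le _ _ _ _ _ x)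
  have hM : ∀ x ∈ B R, |u x t - u x s| ≤ 2 * M := by
    intro x hx
    have h1 := S.bd t ht x hx
    have h2 := S.bd s hs x hx
    rw [abs_le] at *; constructor <;> linarith
  have le : ∀ x, lap κ (fun x => ur x s + ur x t) (fun x => urr x s + urr x t)
      (fun x => utt x s + utt x t) x = W κ ur urr utt x s + W κ ur urr utt x t := by
    intro x; unfold W lap; ring
  have hw : IntegrableOn (fun x => lap κ (fun x => ur x s + ur x t) (fun x => urr x s + urr x t)
      (fun x => utt x s + utt x t) x ^2) (B R) mu := by
    have h1 : IntegrableOn (fun x => 2 * W κ ur urr utt x s ^2 + 2 * W κ ur urr utt x t^2) (B R) mu :=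
      Integrable.add (Integrable.const_mul (S.W2_int hs gs) 2) (Integrable.const_mul (S.W2_int ht gt) 2)
    refine intB_of_le h1 (hf.contOn_lap.pow 2) ?_
    intro x hx
    rw [abs_of_nonneg (sq_nonneg _), le]
    nlinarith [sq_nonneg (W κ ur urr utt x s - W κ ur urr utt x t)]
  obtain ⟨hi, h0⟩ := ibp_cut hf hp k hb0 hbR hM qf qp hw
  have iq : ∀ τ ∈ Icc 0 T, IntegrableOn (fun x => η x.1 * Q κ ur ut x τ) (B R) mu := by
    intro τ hτ
    refine intB_of_le (S.qi τ hτ) ((k.cont.comp continuous_fst).continuousOn.mul (S.sl τ hτ).toSl1.contOn_q) ?_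
    intro x hx
    rw [abs_of_nonneg (mul_nonneg (k.nn _) (Q_nonneg _ _ _ _ _))]
    exact mul_le_of_le_one_left (Q_nonneg _ _ _ _ _) (k.le1 _)
  have id : IntegrableOn (fun x => η x.1 * Q κ ur ut x t - η x.1 * Q κ ur ut x s) (B R) mu :=
    Integrable.sub (iq t ht) (iq s hs)
  have e : ∀ x, η x.1 * qq κ (fun x => ur x s + ur x t) (fun x => ut x s + ut x t)
      (fun x => ur x t - ur x s) (fun x => ut x t - ut x s) x + (u x t - u x s) *
      (η x.1 * lap κ (fun x => ur x s + ur x t) (fun x => urr x s + urr x t)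
      (fun x => utt x s + utt x t) x + η' x.1 * (ur x s + ur x t)) =
      (η x.1 * Q κ ur ut x t - η x.1 * Q κ ur ut x s) +
      (u x t - u x s) * ((η x.1 * W κ ur urr utt x s + η' x.1 * ur x s) +
        (η x.1 * W κ ur urr utt x t + η' x.1 * ur x t)) := by
    intro x; rw [le]; unfold qq Q q; ring
  simp_rw [e] at hi h0
  have ir : IntegrableOn (fun x => (u x t - u x s) * ((η x.1 * W κ ur urr utt x s + η' x.1 * ur x s) +
        (η x.1 * W κ ur urr utt x t + η' x.1 * ur x t))) (B R) mu := by
    have := Integrable.sub hi id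
    refine this.congr (Eventually.of_forall fun x => ?_)
    simp
  rw [integral_add id ir, integral_sub (iq t ht) (iq s hs)] at h0
  linarith

/-- product measure -/
noncomputable abbrev pm (R T : ℝ) : Measure ((ℝ × ℝ) × ℝ) :=
  (mu.restrict (B R)).prod (volume.restrict (Icc 0 T))

lemma Q_int (S : Sys κ R T Λ G M u ur ut urr utt v) :
    Integrable (fun p : (ℝ × ℝ) × ℝ => Q κ ur ut p.1 p.2) (pm R T) := by
  have m := S.mQ
  rw [integrable_prod_iff' m.aestronglyMeasurable]
  refine ⟨?_, ?_⟩
  · filter_upwards [ae_restrict_mem measurableSet_Icc] with t ht using S.qi t ht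
  · obtain ⟨E, hE⟩ := S.qE
    refine Integrable.mono' (integrable_const E)
      (m.aestronglyMeasurable.norm.prod_swap.integral_prod_right') ?_
    filter_upwards [ae_restrict_mem measurableSet_Icc] with t ht
    rw [norm_of_nonneg (integral_nonneg (fun _ => norm_nonneg _))]
    refine le_trans (le_of_eq ?_) (hE t ht)
    refine integral_congr_ae (Eventually.of_forall fun x => ?_)
    exact norm_of_nonneg (Q_nonneg _ _ _ _ _)

lemma ae_B (R T : ℝ) : ∀ᵐ p ∂(pm R T), p.1 ∈ B R ∧ p.2 ∈ Icc 0 T := by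
  have : pm R T = (mu.prod volume).restrict (B R ×ˢ Icc 0 T) := by
    rw [pm, Measure.prod_restrict]
  rw [this]
  filter_upwards [ae_restrict_mem ((B_meas R).prod measurableSet_Icc)] with p hp using hp

/-- weighted products are integrable -/
lemma wInt {F : (ℝ × ℝ) × ℝ → ℝ} {R T : ℝ} (h : Integrable F (pm R T)) {η : ℝ → ℝ} (hc : Continuous η)
    {C : ℝ} (hb : ∀ ρ, |η ρ| ≤ C) : Integrable (fun p => η p.1.1 * F p) (pm R T) := by
  refine h.bdd_mul (c := C) (hc.comp (continuous_fst.comp continuous_fst)).aestronglyMeasurable ?_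
  exact Eventually.of_forall (fun p => hb _)

end Sys

end ConeH
end

section
open Real MeasureTheory Set Filter Topology
open scoped ENNReal

namespace ConeH

/-- space-time cylinder measure -/
noncomputable abbrev stm (R s t : ℝ) : Measure ((ℝ × ℝ) × ℝ) :=
  (mu.restrict (B R)).prod (volume.restrict (Ioc s t))

lemma stm_eq_restrict (R s t : ℝ) : stm R s t = (mu.prod volume).restrict (B R ×ˢ Ioc s t) := by
  rw [stm, Measure.prod_restrict]

lemma stm_mono {R R' s t s' t' : ℝ} (hR : R ≤ R') (hs : s' ≤ s) (ht : t ≤ t') :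
    stm R s t ≤ stm R' s' t' := by
  rw [stm_eq_restrict, stm_eq_restrict]
  exact Measure.restrict_mono (prod_mono (B_mono hR) (Ioc_subset_Ioc hs ht)) le_rfl

lemma stm_le_pm {R T s t : ℝ} (hs : 0 ≤ s) (ht : t ≤ T) : stm R s t ≤ Sys.pm R T := by
  rw [stm_eq_restrict, Sys.pm, Measure.prod_restrict]
  exact Measure.restrict_mono (prod_mono le_rfl (Ioc_subset_Icc_self.trans (Icc_subset_Icc hs ht))) le_rfl

lemma ae_stm (R s t : ℝ) : ∀ᵐ p ∂(stm R s t), p.1 ∈ B R ∧ p.2 ∈ Ioc s t := by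
  rw [stm_eq_restrict]
  filter_upwards [ae_restrict_mem ((B_meas R).prod measurableSet_Ioc)] with p hp using hp

lemma st_eq {R T s t : ℝ} (hs : 0 ≤ s) (hst : s ≤ t) (ht : t ≤ T) {F : (ℝ × ℝ) × ℝ → ℝ}
    (h : Integrable F (Sys.pm R T)) :
    ∫ τ in s..t, (∫ x in B R, F (x, τ) ∂mu) = ∫ p, F p ∂(stm R s t) := by
  rw [intervalIntegral.integral_of_le hst]
  rw [integral_prod_symm _ (h.mono_measure (stm_le_pm hs ht))]

lemma stm_const {R s t : ℝ} (hR : 0 ≤ R) (hst : s ≤ t) (c : ℝ) :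
    ∫ _, c ∂(stm R s t) = c * (π * R^2 * (t - s)) := by
  rw [integral_const, smul_eq_mul, mul_comm, stm, measureReal_def, ← univ_prod_univ, Measure.prod_prod,
    ENNReal.toReal_mul]
  simp only [Measure.restrict_apply_univ]
  have h1 : (mu (B R)).toReal = π * R^2 := by have := mu_B_real hR; rwa [measureReal_def] at this
  rw [h1, Real.volume_Ioc, ENNReal.toReal_ofReal (by linarith)]

variable {κ R T Λ G M : ℝ} {u ur ut urr utt v : ℝ × ℝ → ℝ → ℝ}

namespace Sys

lemma W2_prod (S : Sys κ R T Λ G M u ur ut urr utt v) :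
    Integrable (fun p : (ℝ × ℝ) × ℝ => W κ ur urr utt p.1 p.2 ^2) (pm R T) := by
  have h1 : Integrable (fun p : (ℝ × ℝ) × ℝ => 2*Λ^2*(v p.1 p.2^2 + G^2)) (pm R T) :=
    (S.v2.add (integrable_const (G^2))).const_mul _
  refine h1.mono' (S.mW.pow_const 2).aestronglyMeasurable ?_
  filter_upwards [ae_B R T] with p hp
  rw [norm_of_nonneg (sq_nonneg _)]
  exact S.W_sq_le hp.1 hp.2

lemma ur_sq_le_Q (x : ℝ × ℝ) (t : ℝ) : ur x t ^2 ≤ Q κ ur ut x t := by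
  unfold Q q
  have : 0 ≤ (κ ^ 2 * x.1 ^ 2)⁻¹ * ut x t ^2 := by positivity
  linarith

lemma energy (S : Sys κ R T Λ G M u ur ut urr utt v) {a b D : ℝ} {η η' : ℝ → ℝ}
    (k : Cut a b D η η') (hb0 : 0 < b) (hbR : b < R) :
    ∃ good : ℝ → Prop, (∀ᵐ t ∂(volume.restrict (Icc 0 T)), good t) ∧
      ∀ s ∈ Icc 0 T, ∀ t ∈ Icc 0 T, s ≤ t → good s → good t →
      (∫ x in B R, η x.1^2 * Q κ ur ut x t ∂mu) +
        (1/(2*Λ)) * ∫ p, η p.1.1^2 * v p.1 p.2^2 ∂(stm R s t) ≤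
      (∫ x in B R, η x.1^2 * Q κ ur ut x s ∂mu) + Λ*G^2*(π*R^2*(t-s))
        + 8*Λ * ∫ p, η' p.1.1^2 * Q κ ur ut p.1 p.2 ∂(stm R s t) := by
  have k2 := k.sq
  have hη2 : ∀ ρ, η ρ^2 ≤ 1 := k2.le1
  have hη'2 : ∀ ρ, η' ρ^2 ≤ D^2 := fun ρ => by
    rw [← sq_abs]; exact pow_le_pow_left₀ (abs_nonneg _) (k.bd _) 2
  set K : ℝ × ℝ → ℝ → ℝ := fun x t => η x.1^2 * W κ ur urr utt x t + 2 * η x.1 * η' x.1 * ur x t with hK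
  have mK : Measurable (fun p : (ℝ × ℝ) × ℝ => K p.1 p.2) := by
    have c1 : Measurable (fun p : (ℝ × ℝ) × ℝ => η p.1.1 ^2) :=
      (k2.cont.comp (continuous_fst.comp continuous_fst)).measurable
    have c2 : Measurable (fun p : (ℝ × ℝ) × ℝ => 2 * η p.1.1 * η' p.1.1) :=
      (k2.c.comp (continuous_fst.comp continuous_fst)).measurable
    exact (c1.mul S.mW).add (c2.mul S.mur)
  have K2 : Integrable (fun p : (ℝ × ℝ) × ℝ => K p.1 p.2 ^ 2) (pm R T) := by
    have h1 : Integrable (fun p : (ℝ × ℝ) × ℝ => 2 * W κ ur urr utt p.1 p.2 ^2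
        + 8 * D^2 * Q κ ur ut p.1 p.2) (pm R T) :=
      (S.W2_prod.const_mul 2).add (S.Q_int.const_mul (8*D^2))
    refine h1.mono' (mK.pow_const 2).aestronglyMeasurable (Eventually.of_forall fun p => ?_)
    rw [norm_of_nonneg (sq_nonneg _)]
    have h2 := ur_sq_le_Q (κ := κ) (ur := ur) (ut := ut) p.1 p.2
    set w := W κ ur urr utt p.1 p.2
    set z := ur p.1 p.2
    have h3 : (η p.1.1^2 * w)^2 ≤ w^2 := by
      rw [mul_pow]; refine mul_le_of_le_one_left (sq_nonneg _) ?_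
      have := hη2 p.1.1; have := sq_nonneg (η p.1.1); nlinarith
    have h4 : (η p.1.1 * η' p.1.1 * z)^2 ≤ D^2 * z^2 := by
      rw [mul_pow, mul_pow]
      refine mul_le_mul_of_nonneg_right ?_ (sq_nonneg _)
      have := mul_le_mul (hη2 p.1.1) (hη'2 p.1.1) (sq_nonneg _) zero_le_one
      linarith
    have h5 : D^2 * z^2 ≤ D^2 * Q κ ur ut p.1 p.2 := mul_le_mul_of_nonneg_left h2 (sq_nonneg _)
    have e : K p.1 p.2 = η p.1.1^2 * w + 2 * (η p.1.1 * η' p.1.1 * z) := by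
      simp only [hK]; ring
    rw [e]
    nlinarith [sq_nonneg (η p.1.1^2 * w - 2 * (η p.1.1 * η' p.1.1 * z))]
  have abs1 : ∀ ρ, |η ρ^2| ≤ 1 := fun ρ => by rw [abs_of_nonneg (sq_nonneg _)]; exact hη2 ρ
  have abs2 : ∀ ρ, |η' ρ^2| ≤ D^2 := fun ρ => by rw [abs_of_nonneg (sq_nonneg _)]; exact hη'2 ρ
  have iI := wInt S.Q_int k2.cont abs1
  have iv := wInt S.v2 k2.cont abs1
  have iQ := wInt S.Q_int (k.c.pow 2) abs2
  obtain ⟨good2, hg2, h2⟩ := timeLemma (I := fun t => ∫ x in B R, η x.1^2 * Q κ ur ut x t ∂mu)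
    (K := K) (u := u) S.T0 S.vc (by
      filter_upwards [ae_restrict_mem (B_meas R)] with x hx using S.hv x hx) S.mv mK S.v2 K2
      iI.integral_prod_right S.good (by
        intro s hs t ht gs gt
        exact S.diffI k2 hb0 hbR hs ht gs gt)
  refine ⟨good2, hg2, fun s hs t ht hst gs gt => ?_⟩
  have h := h2 s hs t ht hst gs gt
  have ivK : Integrable (fun p : (ℝ × ℝ) × ℝ => v p.1 p.2 * K p.1 p.2) (pm R T) := by
    refine (S.v2.add K2).mono' (S.mv.mul mK).aestronglyMeasurable (Eventually.of_forall fun p => ?_)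
    rw [norm_eq_abs, abs_le, Pi.add_apply]
    constructor <;> nlinarith [sq_nonneg (v p.1 p.2 + K p.1 p.2), sq_nonneg (v p.1 p.2 - K p.1 p.2), sq_nonneg (v p.1 p.2), sq_nonneg (K p.1 p.2)]
  rw [st_eq hs.1 hst ht.2 ivK] at h
  have hle := stm_le_pm (R := R) hs.1 ht.2 
  have iv' := iv.mono_measure hle
  have iQ' := iQ.mono_measure hle
  have ivK' := ivK.mono_measure hle
  have ic : Integrable (fun _ : (ℝ × ℝ) × ℝ => Λ*G^2) (stm R s t) := integrable_const _
  have hm : ∫ p, ((1/(2*Λ)) * (η p.1.1^2 * v p.1 p.2^2) - Λ*G^2 - 8*Λ*(η' p.1.1^2 * Q κ ur ut p.1 p.2)) ∂(stm R s t)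
      ≤ ∫ p, 2 * (v p.1 p.2 * K p.1 p.2) ∂(stm R s t) := by
    refine integral_mono_ae (((iv'.const_mul _).sub ic).sub (iQ'.const_mul _)) (ivK'.const_mul _) ?_
    filter_upwards [ae_stm R s t] with p hp
    have h2 := ur_sq_le_Q (κ := κ) (ur := ur) (ut := ut) p.1 p.2
    have e2 := S.e2 p.1 hp.1 p.2 ⟨hs.1.trans hp.2.1.le, hp.2.2.trans ht.2⟩
    change _ ≤ v p.1 p.2 * W κ ur urr utt p.1 p.2 at e2
    change _ ≤ 2 * (v p.1 p.2 * (η p.1.1^2 * W κ ur urr utt p.1 p.2 + 2 * η p.1.1 * η' p.1.1 * ur p.1 p.2))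
    have L := S.Λ0
    have a1 := mul_le_mul_of_nonneg_left e2 (sq_nonneg (η p.1.1))
    have a2 := mul_le_mul_of_nonneg_left h2 (sq_nonneg (η' p.1.1))
    set w := W κ ur urr utt p.1 p.2
    set z := ur p.1 p.2
    set e := η p.1.1 with he
    set e' := η' p.1.1
    set V := v p.1 p.2
    set QQ := Q κ ur ut p.1 p.2
    have a3 : e^2 * (Λ * G^2) ≤ Λ*G^2 := mul_le_of_le_one_left (by positivity) (hη2 _)
    have a4 : -(4 * ((e*V) * (e'*z))) ≤ (1/(2*Λ)) * (e*V)^2 + 8*Λ*(e'*z)^2 := by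
      have : 0 ≤ (1/(2*Λ)) * (e*V + 4*Λ*(e'*z))^2 := by positivity
      have e5 : (1/(2*Λ)) * (e*V + 4*Λ*(e'*z))^2 = (1/(2*Λ)) * (e*V)^2 + 4 * ((e*V) * (e'*z)) + 8*Λ*(e'*z)^2 := by
        field_simp; ring
      linarith
    have a5 : 8*Λ*(e'^2*z^2) ≤ 8*Λ*(e'^2*QQ) := mul_le_mul_of_nonneg_left a2 (by positivity)
    have a6 : e^2*(V^2/(2*Λ) - Λ*G^2/2) = (1/(2*Λ))*(e*V)^2 - e^2*(Λ*G^2)/2 := by ring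
    have a7 : (1/(2*Λ))*(e^2*V^2) = (1/(2*Λ))*(e*V)^2 := by ring
    nlinarith
  have e1 : ∫ p, ((1/(2*Λ)) * (η p.1.1^2 * v p.1 p.2^2) - Λ*G^2 - 8*Λ*(η' p.1.1^2 * Q κ ur ut p.1 p.2)) ∂(stm R s t)
      = (1/(2*Λ)) * (∫ p, η p.1.1^2 * v p.1 p.2^2 ∂(stm R s t)) - Λ*G^2*(π*R^2*(t-s))
        - 8*Λ * ∫ p, η' p.1.1^2 * Q κ ur ut p.1 p.2 ∂(stm R s t) := by
    have b1 : Integrable (fun p : (ℝ × ℝ) × ℝ => (1/(2*Λ)) * (η p.1.1^2 * v p.1 p.2^2)) (stm R s t) := iv'.const_mul _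
    have b2 : Integrable (fun p : (ℝ × ℝ) × ℝ => 8*Λ*(η' p.1.1^2 * Q κ ur ut p.1 p.2)) (stm R s t) := iQ'.const_mul _
    have b3 : Integrable (fun p : (ℝ × ℝ) × ℝ => (1/(2*Λ)) * (η p.1.1^2 * v p.1 p.2^2) - Λ*G^2) (stm R s t) := b1.sub ic
    rw [integral_sub b3 b2, integral_sub b1 ic, stm_const S.R0.le hst, integral_const_mul, integral_const_mul]
  rw [e1, integral_const_mul] at hm
  linarith

end Sys

end ConeH
end

section
open Real MeasureTheory Set Filter Topology
open scoped ENNReal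

namespace ConeH

lemma exists_good_avg {g : ℝ → ℝ} {s t : ℝ} (hst : s < t) (hg : IntegrableOn g (Ioc s t))
    {P : ℝ → Prop} (hP : ∀ᵐ τ ∂(volume.restrict (Ioc s t)), P τ) :
    ∃ τ ∈ Ioc s t, P τ ∧ g τ * (t - s) ≤ ∫ τ in s..t, g τ := by
  have h1 : ∀ᵐ τ ∂(volume.restrict (Ioc s t)), τ ∈ Ioc s t ∧ P τ := by
    filter_upwards [hP, ae_restrict_mem measurableSet_Ioc] with τ h h' using ⟨h', h⟩
  have hne : volume.restrict (Ioc s t) ≠ 0 := by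
    rw [Ne, Measure.restrict_eq_zero, Real.volume_Ioc]; simp [hst]
  obtain ⟨τ, h2, h3⟩ := exists_notMem_null_le_average hne hg (ae_iff.1 h1)
  simp only [mem_ofPred_eq, not_not] at h2
  refine ⟨τ, h2.1, h2.2, ?_⟩
  rw [average_eq] at h3
  have e : (volume.restrict (Ioc s t)).real univ = t - s := by
    rw [measureReal_def, Measure.restrict_apply_univ, Real.volume_Ioc, ENNReal.toReal_ofReal (by linarith)]
  rw [e, smul_eq_mul, ← intervalIntegral.integral_of_le hst.le] at h3
  have : 0 < t - s := by linarith
  calc g τ * (t - s) ≤ ((t-s)⁻¹ * ∫ τ in s..t, g τ) * (t - s) := mul_le_mul_of_nonneg_right h3 this.le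
    _ = _ := by field_simp

lemma ae_sub {P : ℝ → Prop} {s t s' t' : ℝ} (h : ∀ᵐ τ ∂(volume.restrict (Icc s' t')), P τ)
    (h1 : s' ≤ s) (h2 : t ≤ t') : ∀ᵐ τ ∂(volume.restrict (Ioc s t)), P τ :=
  ae_restrict_of_ae_restrict_of_subset (Ioc_subset_Icc_self.trans (Icc_subset_Icc h1 h2)) h

lemma ae_sub' {P : ℝ → Prop} {s t s' t' : ℝ} (h : ∀ᵐ τ ∂(volume.restrict (Ioc s' t')), P τ)
    (h1 : s' ≤ s) (h2 : t ≤ t') : ∀ᵐ τ ∂(volume.restrict (Ioc s t)), P τ :=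
  ae_restrict_of_ae_restrict_of_subset (Ioc_subset_Ioc h1 h2) h

lemma exists_good {s t : ℝ} (hst : s < t) {P : ℝ → Prop} (hP : ∀ᵐ τ ∂(volume.restrict (Ioc s t)), P τ) :
    ∃ τ ∈ Ioc s t, P τ := by
  obtain ⟨τ, h1, h2, _⟩ := exists_good_avg hst (g := fun _ => 0) (by simp) hP
  exact ⟨τ, h1, h2⟩

lemma st_le {R T s t c : ℝ} (hs : 0 ≤ s) (hst : s ≤ t) (ht : t ≤ T) {F : (ℝ × ℝ) × ℝ → ℝ}
    (h : Integrable F (Sys.pm R T)) (hc : ∀ᵐ τ ∂(volume.restrict (Ioc s t)), ∫ x in B R, F (x, τ) ∂mu ≤ c) :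
    ∫ p, F p ∂(stm R s t) ≤ c * (t - s) := by
  have hi := h.mono_measure (stm_le_pm hs ht)
  rw [integral_prod_symm _ hi]
  have := integral_mono_ae (μ := volume.restrict (Ioc s t)) hi.integral_prod_right (integrable_const c) hc
  refine this.trans (le_of_eq ?_)
  rw [integral_const, measureReal_def, Measure.restrict_apply_univ, Real.volume_Ioc, ENNReal.toReal_ofReal (by linarith), smul_eq_mul, mul_comm]

lemma Sl1.mono {R R' : ℝ} {f fr ft : ℝ × ℝ → ℝ} (h : Sl1 R f fr ft) (hR : R' ≤ R) : Sl1 R' f fr ft where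
  per := fun x hx => h.per x (B_mono hR hx)
  hr := fun x hx => h.hr x (B_mono hR hx)
  ht := fun x hx => h.ht x (B_mono hR hx)
  c0 := h.c0.mono (B_mono hR)
  cr := h.cr.mono (B_mono hR)
  ct := h.ct.mono (B_mono hR)

lemma Sl.mono {R R' : ℝ} {f fr ft frr ftt : ℝ × ℝ → ℝ} (h : Sl R f fr ft frr ftt) (hR : R' ≤ R) :
    Sl R' f fr ft frr ftt where
  toSl1 := h.toSl1.mono hR
  hrr := fun x hx => h.hrr x (B_mono hR hx)
  htt := fun x hx => h.htt x (B_mono hR hx)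
  crr := h.crr.mono (B_mono hR)
  ctt := h.ctt.mono (B_mono hR)

variable {κ R T Λ G M : ℝ} {u ur ut urr utt v : ℝ × ℝ → ℝ → ℝ}

namespace Sys

lemma Q_mono (S : Sys κ R T Λ G M u ur ut urr utt v) {r : ℝ} (hr : r ≤ R) {t : ℝ} (ht : t ∈ Icc 0 T) :
    ∫ x in B r, Q κ ur ut x t ∂mu ≤ ∫ x in B R, Q κ ur ut x t ∂mu :=
  setIntegral_mono_set (S.qi t ht) (Eventually.of_forall fun x => Q_nonneg _ _ _ _ _)
    (B_mono hr).eventuallyLE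

lemma mono (S : Sys κ R T Λ G M u ur ut urr utt v) {r : ℝ} (h0 : 0 < r) (hr : r ≤ R) :
    Sys κ r T Λ G M u ur ut urr utt v where
  κ0 := S.κ0
  R0 := h0
  T0 := S.T0
  Λ0 := S.Λ0
  G0 := S.G0
  M0 := S.M0
  sl := fun t ht => (S.sl t ht).mono hr
  bd := fun t ht x hx => S.bd t ht x (B_mono hr hx)
  vc := S.vc
  hv := fun x hx => S.hv x (B_mono hr hx)
  e1 := fun x hx => S.e1 x (B_mono hr hx)
  e2 := fun x hx => S.e2 x (B_mono hr hx)
  mu' := S.mu'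
  mur := S.mur
  muth := S.muth
  murr := S.murr
  mutt := S.mutt
  mv := S.mv
  qi := fun t ht => (S.qi t ht).mono_set (B_mono hr)
  qE := by
    obtain ⟨E, hE⟩ := S.qE
    exact ⟨E, fun t ht => (S.Q_mono hr ht).trans (hE t ht)⟩
  v2 := by
    refine S.v2.mono_measure ?_
    rw [Measure.prod_restrict, Measure.prod_restrict]
    exact Measure.restrict_mono (prod_mono (B_mono hr) le_rfl) le_rfl

/-- energy bound on a cylinder -/
def Bnd (κ : ℝ) (ur ut v : ℝ × ℝ → ℝ → ℝ) (r t0 A : ℝ) : Prop :=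
  ∀ᵐ t ∂(volume.restrict (Ioc (t0 - r^2) t0)),
    (∫ x in B r, Q κ ur ut x t ∂mu) ≤ A ∧ ∫ p, v p.1 p.2^2 ∂(stm r (t0-r^2) t) ≤ A

lemma stepCore (S : Sys κ R T Λ G M u ur ut urr utt v) {D : ℝ} {η η' : ℝ → ℝ} {r N t0 t1 A V : ℝ}
    (hr : 0 < r) (hN : 1 < N) (hNr : N^2 * r < R) (ht0 : t0 ≤ T) (hR : R^2 ≤ t0)
    (h1 : t0 - r^2 ≤ t1) (h1' : t1 ≤ t0) 
    (hA : ∀ᵐ t ∂(volume.restrict (Ioc (t0 - R^2) t0)), (∫ x in B R, Q κ ur ut x t ∂mu) ≤ A)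
    (k : Cut (N*r/2) (N*r) (2 * D/(N*r)) η η')
    {good : ℝ → Prop} 
    (hE : ∀ s ∈ Icc 0 T, ∀ t ∈ Icc 0 T, s ≤ t → good s → good t →
      (∫ x in B R, η x.1^2 * Q κ ur ut x t ∂mu) +
        (1/(2*Λ)) * ∫ p, η p.1.1^2 * v p.1 p.2^2 ∂(stm R s t) ≤
      (∫ x in B R, η x.1^2 * Q κ ur ut x s ∂mu) + Λ*G^2*(π*R^2*(t-s))
        + 8*Λ * ∫ p, η' p.1.1^2 * Q κ ur ut p.1 p.2 ∂(stm R s t))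
    (g1 : good t1) (hv1 : IntegrableOn (fun x => v x t1^2) (B R) mu)
    (hV : ∫ x in B R, v x t1^2 ∂mu ≤ V) (hA1 : (∫ x in B R, Q κ ur ut x t1 ∂mu) ≤ A)
    {t : ℝ} (ht1 : t1 ≤ t) (ht : t ≤ t0) (gt : good t) :
    (∫ x in B (N*r/2), Q κ ur ut x t ∂mu) +
        (1/(2*Λ)) * ∫ p, v p.1 p.2^2 ∂(stm (N*r/2) t1 t) ≤
      ((2*π*κ + 2*π^2*κ^2) * A + N^4*r^2 * (2 * Λ^2 * V) + 2*π*Λ^2*G^2*R^4) / Real.log N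
        + π*Λ*G^2*R^4 + 32 * Λ * D^2 / N^2 * A := by
  have hN0 : 0 < N := by linarith
  have hℓ : 0 < N * r := by positivity
  have hL := S.Λ0
  have hlt : r < R := by nlinarith
  have hNN : N * r ≤ N^2 * r := by nlinarith
  have hNR : N * r < R := lt_of_le_of_lt hNN hNr
  have rR : r^2 < R^2 := by nlinarith
  have it1 : t1 ∈ Icc 0 T := ⟨by linarith, by linarith⟩
  have it : t ∈ Icc 0 T := ⟨by linarith [it1.1], by linarith⟩
  have hlog : 0 < Real.log N := Real.log_pos hN
  have e := hE t1 it1 t it ht1 g1 gt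
  have hη2 : ∀ ρ, η ρ^2 ≤ 1 := k.sq.le1
  have abs1 : ∀ ρ, |η ρ^2| ≤ 1 := fun ρ => by rw [abs_of_nonneg (sq_nonneg _)]; exact hη2 ρ
  have hη'2 : ∀ ρ, η' ρ^2 ≤ (2 * D/(N*r))^2 := fun ρ => by
    rw [← sq_abs]; exact pow_le_pow_left₀ (abs_nonneg _) (k.bd _) 2
  have abs2 : ∀ ρ, |η' ρ^2| ≤ (2 * D/(N*r))^2 := fun ρ => by rw [abs_of_nonneg (sq_nonneg _)]; exact hη'2 ρ
  have ηQ : ∀ τ ∈ Icc 0 T, IntegrableOn (fun x => η x.1^2 * Q κ ur ut x τ) (B R) mu := by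
    intro τ hτ
    refine intB_of_le (S.qi τ hτ) ((k.sq.cont.comp continuous_fst).continuousOn.mul (S.sl τ hτ).toSl1.contOn_q) ?_
    intro x hx
    rw [abs_of_nonneg (mul_nonneg (sq_nonneg _) (Q_nonneg _ _ _ _ _))]
    exact mul_le_of_le_one_left (Q_nonneg _ _ _ _ _) (hη2 _)
  -- lower bounds
  have l1 : (∫ x in B (N*r/2), Q κ ur ut x t ∂mu) ≤ ∫ x in B R, η x.1^2 * Q κ ur ut x t ∂mu := by
    have : (∫ x in B (N*r/2), Q κ ur ut x t ∂mu) = ∫ x in B (N*r/2), η x.1^2 * Q κ ur ut x t ∂mu := by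
      refine setIntegral_congr_fun (B_meas _) fun x hx => ?_
      simp only [k.one x.1 (mem_B.1 hx).2.le]; ring
    rw [this]
    exact setIntegral_mono_set (ηQ t it) (Eventually.of_forall fun x => mul_nonneg (sq_nonneg _) (Q_nonneg _ _ _ _ _))
      (B_mono (by linarith)).eventuallyLE
  have l2 : ∫ p, v p.1 p.2^2 ∂(stm (N*r/2) t1 t) ≤ ∫ p, η p.1.1^2 * v p.1 p.2^2 ∂(stm R t1 t) := by
    have : ∫ p, v p.1 p.2^2 ∂(stm (N*r/2) t1 t) = ∫ p, η p.1.1^2 * v p.1 p.2^2 ∂(stm (N*r/2) t1 t) := by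
      refine integral_congr_ae ?_
      filter_upwards [ae_stm (N*r/2) t1 t] with p hp
      simp only [k.one p.1.1 (mem_B.1 hp.1).2.le]; ring
    rw [this]
    refine integral_mono_measure (stm_mono (by linarith) le_rfl le_rfl)
      (Eventually.of_forall fun x => mul_nonneg (sq_nonneg _) (sq_nonneg _)) ?_
    exact (wInt S.v2 k.sq.cont abs1).mono_measure (stm_le_pm it1.1 it.2)
  -- upper bounds
  have u1 : (∫ x in B R, η x.1^2 * Q κ ur ut x t1 ∂mu) ≤ ∫ x in B (N*r), Q κ ur ut x t1 ∂mu := by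
    rw [← setInt_B_eq hNR.le (fun x hx => by simp [k.zero _ hx])]
    refine integral_mono ((ηQ t1 it1).mono_set (B_mono hNR.le)) ((S.qi t1 it1).mono_set (B_mono hNR.le)) fun x => ?_
    exact mul_le_of_le_one_left (Q_nonneg _ _ _ _ _) (hη2 _)
  have W2 := S.W2_int it1 hv1
  have gr := growth S.κ0 (S.sl t1 it1) (S.bd t1 it1) (S.qi t1 it1) W2 hℓ hNN hNr
  have elog : N^2*r/(N*r) = N := by field_simp
  rw [elog] at gr
  change (∫ x in B (N*r), Q κ ur ut x t1 ∂mu) * Real.log N ≤ _ * (∫ x in B (N^2*r), Q κ ur ut x t1 ∂mu) +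
    _ * ∫ x in B (N^2*r), W κ ur urr utt x t1 ^2 ∂mu at gr
  have hv1' : IntegrableOn (fun x => v x t1^2) (B (N^2*r)) mu := hv1.mono_set (B_mono hNr.le)
  have w1 : ∫ x in B (N^2*r), W κ ur urr utt x t1 ^2 ∂mu ≤ 2*Λ^2*(V + G^2*(π*(N^2*r)^2)) := by
    have c1 : IntegrableOn (fun x => v x t1^2 + G^2) (B (N^2*r)) mu := Integrable.add hv1' (integrable_const (G^2))
    have c2 : IntegrableOn (fun x => 2*Λ^2*(v x t1^2 + G^2)) (B (N^2*r)) mu := Integrable.const_mul c1 _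
    have := setIntegral_mono_on (W2.mono_set (B_mono hNr.le)) c2 (B_meas _) (fun x hx => S.W_sq_le (B_mono hNr.le hx) it1)
    refine this.trans ?_
    rw [integral_const_mul]
    refine mul_le_mul_of_nonneg_left ?_ (by positivity)
    rw [integral_add hv1' (integrable_const _), integral_const, smul_eq_mul, measureReal_def, Measure.restrict_apply_univ,
      ← measureReal_def, mu_B_real (by positivity)]
    have : ∫ x in B (N^2*r), v x t1^2 ∂mu ≤ ∫ x in B R, v x t1^2 ∂mu :=
      setIntegral_mono_set hv1 (Eventually.of_forall fun x => sq_nonneg _) (B_mono hNr.le).eventuallyLE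
    linarith
  have q1 : (∫ x in B (N^2*r), Q κ ur ut x t1 ∂mu) ≤ A := (S.Q_mono hNr.le it1).trans hA1
  have κ0 := S.κ0
  have R0 := S.R0
  have x4 : (N^2*r)^4 ≤ R^4 := pow_le_pow_left₀ (by positivity) hNr.le 4
  have u2 : (∫ x in B (N*r), Q κ ur ut x t1 ∂mu) ≤
      ((2*π*κ + 2*π^2*κ^2) * A + N^4*r^2 * (2 * Λ^2 * V) + 2*π*Λ^2*G^2*R^4) / Real.log N := by
    rw [le_div_iff₀ hlog]
    refine gr.trans ?_
    have d1 : (2*π*κ + 2*π^2*κ^2) * (∫ x in B (N^2*r), Q κ ur ut x t1 ∂mu) ≤ (2*π*κ + 2*π^2*κ^2) * A :=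
      mul_le_mul_of_nonneg_left q1 (by positivity)
    have d2 := mul_le_mul_of_nonneg_left w1 (sq_nonneg (N^2*r))
    have d3 : 2*π*Λ^2*G^2*(N^2*r)^4 ≤ 2*π*Λ^2*G^2*R^4 := mul_le_mul_of_nonneg_left x4 (by positivity)
    nlinarith
  have u3 : ∫ p, η' p.1.1^2 * Q κ ur ut p.1 p.2 ∂(stm R t1 t) ≤ ((2 * D/(N*r))^2 * A) * (t - t1) := by
    have iQ := wInt S.Q_int (k.c.pow 2) abs2
    refine st_le it1.1 ht1 it.2 iQ ?_
    filter_upwards [ae_sub' hA (by linarith : t0 - R^2 ≤ t1) ht, ae_restrict_mem measurableSet_Ioc] with τ hτ hm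
    have iτ : τ ∈ Icc 0 T := ⟨by linarith [it1.1, hm.1], by linarith [hm.2]⟩
    have b1 : IntegrableOn (fun x => (2 * D/(N*r))^2 * Q κ ur ut x τ) (B R) mu := Integrable.const_mul (S.qi τ iτ) _
    have b2 : ∫ x in B R, η' x.1^2 * Q κ ur ut x τ ∂mu ≤ ∫ x in B R, (2 * D/(N*r))^2 * Q κ ur ut x τ ∂mu := by
      refine integral_mono_of_nonneg (Eventually.of_forall fun x => mul_nonneg (sq_nonneg _) (Q_nonneg _ _ _ _ _)) b1
        (Eventually.of_forall fun x => ?_)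
      exact mul_le_mul_of_nonneg_right (hη'2 _) (Q_nonneg _ _ _ _ _)
    rw [integral_const_mul] at b2
    exact b2.trans (mul_le_mul_of_nonneg_left hτ (sq_nonneg _))
  have A0 : 0 ≤ A := le_trans (integral_nonneg fun x => Q_nonneg _ _ _ _ _) hA1
  have htt : t - t1 ≤ r^2 := by linarith
  have u4 : 8*Λ*(((2 * D/(N*r))^2 * A) * (t - t1)) ≤ 32 * Λ * D^2 / N^2 * A := by
    have : 8*Λ*(((2 * D/(N*r))^2 * A) * (t - t1)) ≤ 8*Λ*(((2 * D/(N*r))^2 * A) * r^2) := by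
      refine mul_le_mul_of_nonneg_left (mul_le_mul_of_nonneg_left htt ?_) ?_ <;> positivity
    refine this.trans (le_of_eq ?_)
    field_simp; ring
  have u5 : Λ*G^2*(π*R^2*(t-t1)) ≤ π*Λ*G^2*R^4 := by
    have : Λ*G^2*(π*R^2*(t-t1)) ≤ Λ*G^2*(π*R^2*R^2) := by
      refine mul_le_mul_of_nonneg_left (mul_le_mul_of_nonneg_left (by linarith) ?_) ?_ <;> positivity
    refine this.trans (le_of_eq ?_); ring
  have u6 := mul_le_mul_of_nonneg_left u3 (by positivity : 0 ≤ 8*Λ)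
  have l3 := mul_le_mul_of_nonneg_left l2 (by positivity : 0 ≤ 1/(2*Λ))
  linarith

end Sys

end ConeH
end

section
open Real MeasureTheory Set Filter Topology
open scoped ENNReal

namespace ConeH

lemma choose_N (c d F : ℝ) (hF : 0 < F) : ∃ N : ℝ, 2 ≤ N ∧ c / Real.log N + d / N^2 ≤ F := by
  have h1 : Tendsto (fun N : ℝ => c / Real.log N) atTop (𝓝 0) := Real.tendsto_log_atTop.const_div_atTop c
  have h2 : Tendsto (fun N : ℝ => d / N^2) atTop (𝓝 0) := (tendsto_pow_atTop (by norm_num)).const_div_atTop d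
  have h3 := h1.add h2
  rw [add_zero] at h3
  obtain ⟨N, hN, hN2⟩ := ((h3.eventually (ge_mem_nhds hF)).and (eventually_ge_atTop 2)).exists
  exact ⟨N, hN2, hN⟩

set_option maxHeartbeats 1000000 in
lemma step (κ Λ : ℝ) (hκ : 0 < κ) (hΛ : 0 < Λ) : ∃ σ C : ℝ, 0 < σ ∧ σ ≤ 1/2 ∧ 0 ≤ C ∧
    ∀ (R T G M : ℝ) (u ur ut urr utt v : ℝ × ℝ → ℝ → ℝ), Sys κ R T Λ G M u ur ut urr utt v →
    ∀ t0 A : ℝ, R^2 ≤ t0 → t0 ≤ T → Sys.Bnd κ ur ut v R t0 A →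
      Sys.Bnd κ ur ut v (σ*R) t0 (A/2 + C*(G^2*R^4)) := by
  obtain ⟨D, hD0, hD⟩ := exists_cut
  set F := 1 + 2*Λ with hF
  have F0 : 0 < F := by positivity
  set cκ := 2*π*κ + 2*π^2*κ^2 with hcκ
  obtain ⟨N, hN2, hN⟩ := choose_N cκ (32*Λ*D^2) (1/(4*F)) (by positivity)
  have hN1 : 1 < N := by linarith
  have hlog : 0 < Real.log N := Real.log_pos hN1
  obtain ⟨n, hn⟩ := exists_nat_gt (N^4*(2*Λ^2*(4/3)) / Real.log N * (4*F))
  have n0 : (0:ℝ) < n := lt_of_le_of_lt (by positivity) hn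
  have hn' : N^4*(2*Λ^2*(4/3)) / Real.log N / n ≤ 1/(4*F) := by
    rw [div_le_div_iff₀ n0 (by positivity)]; linarith
  refine ⟨(1/2)^n/(2*N^2), F*(2*π*Λ^2/Real.log N + π*Λ), by positivity, ?_, by positivity, ?_⟩
  · rw [div_le_div_iff₀ (by positivity) (by norm_num)]
    have : ((1:ℝ)/2)^n ≤ 1 := pow_le_one₀ (by norm_num) (by norm_num)
    nlinarith
  intro R T G M u ur ut urr utt v S t0 A hR hT hB
  have R0 := S.R0
  set r : ℕ → ℝ := fun k => R/(2*N^2) * (1/2)^k with hr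
  have r0 : ∀ k, 0 < r k := fun k => by positivity
  have rs : ∀ k, r (k+1) = r k / 2 := fun k => by simp only [hr, pow_succ]; ring
  have rle : ∀ k, N^2 * r k ≤ R/2 := by
    intro k
    have : ((1:ℝ)/2)^k ≤ 1 := pow_le_one₀ (by norm_num) (by norm_num)
    calc N^2 * r k = R/2 * (1/2)^k := by simp only [hr]; field_simp
      _ ≤ R/2 * 1 := by gcongr
      _ = R/2 := by ring
  have rR : ∀ k, r k ≤ R/2 := by
    intro k; have h1 := rle k; have h2 := mul_le_mul_of_nonneg_right (one_le_pow₀ hN1.le : 1 ≤ N^2) (r0 k).le; linarith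
  have rR2 : ∀ k, r k^2 < R^2 := by
    intro k; have := rR k; have := r0 k; nlinarith
  set e : ℕ → ℝ := fun k => t0 - r k^2 with he
  have emono : ∀ k, e k < e (k+1) := by
    intro k; simp only [he]; have := rs k; have := r0 k; rw [rs k]; nlinarith
  have elt : ∀ k, e k < t0 := fun k => by simp only [he]; have := r0 k; nlinarith
  have egt : ∀ k, t0 - R^2 < e k := fun k => by simp only [he]; linarith [rR2 k]
  have e0 : ∀ k, 0 ≤ e k := fun k => by linarith [egt k]
  -- the function g
  set g : ℝ → ℝ := fun τ => ∫ x in B R, v x τ^2 ∂mu with hg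
  have gi : IntegrableOn g (Icc 0 T) := S.v2.integral_prod_right
  have g0 : ∀ τ, 0 ≤ g τ := fun τ => integral_nonneg fun x => sq_nonneg _
  have gii : ∀ a b, 0 ≤ a → a ≤ b → b ≤ T → IntervalIntegrable g volume a b := fun a b h1 h2 h3 => by
    rw [intervalIntegrable_iff_integrableOn_Ioc_of_le h2]
    exact gi.mono_set (Ioc_subset_Icc_self.trans (Icc_subset_Icc h1 h3))
  -- total bound
  obtain ⟨ts, hts, hts2⟩ := exists_good (elt n) (ae_sub' hB (egt n).le le_rfl)
  have A0 : 0 ≤ A := le_trans (integral_nonneg fun x => Q_nonneg _ _ _ _ _) hts2.1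
  have gst : ∀ a b, 0 ≤ a → a ≤ b → b ≤ T → ∫ τ in a..b, g τ = ∫ p, v p.1 p.2^2 ∂(stm R a b) :=
    fun a b h1 h2 h3 => st_eq h1 h2 h3 S.v2
  have tot : ∫ τ in (e 0)..(e n), g τ ≤ A := by
    have ee : e 0 ≤ e n := monotone_nat_of_le_succ (fun k => (emono k).le) (Nat.zero_le n)
    refine le_trans ?_ hts2.2
    rw [gst _ _ (e0 0) ee (by linarith [elt n])]
    refine integral_mono_measure (stm_mono le_rfl (egt 0).le hts.1.le) (Eventually.of_forall fun x => sq_nonneg _) ?_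
    exact S.v2.mono_measure (stm_le_pm (by linarith) (by linarith [hts.2]))
  have sumE := intervalIntegral.sum_integral_adjacent_intervals (f := g) (a := e) (n := n) (μ := volume) (fun k hk => gii _ _ (e0 k) (emono k).le (by linarith [elt (k+1)]))
  obtain ⟨k, hk, hkA⟩ : ∃ k ∈ Finset.range n, ∫ τ in (e k)..(e (k+1)), g τ ≤ A / n := by
    refine Finset.exists_le_of_sum_le ?_ ?_
    · rw [Finset.nonempty_range_iff]; rintro rfl; simp at n0
    · rw [sumE]; simp only [Finset.sum_const, Finset.card_range, nsmul_eq_mul]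
      rw [mul_div_cancel₀ _ n0.ne']; exact tot
  -- cutoff
  have Nr : 0 < N * r k := by have := r0 k; positivity
  obtain ⟨η, η', cut⟩ := hD (N * r k/2) (N * r k) (by linarith)
  have ed : D / (N * r k - N * r k/2) = 2*D/(N * r k) := by
    rw [div_eq_div_iff (by linarith) Nr.ne']; ring
  rw [ed] at cut
  have hNr : N^2 * r k < R := by linarith [rle k]
  have hNR : N * r k < R := by
    have h1 := mul_le_mul_of_nonneg_right hN1.le Nr.le
    have h2 : N * (N * r k) = N^2 * r k := by ring
    linarith
  obtain ⟨good, hgood, hE⟩ := S.energy cut Nr hNR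
  have hAll := hB
  have hQ : ∀ᵐ t ∂(volume.restrict (Ioc (t0 - R^2) t0)), (∫ x in B R, Q κ ur ut x t ∂mu) ≤ A :=
    hB.mono fun t h => h.1
  have ekT : e (k+1) ≤ T := by linarith [elt (k+1)]
  obtain ⟨t1, ht1, ⟨⟨g1, hv1⟩, q1⟩, hV⟩ := exists_good_avg (emono k) (g := g)
    (gi.mono_set (Ioc_subset_Icc_self.trans (Icc_subset_Icc (e0 k) ekT)))
    (((ae_sub hgood (e0 k) ekT).and (ae_sub S.good (e0 k) ekT)).and (ae_sub' hQ (egt k).le (elt (k+1)).le))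
  have hV2 : g t1 ≤ (4/3) * A / (n * r k^2) := by
    have : e (k+1) - e k = (3/4) * r k^2 := by simp only [he, rs]; ring
    rw [this] at hV
    have h3 := hV.trans hkA
    have rk2 : 0 < r k^2 := pow_pos (r0 k) 2
    rw [le_div_iff₀ (by positivity)]
    rw [le_div_iff₀ n0] at h3
    nlinarith
  -- conclusion
  set σ := ((1:ℝ)/2)^n/(2*N^2) with hσ
  have kn : k < n := Finset.mem_range.1 hk
  have hσr : σ * R ≤ r k / 2 := by
    have : ((1:ℝ)/2)^n ≤ (1/2)^(k+1) := pow_le_pow_of_le_one (by norm_num) (by norm_num) kn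
    calc σ * R = R/(2*N^2) * (1/2)^n := by simp only [hσ]; ring
      _ ≤ R/(2*N^2) * (1/2)^(k+1) := by gcongr
      _ = r k / 2 := by rw [← rs]
  have σ0 : 0 < σ := by positivity
  have hσR : 0 < σ * R := by positivity
  have hs1 : t1 ≤ t0 - (σ*R)^2 := by
    have h2 : (σ*R)^2 ≤ (r k/2)^2 := pow_le_pow_left₀ hσR.le hσr 2
    have := ht1.2
    simp only [he, rs] at this
    linarith
  have hσℓ : σ * R ≤ N * r k / 2 := by
    have h1 := mul_le_mul_of_nonneg_right hN1.le (r0 k).le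
    linarith
  have st0 : 0 ≤ t1 := by linarith [ht1.1, e0 k]
  filter_upwards [ae_sub hgood (by linarith : 0 ≤ t0 - (σ*R)^2) hT, ae_restrict_mem measurableSet_Ioc] with t gt hmt
  have main := S.stepCore (r0 k) hN1 hNr hT hR ht1.1.le (by linarith [ht1.2, elt (k+1)]) hQ cut hE g1 hv1 hV2 q1
    (by linarith [hmt.1] : t1 ≤ t) hmt.2 gt
  have itt : t ∈ Icc 0 T := ⟨by linarith [hmt.1], by linarith [hmt.2]⟩
  have X : ((2*π*κ + 2*π^2*κ^2) * A + N^4*r k^2 * (2 * Λ^2 * ((4/3) * A / (n * r k^2))) + 2*π*Λ^2*G^2*R^4) / Real.log N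
        + π*Λ*G^2*R^4 + 32 * Λ * D^2 / N^2 * A ≤ A/(2*F) + (2*π*Λ^2/Real.log N + π*Λ)*(G^2*R^4) := by
    have rk := (r0 k).ne'
    have e1 : ((2*π*κ + 2*π^2*κ^2) * A + N^4*r k^2 * (2 * Λ^2 * ((4/3) * A / (n * r k^2))) + 2*π*Λ^2*G^2*R^4) / Real.log N
        + π*Λ*G^2*R^4 + 32 * Λ * D^2 / N^2 * A = (cκ/Real.log N + 32*Λ*D^2/N^2) * A +
        (N^4*(2*Λ^2*(4/3)) / Real.log N / n) * A + (2*π*Λ^2/Real.log N + π*Λ)*(G^2*R^4) := by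
      simp only [hcκ]
      field_simp
      ring
    rw [e1]
    have := mul_le_mul_of_nonneg_right hN A0
    have := mul_le_mul_of_nonneg_right hn' A0
    have : 1/(4*F)*A + 1/(4*F)*A = A/(2*F) := by field_simp; ring
    linarith
  have main2 := main.trans X
  set Y := A/(2*F) + (2*π*Λ^2/Real.log N + π*Λ)*(G^2*R^4) with hY
  have Y0 : 0 ≤ Y := by positivity
  have p1 : 0 ≤ ∫ x in B (N*r k/2), Q κ ur ut x t ∂mu := integral_nonneg fun x => Q_nonneg _ _ _ _ _
  have p2 : 0 ≤ ∫ p, v p.1 p.2^2 ∂(stm (N*r k/2) t1 t) := integral_nonneg fun x => sq_nonneg _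
  have goalE : A/2 + F*(2*π*Λ^2/Real.log N + π*Λ)*(G^2*R^4) = F * Y := by
    rw [hY]; field_simp
  rw [goalE]
  have S' := S.mono (r := N*r k/2) (by linarith) (by linarith)
  constructor
  · refine (S'.Q_mono hσℓ itt).trans ?_
    have : 0 ≤ (1/(2*Λ)) * ∫ p, v p.1 p.2^2 ∂(stm (N*r k/2) t1 t) := by positivity
    have : 0 ≤ 2*Λ*Y := by positivity
    rw [hF]; nlinarith
  · have m1 : ∫ p, v p.1 p.2^2 ∂(stm (σ*R) (t0 - (σ*R)^2) t) ≤ ∫ p, v p.1 p.2^2 ∂(stm (N*r k/2) t1 t) :=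
      integral_mono_measure (stm_mono hσℓ hs1 le_rfl) (Eventually.of_forall fun x => sq_nonneg _)
        (S'.v2.mono_measure (stm_le_pm st0 itt.2))
    refine m1.trans ?_
    have h5 : (1/(2*Λ)) * ∫ p, v p.1 p.2^2 ∂(stm (N*r k/2) t1 t) ≤ Y := by linarith
    rw [one_div, inv_mul_le_iff₀ (by positivity)] at h5
    rw [hF]; nlinarith

end ConeH
end

section
open Real MeasureTheory Set Filter Topology
open scoped ENNReal

namespace ConeH

variable {κ R T Λ G M : ℝ} {u ur ut urr utt v : ℝ × ℝ → ℝ → ℝ}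

lemma Sys.Bnd_mono (S : Sys κ R T Λ G M u ur ut urr utt v) {r t0 A A' : ℝ} (hr0 : 0 < r) (hr : r ≤ R)
    (hR : R^2 ≤ t0) (hT : t0 ≤ T) (hA : A ≤ A')
    (h : Sys.Bnd κ ur ut v R t0 A) : Sys.Bnd κ ur ut v r t0 A' := by
  have r2 : r^2 ≤ R^2 := pow_le_pow_left₀ hr0.le hr 2
  have h1 : t0 - R^2 ≤ t0 - r^2 := by linarith
  unfold Bnd
  filter_upwards [ae_sub' h h1 le_rfl, ae_restrict_mem measurableSet_Ioc] with t ht hm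
  have it : t ∈ Icc 0 T := ⟨by linarith [hm.1], by linarith [hm.2]⟩
  refine ⟨((S.Q_mono hr it).trans ht.1).trans hA, (le_trans ?_ ht.2).trans hA⟩
  exact integral_mono_measure (stm_mono hr h1 le_rfl) (Eventually.of_forall fun x => sq_nonneg _)
        (S.v2.mono_measure (stm_le_pm (by linarith) it.2))

lemma decay (κ Λ : ℝ) (hκ : 0 < κ) (hΛ : 0 < Λ) : ∃ α C : ℝ, 0 < α ∧ 0 < C ∧
    ∀ (R T G M : ℝ) (u ur ut urr utt v : ℝ × ℝ → ℝ → ℝ), Sys κ R T Λ G M u ur ut urr utt v →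
    ∀ t0 A : ℝ, R^2 ≤ t0 → t0 ≤ T → 0 ≤ A → Sys.Bnd κ ur ut v R t0 A → ∀ r, 0 < r → r ≤ R →
      Sys.Bnd κ ur ut v r t0 (C * (r/R)^(2*α) * (A + G^2*R^4)) := by
  obtain ⟨σ, C, σ0, σ1, C0, hst⟩ := step κ Λ hκ hΛ
  have hls : Real.log σ < 0 := Real.log_neg σ0 (by linarith)
  have hl2 : Real.log (1/2) < 0 := Real.log_neg (by norm_num) (by norm_num)
  set α := Real.log (1/2) / (2 * Real.log σ) with hα
  have α0 : 0 < α := div_pos_of_neg_of_neg hl2 (by linarith)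
  have hσα : σ ^ (2*α) = 1/2 := by
    rw [Real.rpow_def_of_pos σ0, hα]
    have : Real.log σ * (2 * (Real.log (1/2) / (2 * Real.log σ))) = Real.log (1/2) := by
      have := hls.ne
      field_simp
    rw [this, Real.exp_log (by norm_num)]
  refine ⟨α, 2*(1+4*C), α0, by positivity, ?_⟩
  intro R T G M u ur ut urr utt v S t0 A hR hT hA0 hB r r0 hrR
  have R0 := S.R0
  have hpow : ∀ m : ℕ, σ^m ≤ 1 := fun m => pow_le_one₀ σ0.le (by linarith)
  have hS : ∀ m : ℕ, Sys κ (σ^m*R) T Λ G M u ur ut urr utt v := fun m =>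
    S.mono (by positivity) (mul_le_of_le_one_left R0.le (hpow m))
  have hR2 : ∀ m : ℕ, (σ^m*R)^2 ≤ t0 := fun m =>
    (pow_le_pow_left₀ (by positivity) (mul_le_of_le_one_left R0.le (hpow m)) 2).trans hR
  have key : ∀ m : ℕ, ∃ Am : ℝ, Sys.Bnd κ ur ut v (σ^m*R) t0 Am ∧
      Am + 4*C*(G^2*(σ^m*R)^4) ≤ (1/2)^m * (A + 4*C*(G^2*R^4)) := by
    intro m
    induction m with
    | zero => exact ⟨A, by simpa using hB, by simp⟩
    | succ m ih =>
      obtain ⟨Am, h1, h2⟩ := ih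
      refine ⟨_, by
        have := hst _ _ _ _ _ _ _ _ _ _ (hS m) t0 Am (hR2 m) hT h1
        rwa [← mul_assoc, ← pow_succ'] at this, ?_⟩
      have e : (σ^(m+1)*R)^4 = σ^4 * (σ^m*R)^4 := by ring
      rw [e, pow_succ (1/2:ℝ)]
      set P := G^2*(σ^m*R)^4 with hP
      have P0 : 0 ≤ P := by positivity
      have s4 : σ^4 ≤ 1/4 := by
        have : σ^4 ≤ (1/2)^4 := pow_le_pow_left₀ σ0.le σ1 4
        linarith
      have e2 : G^2 * (σ^4 * (σ^m*R)^4) = σ^4 * P := by rw [hP]; ring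
      rw [e2]
      have := mul_le_mul_of_nonneg_right s4 (mul_nonneg C0 P0)
      nlinarith
  have hrR1 : r / R ≤ 1 := by rw [div_le_one R0]; exact hrR
  obtain ⟨m, hm1, hm2⟩ := exists_nat_pow_near_of_lt_one (div_pos r0 R0) hrR1 σ0 (by linarith)
  obtain ⟨Am, h1, h2⟩ := key m
  rw [div_le_iff₀ R0] at hm2
  refine (hS m).Bnd_mono r0 hm2 (hR2 m) hT ?_ h1
  have h3 : ((1:ℝ)/2)^(m+1) ≤ (r/R)^(2*α) := by
    rw [← hσα, ← Real.rpow_natCast, ← Real.rpow_mul σ0.le, mul_comm, Real.rpow_mul σ0.le, Real.rpow_natCast]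
    exact Real.rpow_le_rpow (by positivity) hm1.le (by positivity)
  have h4 : Am ≤ (1/2)^m * (A + 4*C*(G^2*R^4)) := by
    have : 0 ≤ 4*C*(G^2*(σ^m*R)^4) := by positivity
    linarith
  have h5 : A + 4*C*(G^2*R^4) ≤ (1+4*C)*(A + G^2*R^4) := by
    have : 0 ≤ G^2*R^4 := by positivity
    nlinarith
  calc Am ≤ (1/2)^m * (A + 4*C*(G^2*R^4)) := h4
    _ ≤ (2 * (r/R)^(2*α)) * ((1+4*C)*(A + G^2*R^4)) := by
      have : ((1:ℝ)/2)^m ≤ 2 * (r/R)^(2*α) := by rw [pow_succ] at h3; linarith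
      gcongr
    _ = _ := by ring

end ConeH
end

section
open Real MeasureTheory Set Filter Topology
open scoped ENNReal

namespace ConeH

lemma absorb {J : ℝ → ℝ} {s1 s0 B0 C : ℝ} (h10 : s1 < s0) (hC : 0 ≤ C)
    (hB : ∀ s ∈ Ioc s1 s0, J s ≤ B0)
    (h : ∀ s d, s1 < s → 0 < d → d ≤ s - s1 → s + d ≤ s0 → J (s+d) ≤ J s / 8 + C / d^2) :
    J s0 ≤ 8 * C / (s0-s1)^2 := by
  have key : ∀ n : ℕ, ∀ s ∈ Ioc s1 s0, J s * (s-s1)^2 ≤ (1/2)^n * (|B0| * (s0-s1)^2) + 8*C := by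
    intro n
    induction n with
    | zero =>
      intro s hs
      have h1 : J s ≤ |B0| := (hB s hs).trans (le_abs_self _)
      have h2 : (s-s1)^2 ≤ (s0-s1)^2 := pow_le_pow_left₀ (by linarith [hs.1]) (by linarith [hs.2]) 2
      have h3 : J s * (s-s1)^2 ≤ |B0| * (s0-s1)^2 :=
        (mul_le_mul_of_nonneg_right h1 (sq_nonneg _)).trans (mul_le_mul_of_nonneg_left h2 (abs_nonneg _))
      simp; linarith
    | succ n ih =>
      intro s hs
      have p : 0 < (s - s1)/2 := by linarith [hs.1]
      have h1 := h (s - (s-s1)/2) ((s-s1)/2) (by linarith) p (by linarith) (by linarith [hs.2])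
      have h2 := ih (s - (s-s1)/2) ⟨by linarith, by linarith [hs.2]⟩
      rw [sub_add_cancel] at h1
      have e : s - (s-s1)/2 - s1 = (s-s1)/2 := by ring
      rw [e] at h2
      set d := (s-s1)/2 with hd
      have e2 : (s-s1)^2 = 4*d^2 := by rw [hd]; ring
      rw [e2]
      have d2 : 0 < d^2 := by positivity
      have h3 : J s * (4*d^2) ≤ (J (s-d)/8 + C/d^2) * (4*d^2) := mul_le_mul_of_nonneg_right h1 (by positivity)
      have h4 : (J (s-d)/8 + C/d^2) * (4*d^2) = J (s-d) * d^2/2 + 4*C := by field_simp; ring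
      rw [pow_succ (1/2:ℝ)]
      linarith
  have lim : Tendsto (fun n : ℕ => ((1:ℝ)/2)^n * (|B0| * (s0-s1)^2) + 8*C) atTop (𝓝 (0 * (|B0| * (s0-s1)^2) + 8*C)) :=
    ((tendsto_pow_atTop_nhds_zero_of_lt_one (by norm_num) (by norm_num)).mul_const _).add_const _
  have := ge_of_tendsto' lim (fun n => key n s0 ⟨h10, le_rfl⟩)
  rw [zero_mul, zero_add] at this
  rw [le_div_iff₀ (pow_pos (by linarith) 2)]; exact this

variable {κ R T Λ G M : ℝ} {u ur ut urr utt v : ℝ × ℝ → ℝ → ℝ}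

namespace Sys

lemma etaQ_int (S : Sys κ R T Λ G M u ur ut urr utt v) {a b D : ℝ} {η η' : ℝ → ℝ}
    (k : Cut a b D η η') {τ : ℝ} (hτ : τ ∈ Icc 0 T) :
    IntegrableOn (fun x => η x.1 * Q κ ur ut x τ) (B R) mu := by
  refine intB_of_le (S.qi τ hτ) ((k.cont.comp continuous_fst).continuousOn.mul (S.sl τ hτ).toSl1.contOn_q) ?_
  intro x hx
  rw [abs_of_nonneg (mul_nonneg (k.nn _) (Q_nonneg _ _ _ _ _))]
  exact mul_le_of_le_one_left (Q_nonneg _ _ _ _ _) (k.le1 _)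

lemma etav_int {w : ℝ × ℝ → ℝ} {a b D : ℝ} {η η' : ℝ → ℝ}
    (k : Cut a b D η η') (g : IntegrableOn w (B R) mu) :
    IntegrableOn (fun x => η x.1 * w x) (B R) mu := by
  refine Integrable.bdd_mul (c := 1) g (k.cont.comp continuous_fst).aestronglyMeasurable
    (Eventually.of_forall fun x => ?_)
  simp only [Function.comp, norm_eq_abs]
  rw [abs_of_nonneg (k.nn _)]; exact k.le1 _

lemma Yb (S : Sys κ R T Λ G M u ur ut urr utt v) {a b D : ℝ} {η η' : ℝ → ℝ}
    (k : Cut a b D η η') (hb0 : 0 < b) (hbR : b < R) {t : ℝ} (ht : t ∈ Icc 0 T)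
    (g : IntegrableOn (fun x => v x t ^2) (B R) mu) {ε : ℝ} (hε : 0 < ε) :
    ∫ x in B R, η x.1^2 * Q κ ur ut x t ∂mu ≤ ε * (∫ x in B R, (η x.1^2)^2 * v x t^2 ∂mu)
      + (M^2*Λ^2/ε + 2*M*Λ*G + 4*M^2*D^2) * (π*R^2) := by
  obtain ⟨hi, h0⟩ := ibp_cut (S.sl t ht) (S.sl t ht).toSl1 k.sq hb0 hbR (S.bd t ht) (S.qi t ht) (S.qi t ht)
    (S.W2_int ht g)
  have iQ := S.etaQ_int k.sq ht
  have iv := etav_int k.sq.sq g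
  set c := M^2*Λ^2/ε + 2*M*Λ*G + 4*M^2*D^2 with hc
  have ic : IntegrableOn (fun _ : ℝ × ℝ => c) (B R) mu := integrable_const _
  have i1 : IntegrableOn (fun x => (1/2) * (η x.1^2 * Q κ ur ut x t)) (B R) mu := Integrable.const_mul iQ _
  have i2 : IntegrableOn (fun x => (ε/2) * ((η x.1^2)^2 * v x t^2)) (B R) mu := Integrable.const_mul iv _
  have i3 : IntegrableOn (fun x => (1/2) * (η x.1^2 * Q κ ur ut x t) - (ε/2) * ((η x.1^2)^2 * v x t^2)) (B R) mu := Integrable.sub i1 i2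
  have i4 : IntegrableOn (fun _ : ℝ × ℝ => c/2) (B R) mu := integrable_const _
  have hm := setIntegral_mono_on (Integrable.sub i3 i4) hi (B_meas R) (fun x hx => by
    have hu := S.bd t ht x hx
    have hw := S.e1 x hx t ht
    have hq := ur_sq_le_Q (κ := κ) (ur := ur) (ut := ut) x t
    have hη' := k.bd x.1
    have hη0 := k.nn x.1
    have hη1 := k.le1 x.1
    have M0 := S.M0
    have L0 := S.Λ0
    have G0 := S.G0
    change _ ≤ η x.1^2 * qq κ (fun x => ur x t) (fun x => ut x t) (fun x => ur x t) (fun x => ut x t) x +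
      u x t * (η x.1^2 * W κ ur urr utt x t + 2 * η x.1 * η' x.1 * ur x t)
    change |W κ ur urr utt x t| ≤ _ at hw
    rw [qq_self]
    change (1/2) * (η x.1^2 * Q κ ur ut x t) - (ε/2) * ((η x.1^2)^2 * v x t^2) - c/2 ≤ 
      η x.1^2 * Q κ ur ut x t + u x t * (η x.1^2 * W κ ur urr utt x t + 2 * η x.1 * η' x.1 * ur x t)
    set w := W κ ur urr utt x t
    set z := ur x t
    set U := u x t
    set V := v x t
    set e := η x.1
    set e' := η' x.1
    set q' := Q κ ur ut x t
    have D0 : 0 ≤ D := (abs_nonneg _).trans hη'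
    have e2 : e^2 ≤ 1 := by nlinarith
    have b1 : |U * (e^2 * w)| ≤ (ε/2) * ((e^2)^2*V^2) + M^2*Λ^2/(2*ε) + M*Λ*G := by
      rw [abs_mul, abs_mul, abs_of_nonneg (sq_nonneg e)]
      have c1 : |U| * (e^2*|w|) ≤ M * (e^2 * (Λ*(|V|+G))) := by
        have : e^2*|w| ≤ e^2 * (Λ*(|V|+G)) := mul_le_mul_of_nonneg_left hw (sq_nonneg _)
        exact mul_le_mul hu this (by positivity) M0
      have c2 : M * (e^2 * (Λ*(|V|+G))) ≤ M*Λ*(e^2*|V|) + M*Λ*G := by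
        have : e^2 * (M*Λ*G) ≤ M*Λ*G := mul_le_of_le_one_left (by positivity) e2
        nlinarith
      have c3 : M*Λ*(e^2*|V|) ≤ (ε/2) * ((e^2)^2*V^2) + M^2*Λ^2/(2*ε) := by
        have c4 : 0 ≤ (ε * (e^2*|V|) - M*Λ)^2/(2*ε) := by positivity
        have c5 : (ε * (e^2*|V|) - M*Λ)^2/(2*ε) = (ε/2) * ((e^2)^2*|V|^2) + M^2*Λ^2/(2*ε) - M*Λ*(e^2*|V|) := by
          field_simp; ring
        rw [sq_abs] at c5
        linarith
      linarith
    have b2 : |U * (2*e*e'*z)| ≤ (1/2)*(e^2*z^2) + 2*M^2*D^2 := by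
      have c1 : |U * (2*e*e'*z)| = |U| * |e'| * (2 * (e*|z|)) := by
        rw [abs_mul, abs_mul, abs_mul, abs_mul, abs_two, abs_of_nonneg hη0]; ring
      rw [c1]
      have c2 : |U| * |e'| ≤ M * D := mul_le_mul hu hη' (abs_nonneg _) M0
      have c3 : 0 ≤ 2 * (e*|z|) := by positivity
      have c4 := mul_le_mul_of_nonneg_right c2 c3
      have c5 : e^2*z^2 = (e*|z|)^2 := by rw [mul_pow, sq_abs]
      rw [c5]
      nlinarith [sq_nonneg (e*|z| - 2*(M*D))]
    have b3 : e^2*z^2 ≤ e^2*q' := mul_le_mul_of_nonneg_left hq (sq_nonneg _)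
    have b4 : c/2 = M^2*Λ^2/(2*ε) + M*Λ*G + 2*M^2*D^2 := by rw [hc]; field_simp; ring
    have b5 := neg_le_of_abs_le b1
    have b6 := neg_le_of_abs_le b2
    rw [b4, mul_add]
    linarith)
  change ∫ x in B R, ((1/2) * (η x.1^2 * Q κ ur ut x t) - (ε/2) * ((η x.1^2)^2 * v x t^2) - c/2) ∂mu ≤ _ at hm
  rw [h0, integral_sub i3 i4, integral_sub i1 i2, integral_const_mul, integral_const_mul, integral_const, smul_eq_mul, measureReal_def, Measure.restrict_apply_univ,
      ← measureReal_def, mu_B_real S.R0.le] at hm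
  linarith

end Sys

end ConeH
end

section
open Real MeasureTheory Set Filter Topology
open scoped ENNReal

namespace ConeH

lemma initAbs {T Λ P N C0 δ : ℝ} {Y Z j : ℝ → ℝ} (hΛ : 0 < Λ) (hP : 0 ≤ P) (hN : 0 ≤ N) (hC0 : 0 ≤ C0)
    (hδ0 : 0 < δ) (hδ1 : δ ≤ 1)
    (hY : IntegrableOn Y (Icc 0 T)) (hj : IntegrableOn j (Icc 0 T)) (Y0 : ∀ τ, 0 ≤ Y τ)
    (Z0 : ∀ τ, 0 ≤ Z τ) (j0 : ∀ τ, 0 ≤ j τ) {good : ℝ → Prop}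
    (hg : ∀ᵐ t ∂(volume.restrict (Icc 0 T)), good t)
    (hE : ∀ s ∈ Icc 0 T, ∀ t ∈ Icc 0 T, s ≤ t → good s → good t →
      Z t + (1/(2*Λ)) * (∫ τ in s..t, j τ) ≤ Y s + P * (t - s) + N * ∫ τ in s..t, Y τ)
    (hYb : ∀ᵐ t ∂(volume.restrict (Icc 0 T)), ∀ ε > 0, Y t ≤ ε * j t + C0 * (1 + 1/ε))
    {e : ℝ} (he : e ∈ Icc δ T) :
    ∀ᵐ t ∂(volume.restrict (Ioc (e-δ/2) e)),
      Z t ≤ (4/δ + N) * (128 * (2*Λ*(1+N)*C0*(1+16*Λ*(1+N))+2*Λ*P)/δ^2 + 2*C0) + P ∧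
      (∫ τ in (e-δ/2)..t, j τ) ≤ 128 * (2*Λ*(1+N)*C0*(1+16*Λ*(1+N))+2*Λ*P)/δ^2 := by
  have heT := he.2
  have heδ := he.1
  have gS : ∀ᵐ t ∂(volume.restrict (Ioc (e-δ/2) e)), good t := ae_sub hg (by linarith) heT
  filter_upwards [gS, ae_restrict_mem measurableSet_Ioc] with t gt ht
  have htT : t ∈ Icc 0 T := ⟨by linarith [ht.1], by linarith [ht.2]⟩
  set K := 1 + N with hK
  have K0 : 0 < K := by linarith
  set Cc := 2*Λ*K*C0*(1+16*Λ*K)+2*Λ*P with hCc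
  have Cc0 : 0 ≤ Cc := by positivity
  have iiY : ∀ s ∈ Icc 0 T, ∀ s' ∈ Icc 0 T, IntervalIntegrable Y volume s s' := by
    intro s hs s' hs'
    rw [intervalIntegrable_iff]
    exact hY.mono_set (uIoc_subset_uIcc.trans (uIcc_subset_Icc hs hs'))
  have iij : ∀ s ∈ Icc 0 T, ∀ s' ∈ Icc 0 T, IntervalIntegrable j volume s s' := by
    intro s hs s' hs'
    rw [intervalIntegrable_iff]
    exact hj.mono_set (uIoc_subset_uIcc.trans (uIcc_subset_Icc hs hs'))
  have jm : ∀ s s', 0 ≤ s → s ≤ s' → s' ≤ t → (∫ τ in s'..t, j τ) ≤ ∫ τ in s..t, j τ := by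
    intro s s' h0 h1 h2
    have a1 : s ∈ Icc 0 T := ⟨h0, by linarith [htT.2]⟩
    have a2 : s' ∈ Icc 0 T := ⟨by linarith, by linarith [htT.2]⟩
    rw [← intervalIntegral.integral_add_adjacent_intervals (iij s a1 s' a2) (iij s' a2 t htT)]
    have := intervalIntegral.integral_nonneg (μ := volume) h1 (fun τ _ => j0 τ)
    linarith
  have Ym : ∀ s s', 0 ≤ s → s ≤ s' → s' ≤ t → (∫ τ in s'..t, Y τ) ≤ (∫ τ in s..t, Y τ) ∧ (∫ τ in s..s', Y τ) ≤ (∫ τ in s..t, Y τ) := by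
    intro s s' h0 h1 h2
    have a1 : s ∈ Icc 0 T := ⟨h0, by linarith [htT.2]⟩
    have a2 : s' ∈ Icc 0 T := ⟨by linarith, by linarith [htT.2]⟩
    rw [← intervalIntegral.integral_add_adjacent_intervals (iiY s a1 s' a2) (iiY s' a2 t htT)]
    have := intervalIntegral.integral_nonneg (μ := volume) h1 (fun τ _ => Y0 τ)
    have := intervalIntegral.integral_nonneg (μ := volume) h2 (fun τ _ => Y0 τ)
    constructor <;> linarith
  have Yi : ∀ s, e - δ ≤ s → s ≤ t → ∀ ε > 0, (∫ τ in s..t, Y τ) ≤ ε * (∫ τ in s..t, j τ) + C0 * (1 + 1/ε) := by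
    intro s h0 h1 ε hε
    have a1 : s ∈ Icc 0 T := ⟨by linarith, by linarith [htT.2]⟩
    have h2 : (∫ τ in s..t, Y τ) ≤ ∫ τ in s..t, (ε * j τ + C0 * (1+1/ε)) := by
      refine intervalIntegral.integral_mono_ae_restrict h1 (iiY s a1 t htT)
        (((iij s a1 t htT).const_mul ε).add intervalIntegrable_const) ?_
      have := ae_restrict_of_ae_restrict_of_subset (Icc_subset_Icc a1.1 htT.2) hYb
      filter_upwards [this] with τ hτ using hτ ε hε
    rw [intervalIntegral.integral_add ((iij s a1 t htT).const_mul ε) intervalIntegrable_const,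
      intervalIntegral.integral_const_mul, intervalIntegral.integral_const, smul_eq_mul] at h2
    have : (t-s) * (C0 * (1+1/ε)) ≤ C0 * (1+1/ε) :=
      mul_le_of_le_one_left (by positivity) (by linarith [ht.2])
    linarith
  have main : ∀ s d, e - δ < s → 0 < d → s + d ≤ e - δ/2 →
      ∃ s' ∈ Ioc s (s+d), good s' ∧ Y s' + P * (t - s') + N * (∫ τ in s'..t, Y τ) ≤ (1/d + N) * (∫ τ in s..t, Y τ) + P := by
    intro s d hs hd hsd
    have a1 : s ∈ Icc 0 T := ⟨by linarith, by linarith [htT.2]⟩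
    have a2 : s+d ∈ Icc 0 T := ⟨by linarith, by linarith [htT.2]⟩
    obtain ⟨s', m, g', h⟩ := exists_good_avg (s := s) (t := s+d) (by linarith) (g := Y)
      (hY.mono_set (Ioc_subset_Icc_self.trans (Icc_subset_Icc a1.1 a2.2))) (P := good) (ae_sub hg a1.1 a2.2)
    refine ⟨s', m, g', ?_⟩
    rw [add_sub_cancel_left] at h
    have h1 := (Ym s (s+d) a1.1 (by linarith) (by linarith [ht.1])).2
    have h2 := (Ym s s' a1.1 m.1.le (by linarith [ht.1, m.2])).1
    have h3 : Y s' ≤ 1/d * ∫ τ in s..t, Y τ := by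
      rw [one_div, ← div_eq_inv_mul, le_div_iff₀ hd]; linarith
    have h4 := mul_le_mul_of_nonneg_left h2 hN
    have h5 : P * (t-s') ≤ P := mul_le_of_le_one_right hP (by linarith [m.1, ht.2])
    rw [add_mul]; linarith
  have abs := absorb (J := fun s => ∫ τ in s..t, j τ) (s1 := e - δ) (s0 := e - 3*δ/4) (B0 := ∫ τ in (0:ℝ)..t, j τ)
    (C := Cc) (by linarith) Cc0 (fun s hs => jm 0 s le_rfl (by linarith [hs.1]) (by linarith [hs.2, ht.1])) (by
      intro s d hs hd hd1 hsd
      obtain ⟨s', m, g', h⟩ := main s d hs hd (by linarith)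
      have a1 : s' ∈ Icc 0 T := ⟨by linarith [m.1], by linarith [htT.2, m.2, ht.1]⟩
      have h1 := hE s' a1 t htT (by linarith [m.2, ht.1]) g' gt
      have h2 := jm s' (s+d) a1.1 m.2 (by linarith [ht.1])
      have hε : 0 < d/(16*Λ*K) := by positivity
      have h3 := Yi s hs.le (by linarith [ht.1]) _ hε
      have h4 : 1/d + N ≤ K/d := by
        rw [hK, add_div]; gcongr; rw [le_div_iff₀ hd]; nlinarith
      have I0 : 0 ≤ ∫ τ in s..t, Y τ := intervalIntegral.integral_nonneg (by linarith [ht.1]) (fun τ _ => Y0 τ)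
      have h5 : (1/d + N) * (∫ τ in s..t, Y τ) ≤ K/d * (d/(16*Λ*K) * (∫ τ in s..t, j τ) + C0 * (1 + 1/(d/(16*Λ*K)))) :=
        mul_le_mul h4 h3 I0 (by positivity)
      have h6 := Z0 t
      have h7 : (1/(2*Λ)) * (∫ τ in (s+d)..t, j τ) ≤ K/d * (d/(16*Λ*K) * (∫ τ in s..t, j τ) + C0 * (1 + 1/(d/(16*Λ*K)))) + P := by
        have := mul_le_mul_of_nonneg_left h2 (show 0 ≤ 1/(2*Λ) by positivity)
        linarith
      have d1 : d ≤ 1 := by linarith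
      have d2 : d^2 ≤ d := by nlinarith
      have d3 : d^2 ≤ 1 := by nlinarith
      have h8 := mul_le_mul_of_nonneg_left h7 (show 0 ≤ 2*Λ by positivity)
      rw [← mul_assoc, mul_one_div_cancel (by positivity), one_mul] at h8
      refine h8.trans ?_
      have e1 : 2*Λ * (K/d * (d/(16*Λ*K) * (∫ τ in s..t, j τ) + C0 * (1 + 1/(d/(16*Λ*K)))) + P)
        = (∫ τ in s..t, j τ)/8 + (2*Λ*K*C0*(d + 16*Λ*K) + 2*Λ*P*d^2)/d^2 := by
          field_simp; ring
      rw [e1, hCc]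
      have x1 : 2*Λ*K*C0*(d + 16*Λ*K) ≤ 2*Λ*K*C0*(1 + 16*Λ*K) :=
        mul_le_mul_of_nonneg_left (by linarith) (by positivity)
      have x2 : 2*Λ*P*d^2 ≤ 2*Λ*P := mul_le_of_le_one_right (by positivity) d3
      have x3 := div_le_div_of_nonneg_right (add_le_add x1 x2) (sq_nonneg d)
      linarith)
  have e2 : 8 * Cc / (e - 3*δ/4 - (e-δ))^2 = 128 * Cc/δ^2 := by
    have : e - 3*δ/4 - (e-δ) = δ/4 := by ring
    rw [this]; field_simp; ring
  rw [e2] at abs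
  constructor
  · obtain ⟨s', m, g', h⟩ := main (e-3*δ/4) (δ/4) (by linarith) (by linarith) (by linarith)
    have a1 : s' ∈ Icc 0 T := ⟨by linarith [m.1], by linarith [htT.2, m.2, ht.1]⟩
    have h1 := hE s' a1 t htT (by linarith [m.2, ht.1]) g' gt
    have h3 := Yi (e-3*δ/4) (by linarith) (by linarith [ht.1]) 1 one_pos
    have h4 := intervalIntegral.integral_nonneg (μ := volume) (show s' ≤ t by linarith [m.2, ht.1]) (fun τ _ => j0 τ)
    have h5 : 0 ≤ (1/(2*Λ)) * (∫ τ in s'..t, j τ) := by positivity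
    have h6 : (1/(δ/4) + N) * (∫ τ in (e-3*δ/4)..t, Y τ) ≤ (4/δ+N) * (128 * Cc/δ^2 + 2*C0) := by
      have : 1/(δ/4) = 4/δ := by field_simp
      rw [this]
      refine mul_le_mul_of_nonneg_left ?_ (by positivity)
      norm_num at h3
      linarith
    linarith
  · exact (jm (e-3*δ/4) (e-δ/2) (by linarith) (by linarith) ht.1.le).trans abs

variable {κ T Λ G M : ℝ} {u ur ut urr utt v : ℝ × ℝ → ℝ → ℝ}

lemma initial {κ Λ G M δ : ℝ} (hΛ : 0 < Λ) (hG : 0 ≤ G) (hM : 0 ≤ M) (hδ0 : 0 < δ) (hδ1 : δ < 1) :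
    ∃ C : ℝ, 0 < C ∧ ∀ (T : ℝ) (u ur ut urr utt v : ℝ × ℝ → ℝ → ℝ), Sys κ 1 T Λ G M u ur ut urr utt v →
      ∀ e ∈ Icc δ T, ∀ᵐ t ∂(volume.restrict (Ioc (e-δ/2) e)),
        (∫ x in B (1-δ/2), Q κ ur ut x t ∂mu) ≤ C ∧ ∫ p, v p.1 p.2^2 ∂(stm (1-δ/2) (e-δ/2) t) ≤ C := by
  obtain ⟨D, hD, hcut⟩ := exists_cut
  obtain ⟨η, η', k⟩ := hcut (1-δ/2) (1-δ/4) (by linarith)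
  have eb : 1 - δ/4 - (1-δ/2) = δ/4 := by ring
  rw [eb] at k
  set D' := D/(δ/4) with hD'
  have D0 : 0 < D' := by positivity
  set C0 := (M^2*Λ^2 + 2*M*Λ*G + 4*M^2*D'^2) * π with hC0
  have C00 : 0 ≤ C0 := by positivity
  set P := Λ*G^2*π
  set N := 32*Λ*D'^2
  have P0 : 0 ≤ P := by positivity
  have N0 : 0 ≤ N := by positivity
  set A := 128 * (2*Λ*(1+N)*C0*(1+16*Λ*(1+N))+2*Λ*P)/δ^2 with hA
  have A0 : 0 ≤ A := by positivity
  have Ai : 0 ≤ (4/δ + N) * (A + 2*C0) + P := by positivity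
  refine ⟨(4/δ + N) * (A + 2*C0) + P + A + 1, by positivity, ?_⟩
  intro T u ur ut urr utt v S e he
  obtain ⟨good, hg, hE⟩ := S.energy k.sq (by linarith) (by linarith)
  have hk2 : ∀ ρ, |η ρ^2| ≤ 1 := fun ρ => by rw [abs_of_nonneg (sq_nonneg _)]; exact k.sq.le1 ρ
  have hk4 : ∀ ρ, |(η ρ^2)^2| ≤ 1 := fun ρ => by rw [abs_of_nonneg (sq_nonneg _)]; exact k.sq.sq.le1 ρ
  have iY : Integrable (fun p : (ℝ×ℝ)×ℝ => η p.1.1^2 * Q κ ur ut p.1 p.2) (Sys.pm 1 T) :=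
    Sys.wInt S.Q_int k.sq.cont hk2
  have ij : Integrable (fun p : (ℝ×ℝ)×ℝ => (η p.1.1^2)^2 * v p.1 p.2^2) (Sys.pm 1 T) :=
    Sys.wInt S.v2 k.sq.sq.cont hk4
  have gv : ∀ᵐ t ∂(volume.restrict (Icc 0 T)), IntegrableOn (fun x => v x t^2) (B 1) mu := S.v2.prod_left_ae
  have key := initAbs (T := T) (Λ := Λ) (P := P) (N := N) (C0 := C0) (δ := δ)
    (Y := fun τ => ∫ x in B 1, η x.1^2 * Q κ ur ut x τ ∂mu)
    (Z := fun τ => ∫ x in B 1, (η x.1^2)^2 * Q κ ur ut x τ ∂mu)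
    (j := fun τ => ∫ x in B 1, (η x.1^2)^2 * v x τ^2 ∂mu) hΛ P0 N0 C00 hδ0 hδ1.le
    iY.integral_prod_right ij.integral_prod_right
    (fun τ => integral_nonneg fun x => mul_nonneg (sq_nonneg _) (Q_nonneg _ _ _ _ _))
    (fun τ => integral_nonneg fun x => mul_nonneg (sq_nonneg _) (Q_nonneg _ _ _ _ _))
    (fun τ => integral_nonneg fun x => by positivity)
    (good := good) hg (by
      intro s hs t ht hst gs gt
      have h1 := hE s hs t ht hst gs gt
      have e1 := st_eq hs.1 hst ht.2 ij
      have e2 := st_eq hs.1 hst ht.2 iY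
      rw [← e1] at h1
      have h2 : ∫ x in B 1, (η x.1^2)^2 * Q κ ur ut x s ∂mu ≤ ∫ x in B 1, η x.1^2 * Q κ ur ut x s ∂mu := by
        refine setIntegral_mono_on (S.etaQ_int k.sq.sq hs) (S.etaQ_int k.sq hs) (B_meas _) fun x hx => ?_
        refine mul_le_mul_of_nonneg_right ?_ (Q_nonneg _ _ _ _ _)
        have := k.sq.le1 x.1; have := k.sq.nn x.1; nlinarith
      have h3 : ∫ p, (2 * η p.1.1 * η' p.1.1)^2 * Q κ ur ut p.1 p.2 ∂(stm 1 s t) ≤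
          4*D'^2 * ∫ p, η p.1.1^2 * Q κ ur ut p.1 p.2 ∂(stm 1 s t) := by
        rw [← integral_const_mul]
        refine integral_mono_of_nonneg (Eventually.of_forall fun p => mul_nonneg (sq_nonneg _) (Q_nonneg _ _ _ _ _))
          ((iY.mono_measure (stm_le_pm hs.1 ht.2)).const_mul _) (Eventually.of_forall fun p => ?_)
        have a1 : η' p.1.1^2 ≤ D'^2 := by rw [← sq_abs]; exact pow_le_pow_left₀ (abs_nonneg _) (k.bd _) 2
        have a2 := Q_nonneg κ ur ut p.1 p.2
        have a3 : 0 ≤ η p.1.1^2 * Q κ ur ut p.1 p.2 := by positivity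
        have a4 := mul_le_mul_of_nonneg_right a1 a3
        change (2 * η p.1.1 * η' p.1.1)^2 * Q κ ur ut p.1 p.2 ≤ 4*D'^2 * (η p.1.1^2 * Q κ ur ut p.1 p.2)
        nlinarith
      rw [← e2] at h3
      have h4 := mul_le_mul_of_nonneg_left h3 (show 0 ≤ 8*Λ by positivity)
      have h5 : 8*Λ*(4*D'^2 * ∫ τ in s..t, (∫ x in B 1, η x.1^2 * Q κ ur ut x τ ∂mu)) = 
         N * ∫ τ in s..t, (∫ x in B 1, η x.1^2 * Q κ ur ut x τ ∂mu) := by simp only [N]; ring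
      have h6 : Λ*G^2*(π*1^2*(t-s)) = P*(t-s) := by simp only [P]; ring
      rw [h5] at h4
      rw [h6] at h1
      linarith) (by
      filter_upwards [gv, ae_restrict_mem measurableSet_Icc] with t g ht ε hε
      have h1 := S.Yb k (by linarith) (by linarith) ht g hε
      refine h1.trans ?_
      have : (M^2*Λ^2/ε + 2*M*Λ*G + 4*M^2*D'^2) * (π*1^2) ≤ C0 * (1+1/ε) := by
        have b1 : C0 * (1+1/ε) = ((M^2*Λ^2 + 2*M*Λ*G + 4*M^2*D'^2) + (M^2*Λ^2/ε + (2*M*Λ*G + 4*M^2*D'^2)/ε)) * π := by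
          rw [hC0]; field_simp; ring
        rw [b1, one_pow, mul_one]
        refine mul_le_mul_of_nonneg_right ?_ pi_pos.le
        have := hM; have := hG
        have : 0 ≤ M^2*Λ^2 := by positivity
        have : 0 ≤ (2*M*Λ*G + 4*M^2*D'^2)/ε := by positivity
        linarith
      linarith) he
  filter_upwards [key, ae_restrict_mem measurableSet_Ioc] with t h ht
  have htT : t ∈ Icc 0 T := ⟨by linarith [ht.1, he.1], by linarith [ht.2, he.2]⟩
  rw [← hA] at h
  constructor
  · have h1 : ∫ x in B (1-δ/2), Q κ ur ut x t ∂mu ≤ ∫ x in B 1, (η x.1^2)^2 * Q κ ur ut x t ∂mu := by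
      have : ∫ x in B (1-δ/2), Q κ ur ut x t ∂mu = ∫ x in B (1-δ/2), (η x.1^2)^2 * Q κ ur ut x t ∂mu := by
        refine setIntegral_congr_fun (B_meas _) fun x hx => ?_
        simp only [k.one x.1 (mem_B.1 hx).2.le]; ring
      rw [this]
      exact setIntegral_mono_set (S.etaQ_int k.sq.sq htT) (Eventually.of_forall fun x => mul_nonneg (sq_nonneg _) (Q_nonneg _ _ _ _ _))
        (B_mono (by linarith)).eventuallyLE
    have := h.1
    linarith
  · have h1 : ∫ p, v p.1 p.2^2 ∂(stm (1-δ/2) (e-δ/2) t) ≤ ∫ p, (η p.1.1^2)^2 * v p.1 p.2^2 ∂(stm 1 (e-δ/2) t) := by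
      have : ∫ p, v p.1 p.2^2 ∂(stm (1-δ/2) (e-δ/2) t) = ∫ p, (η p.1.1^2)^2 * v p.1 p.2^2 ∂(stm (1-δ/2) (e-δ/2) t) := by
        refine integral_congr_ae ?_
        filter_upwards [ae_stm (1-δ/2) (e-δ/2) t] with p hp
        simp only [k.one p.1.1 (mem_B.1 hp.1).2.le]; ring
      rw [this]
      refine integral_mono_measure (stm_mono (by linarith) le_rfl le_rfl) (Eventually.of_forall fun p => by positivity)
        (ij.mono_measure (stm_le_pm (by linarith [he.1]) htT.2))
    have h2 := st_eq (R := 1) (T := T) (by linarith [he.1] : 0 ≤ e - δ/2) ht.1.le htT.2 ij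
    rw [← h2] at h1
    have := h.2
    linarith

end ConeH
end

section
open Real MeasureTheory Set Filter Topology
open scoped ENNReal

namespace ConeH

noncomputable def pol (y x : ℝ × ℝ) : ℝ × ℝ := (y.1 + x.1 * cos x.2, y.2 + x.1 * sin x.2)

def Dc (y : ℝ × ℝ) (r : ℝ) : Set (ℝ × ℝ) := {z | (z.1-y.1)^2 + (z.2-y.2)^2 < r^2}

lemma Dc_open (y : ℝ × ℝ) (r : ℝ) : IsOpen (Dc y r) := by
  unfold Dc
  exact isOpen_lt (by fun_prop) (by fun_prop)

lemma pol_cont (y : ℝ × ℝ) : Continuous (pol y) := by unfold pol; fun_prop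

lemma pol_mem {y x : ℝ × ℝ} {r : ℝ} (hx : x ∈ B r) : pol y x ∈ Dc y r := by
  rw [mem_B] at hx
  change (y.1 + x.1 * cos x.2 - y.1)^2 + (y.2 + x.1 * sin x.2 - y.2)^2 < r^2
  have : (y.1 + x.1 * cos x.2 - y.1)^2 + (y.2 + x.1 * sin x.2 - y.2)^2 = x.1^2 * (sin x.2^2 + cos x.2^2) := by ring
  rw [this, sin_sq_add_cos_sq, mul_one]
  exact pow_lt_pow_left₀ hx.2 hx.1.le (by norm_num)

lemma lint_pol (y : ℝ × ℝ) {r : ℝ} (hr : 0 < r) {F : ℝ × ℝ → ℝ≥0∞} (hF : Measurable F) :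
    ∫⁻ x in B r, F (pol y x) ∂mu = ∫⁻ z in Dc y r, F z := by
  have mF : Measurable (fun x => F (pol y x)) := hF.comp (pol_cont y).measurable
  rw [lint_B r _ mF.aemeasurable, ← lintegral_indicator (Dc_open y r).measurableSet,
    ← lintegral_sub_left_eq_self ((Dc y r).indicator F) y, ← lintegral_comp_polarCoord_symm]
  have e1 : (polarCoord.target : Set (ℝ × ℝ)) = Ioi (0:ℝ) ×ˢ Ioo (-π) π := rfl
  rw [e1]
  -- restrict the target
  have key : ∀ p ∈ Ioi (0:ℝ) ×ˢ Ioo (-π) π,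
      ENNReal.ofReal p.1 • (Dc y r).indicator F (y - polarCoord.symm p) =
      (Ioo (0:ℝ) r ×ˢ (univ : Set ℝ)).indicator (fun p : ℝ × ℝ => ENNReal.ofReal p.1 * F (pol y (p.1, p.2 + π))) p := by
    intro p hp
    have e2 : y - polarCoord.symm p = pol y (p.1, p.2+π) := by
      rw [polarCoord_symm_apply]; unfold pol
      ext <;> simp <;> ring
    rw [e2, smul_eq_mul]
    by_cases h : p.1 < r
    · rw [indicator_of_mem (show p ∈ Ioo (0:ℝ) r ×ˢ univ from ⟨⟨hp.1, h⟩, trivial⟩), indicator_of_mem]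
      exact pol_mem (mem_B.2 ⟨hp.1, h⟩)
    · rw [indicator_of_notMem (show p ∉ Ioo (0:ℝ) r ×ˢ univ from fun hh => h hh.1.2), indicator_of_notMem, mul_zero]
      intro hh
      change (y.1 + p.1 * cos (p.2+π) - y.1)^2 + (y.2 + p.1 * sin (p.2+π) - y.2)^2 < r^2 at hh
      have : (y.1 + p.1 * cos (p.2+π) - y.1)^2 + (y.2 + p.1 * sin (p.2+π) - y.2)^2 = p.1^2 * (sin (p.2+π)^2 + cos (p.2+π)^2) := by ring
      rw [this, sin_sq_add_cos_sq, mul_one] at hh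
      push Not at h
      have := pow_le_pow_left₀ hr.le h 2
      linarith
  rw [setLIntegral_congr_fun (measurableSet_Ioi.prod measurableSet_Ioo) key,
    setLIntegral_indicator (measurableSet_Ioo.prod MeasurableSet.univ)]
  have e3 : Ioo (0:ℝ) r ×ˢ (univ : Set ℝ) ∩ Ioi (0:ℝ) ×ˢ Ioo (-π) π = Ioo (0:ℝ) r ×ˢ Ioo (-π) π := by
    ext x; simp only [mem_inter_iff, mem_prod, mem_Ioo, mem_univ, mem_Ioi]; tauto
  rw [e3]
  have m1 : Measurable (fun x : ℝ × ℝ => ENNReal.ofReal x.1 * F (pol y x)) := Measurable.mul (by fun_prop) mF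
  have m2 : Measurable (fun x : ℝ × ℝ => ENNReal.ofReal x.1 * F (pol y (x.1, x.2+π))) :=
    Measurable.mul (by fun_prop) (mF.comp (by fun_prop))
  rw [Rc_vol, lintegral_prod _ m1.aemeasurable, Measure.volume_eq_prod, ← Measure.prod_restrict,
    lintegral_prod _ m2.aemeasurable]
  congr 1
  ext ρ
  have m3 : Measurable (fun θ : ℝ => ENNReal.ofReal ρ * F (pol y (ρ, θ))) :=
    m1.comp (by fun_prop : Measurable (fun θ : ℝ => ((ρ, θ) : ℝ × ℝ)))
  rw [← restrict_Ioo_eq_restrict_Ioc]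
  have mp := (measurePreserving_add_right volume π).setLIntegral_comp_preimage (s := Ioo (0:ℝ) (2*π)) measurableSet_Ioo m3
  rw [← mp]
  have : (fun x => x + π) ⁻¹' Ioo (0:ℝ) (2*π) = Ioo (-π) π := by
    rw [preimage_add_const_Ioo]; congr 1 <;> ring
  rw [this]

lemma lint_per {f : ℝ → ℝ≥0∞} (hf : ∀ x, f (x + 2*π) = f x) (a : ℝ) :
    ∫⁻ x in Ioc a (a+2*π), f x = ∫⁻ x in Ioc 0 (2*π), f x := by
  have h := (isAddFundamentalDomain_Ioc two_pi_pos a).setLIntegral_eq (isAddFundamentalDomain_Ioc two_pi_pos 0) f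
    (by
      rintro ⟨g, hg⟩ x
      obtain ⟨n, rfl⟩ := AddSubgroup.mem_zmultiples_iff.1 hg
      change f (n • (2*π) + x) = f x
      have : Function.Periodic f (2*π) := hf
      rw [add_comm]; exact this.zsmul n x)
  rw [zero_add] at h
  exact h

lemma lint_log {κ : ℝ} (hκ : 0 < κ) (y : ℝ × ℝ) {r : ℝ} (hr : 0 < r) (hrκ : r ≤ κ) {F : ℝ × ℝ → ℝ≥0∞}
    (hF : Measurable F) (per : ∀ x : ℝ × ℝ, F (x.1, x.2 + 2*π) = F x) :
    ∫⁻ z in Dc y r, F (exp z.1, z.2/κ) ≤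
      ENNReal.ofReal κ * ∫⁻ x in B (exp (y.1+r)), F x * ENNReal.ofReal (x.1^2)⁻¹ ∂mu := by
  have sub : Dc y r ⊆ Iio (y.1+r) ×ˢ Ioc (y.2 - κ*π) (y.2-κ*π + κ*(2*π)) := by
    intro z hz
    have hz : (z.1-y.1)^2 + (z.2-y.2)^2 < r^2 := hz
    have h1 : z.1 - y.1 < r := lt_of_pow_lt_pow_left₀ 2 hr.le (by nlinarith)
    have h2 : |z.2-y.2| < r := by rw [← abs_of_pos hr]; exact abs_lt_of_sq_lt_sq (by rw [abs_of_pos hr]; nlinarith) (abs_nonneg _)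
    have h3 := abs_lt.1 h2
    have h4 : r < κ * π := by have := pi_gt_three; nlinarith
    exact ⟨by change z.1 < _; linarith, by linarith [h3.1], by linarith [h3.2]⟩
  have m0 : Measurable (fun z : ℝ × ℝ => F (exp z.1, z.2/κ)) := by fun_prop
  refine (lintegral_mono_set sub).trans ?_
  rw [Measure.volume_eq_prod, ← Measure.prod_restrict, lintegral_prod _ m0.aemeasurable]
  have inner : ∀ ρ : ℝ, ∫⁻ z in Ioc (y.2 - κ*π) (y.2-κ*π + κ*(2*π)), F (ρ, z/κ) =
      ENNReal.ofReal κ * ∫⁻ θ in Ioc 0 (2*π), F (ρ, θ) := by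
    intro ρ
    have im : (fun θ => κ*θ) '' Ioc (y.2/κ-π) (y.2/κ-π+2*π) = Ioc (y.2 - κ*π) (y.2-κ*π + κ*(2*π)) := by
      rw [image_mul_left_Ioc hκ]; congr 1 <;> field_simp
    rw [← im, lintegral_image_eq_lintegral_abs_deriv_mul measurableSet_Ioc (f' := fun _ => κ)
      (fun x _ => ((hasDerivAt_const_mul κ).hasDerivWithinAt)) (fun a _ b _ h => mul_left_cancel₀ hκ.ne' h)]
    rw [abs_of_pos hκ, lintegral_const_mul]
    · congr 1
      simp only [mul_div_cancel_left₀ _ hκ.ne']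
      exact lint_per (f := fun θ => F (ρ,θ)) (fun θ => per (ρ,θ)) _
    · fun_prop
  simp only [inner]
  have mI : Measurable (fun ρ => ∫⁻ θ in Ioc 0 (2*π), F (ρ,θ)) := Measurable.lintegral_prod_right hF
  have mI2 : Measurable (fun x => ∫⁻ θ in Ioc 0 (2*π), F (exp x,θ)) := mI.comp measurable_exp
  rw [lintegral_const_mul _ mI2]
  refine mul_le_mul_right (le_of_eq ?_) _
  have im : log '' Ioo 0 (exp (y.1+r)) = Iio (y.1+r) := by
    ext z; constructor
    · rintro ⟨x, hx, rfl⟩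
      exact (log_lt_iff_lt_exp hx.1).2 hx.2
    · intro hz
      exact ⟨exp z, ⟨exp_pos _, exp_lt_exp.2 hz⟩, log_exp z⟩
  rw [← im, lintegral_image_eq_lintegral_abs_deriv_mul measurableSet_Ioo (f' := fun x => x⁻¹)
      (fun x hx => ((hasDerivAt_log hx.1.ne').hasDerivWithinAt)) (fun a ha b hb h => log_injOn_pos ha.1 hb.1 h)]
  have mq : Measurable (fun x : ℝ × ℝ => F x * ENNReal.ofReal (x.1^2)⁻¹) := by fun_prop
  rw [lint_B _ _ mq.aemeasurable, Rc_vol, lintegral_prod _ (by fun_prop)]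
  refine setLIntegral_congr_fun measurableSet_Ioo fun ρ hρ => ?_
  change ENNReal.ofReal |ρ⁻¹| * ∫⁻ θ in Ioc 0 (2*π), F (exp (log ρ), θ) = ∫⁻ θ in Ioc 0 (2*π), ENNReal.ofReal ρ * (F (ρ,θ) * ENNReal.ofReal (ρ^2)⁻¹)
  rw [exp_log hρ.1, abs_of_pos (inv_pos.2 hρ.1), ← lintegral_const_mul _ (by fun_prop)]
  congr 1; ext θ
  rw [mul_comm (F (ρ,θ)), ← mul_assoc, ← ENNReal.ofReal_mul hρ.1.le]
  have := hρ.1.ne'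
  congr 2; field_simp

end ConeH
end

section
open Real MeasureTheory Set Filter Topology
open scoped ENNReal

namespace ConeH

noncomputable def ind (R T : ℝ) (f : ℝ × ℝ → ℝ → ℝ) (x : ℝ × ℝ) (t : ℝ) : ℝ :=
  (B R ×ˢ Icc 0 T).indicator (fun p => f p.1 p.2) (x, t)

lemma ind_eq {R T : ℝ} {f : ℝ × ℝ → ℝ → ℝ} {x : ℝ × ℝ} {t : ℝ} (hx : x ∈ B R) (ht : t ∈ Icc 0 T) :
    ind R T f x t = f x t := indicator_of_mem (show (x,t) ∈ B R ×ˢ Icc 0 T from ⟨hx, ht⟩) _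

lemma BT_meas (R T : ℝ) : MeasurableSet (B R ×ˢ Icc 0 T) := (B_meas R).prod measurableSet_Icc

lemma ind_meas {R T : ℝ} {f : ℝ × ℝ → ℝ → ℝ} (h : Measurable (fun p : (ℝ×ℝ)×ℝ => f p.1 p.2)) :
    Measurable (fun p : (ℝ×ℝ)×ℝ => ind R T f p.1 p.2) := h.indicator (BT_meas R T)

lemma meas_dir {R T : ℝ} {f f' : ℝ × ℝ → ℝ → ℝ} (e : ℝ × ℝ)
    (hm : Measurable (fun p : (ℝ×ℝ)×ℝ => ind R T f p.1 p.2))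
    (hd : ∀ t ∈ Icc 0 T, ∀ x ∈ B R, HasDerivAt (fun r : ℝ => f (x + r • e) t) (f' x t) 0) :
    Measurable (fun p : (ℝ×ℝ)×ℝ => ind R T f' p.1 p.2) := by
  have hs : Tendsto (fun n : ℕ => 1/((n:ℝ)+1)) atTop (𝓝[≠] 0) := by
    rw [tendsto_nhdsWithin_iff]
    refine ⟨tendsto_one_div_add_atTop_nhds_zero_nat, Eventually.of_forall fun n => ?_⟩
    have : (0:ℝ) < 1/((n:ℝ)+1) := by positivity
    exact this.ne'
  refine measurable_of_tendsto_metrizable (f := fun (n : ℕ) (p : (ℝ×ℝ)×ℝ) => (B R ×ˢ Icc 0 T).indicator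
    (fun p => (1/((n:ℝ)+1))⁻¹ * (ind R T f (p.1 + (1/((n:ℝ)+1)) • e) p.2 - ind R T f p.1 p.2)) p) ?_ ?_
  · intro n
    refine Measurable.indicator ?_ (BT_meas R T)
    refine Measurable.const_mul (Measurable.sub ?_ hm) _
    exact hm.comp (by fun_prop : Measurable (fun p : (ℝ×ℝ)×ℝ => ((p.1 + (1/((n:ℝ)+1)) • e, p.2) : (ℝ×ℝ)×ℝ)))
  · rw [tendsto_pi_nhds]
    intro p
    by_cases hp : p ∈ B R ×ˢ Icc 0 T
    · rw [ind_eq hp.1 hp.2]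
      have h1 := (hasDerivAt_iff_tendsto_slope.1 (hd p.2 hp.2 p.1 hp.1)).comp hs
      refine h1.congr' ?_
      have c : Tendsto (fun n : ℕ => p.1 + (1/((n:ℝ)+1)) • e) atTop (𝓝 (p.1 + (0:ℝ) • e)) :=
        tendsto_const_nhds.add ((hs.mono_right nhdsWithin_le_nhds).smul_const e)
      rw [zero_smul, add_zero] at c
      filter_upwards [c ((B_open R).mem_nhds hp.1)] with n hn
      rw [indicator_of_mem hp, ind_eq hn hp.2, ind_eq hp.1 hp.2]
      simp [slope]
    · simp only [ind, indicator_of_notMem hp]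
      exact tendsto_const_nhds

lemma meas_dr {R T : ℝ} {f f' : ℝ × ℝ → ℝ → ℝ}
    (hm : Measurable (fun p : (ℝ×ℝ)×ℝ => ind R T f p.1 p.2))
    (hd : ∀ t ∈ Icc 0 T, ∀ x ∈ B R, HasDerivAt (fun r : ℝ => f (r,x.2) t) (f' x t) x.1) :
    Measurable (fun p : (ℝ×ℝ)×ℝ => ind R T f' p.1 p.2) := by
  refine meas_dir (1,0) hm fun t ht x hx => ?_
  have h := hd t ht x hx
  have h2 : HasDerivAt (fun r : ℝ => x.1 + r) 1 0 := (hasDerivAt_id' (0:ℝ)).const_add x.1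
  have h1 : HasDerivAt (fun r : ℝ => f (r,x.2) t) (f' x t) (x.1 + 0) := by rwa [add_zero]
  have := h1.comp (0:ℝ) h2
  rw [mul_one] at this
  refine this.congr_of_eventuallyEq (Eventually.of_forall fun r => ?_)
  simp only [Function.comp]
  congr 1; ext <;> simp

lemma meas_dt {R T : ℝ} {f f' : ℝ × ℝ → ℝ → ℝ}
    (hm : Measurable (fun p : (ℝ×ℝ)×ℝ => ind R T f p.1 p.2))
    (hd : ∀ t ∈ Icc 0 T, ∀ x ∈ B R, HasDerivAt (fun s : ℝ => f (x.1,s) t) (f' x t) x.2) :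
    Measurable (fun p : (ℝ×ℝ)×ℝ => ind R T f' p.1 p.2) := by
  refine meas_dir (0,1) hm fun t ht x hx => ?_
  have h := hd t ht x hx
  have h2 : HasDerivAt (fun r : ℝ => x.2 + r) 1 0 := (hasDerivAt_id' (0:ℝ)).const_add x.2
  have h1 : HasDerivAt (fun s : ℝ => f (x.1,s) t) (f' x t) (x.2 + 0) := by rwa [add_zero]
  have := h1.comp (0:ℝ) h2
  rw [mul_one] at this
  refine this.congr_of_eventuallyEq (Eventually.of_forall fun r => ?_)
  simp only [Function.comp]
  congr 1; ext <;> simp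

lemma ev_r {R : ℝ} {x : ℝ × ℝ} (hx : x ∈ B R) : ∀ᶠ r in 𝓝 x.1, (r, x.2) ∈ B R := by
  rw [mem_B] at hx
  filter_upwards [lt_mem_nhds hx.1, gt_mem_nhds hx.2] with r h1 h2 using mem_B.2 ⟨h1, h2⟩

lemma ev_t {R : ℝ} {x : ℝ × ℝ} (hx : x ∈ B R) (s : ℝ) : (x.1, s) ∈ B R := by
  rw [mem_B] at *; exact hx

lemma Sl.congr {R : ℝ} {f fr ft frr ftt fr' ft' frr' ftt' : ℝ × ℝ → ℝ} (h : Sl R f fr ft frr ftt)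
    (e1 : ∀ x ∈ B R, fr' x = fr x) (e2 : ∀ x ∈ B R, ft' x = ft x) (e3 : ∀ x ∈ B R, frr' x = frr x)
    (e4 : ∀ x ∈ B R, ftt' x = ftt x) : Sl R f fr' ft' frr' ftt' where
  per := h.per
  hr := fun x hx => by rw [e1 x hx]; exact h.hr x hx
  ht := fun x hx => by rw [e2 x hx]; exact h.ht x hx
  c0 := h.c0
  cr := h.cr.congr e1
  ct := h.ct.congr e2
  hrr := fun x hx => by
    rw [e3 x hx]
    refine (h.hrr x hx).congr_of_eventuallyEq ?_
    filter_upwards [ev_r hx] with r hr using e1 _ hr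
  htt := fun x hx => by
    rw [e4 x hx]
    refine (h.htt x hx).congr_of_eventuallyEq ?_
    exact Eventually.of_forall fun s => e2 _ (ev_t hx s)
  crr := h.crr.congr e3
  ctt := h.ctt.congr e4

lemma Sys.build {κ R T Λ G M : ℝ} {u ur ut urr utt v : ℝ × ℝ → ℝ → ℝ}
    (κ0 : 0 < κ) (R0 : 0 < R) (T0 : 0 < T) (Λ0 : 0 < Λ) (G0 : 0 ≤ G) (M0 : 0 ≤ M)
    (sl : ∀ t ∈ Icc 0 T, Sl R (fun x => u x t) (fun x => ur x t) (fun x => ut x t)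
      (fun x => urr x t) (fun x => utt x t))
    (bd : ∀ t ∈ Icc 0 T, ∀ x ∈ B R, |u x t| ≤ M)
    (vc : ∀ x, Continuous (v x))
    (hv : ∀ x ∈ B R, ∀ s ∈ Icc 0 T, ∀ t ∈ Icc 0 T, u x t - u x s = ∫ τ in s..t, v x τ)
    (e1 : ∀ x ∈ B R, ∀ t ∈ Icc 0 T,
      |lap κ (fun x => ur x t) (fun x => urr x t) (fun x => utt x t) x| ≤ Λ * (|v x t| + G))
    (e2 : ∀ x ∈ B R, ∀ t ∈ Icc 0 T, v x t ^ 2 / (2 * Λ) - Λ * G ^ 2 / 2 ≤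
      v x t * lap κ (fun x => ur x t) (fun x => urr x t) (fun x => utt x t) x)
    (mu' : Measurable (fun p : (ℝ × ℝ) × ℝ => u p.1 p.2))
    (mv : Measurable (fun p : (ℝ × ℝ) × ℝ => v p.1 p.2))
    (qi : ∀ t ∈ Icc 0 T, IntegrableOn (q κ (fun x => ur x t) (fun x => ut x t)) (B R) mu)
    (qE : ∃ E : ℝ, ∀ t ∈ Icc 0 T, ∫ x in B R, q κ (fun x => ur x t) (fun x => ut x t) x ∂mu ≤ E)
    (v2 : Integrable (fun p : (ℝ × ℝ) × ℝ => v p.1 p.2 ^ 2)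
      ((mu.restrict (B R)).prod (volume.restrict (Icc 0 T)))) :
    Sys κ R T Λ G M u (ind R T ur) (ind R T ut) (ind R T urr) (ind R T utt) v := by
  have m1 := ind_meas (R := R) (T := T) mu'
  have m2 := meas_dr m1 (fun t ht x hx => (sl t ht).hr x hx)
  have m3 := meas_dt m1 (fun t ht x hx => (sl t ht).ht x hx)
  have m4 := meas_dr m2 (fun t ht x hx => (sl t ht).hrr x hx)
  have m5 := meas_dt m3 (fun t ht x hx => (sl t ht).htt x hx)
  have eq : ∀ t ∈ Icc 0 T, ∀ x ∈ B R, q κ (fun x => ind R T ur x t) (fun x => ind R T ut x t) x =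
      q κ (fun x => ur x t) (fun x => ut x t) x := by
    intro t ht x hx
    simp only [q, ind_eq hx ht]
  refine ⟨κ0, R0, T0, Λ0, G0, M0, fun t ht => (sl t ht).congr (fun x hx => ind_eq hx ht) (fun x hx => ind_eq hx ht)
    (fun x hx => ind_eq hx ht) (fun x hx => ind_eq hx ht), bd, vc, hv, ?_, ?_, mu', m2, m3, m4, m5, mv, ?_, ?_, v2⟩
  · intro x hx t ht
    have := e1 x hx t ht
    simp only [lap, ind_eq hx ht] at *
    exact this
  · intro x hx t ht
    have := e2 x hx t ht
    simp only [lap, ind_eq hx ht] at *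
    exact this
  · intro t ht
    exact (qi t ht).congr_fun (fun x hx => (eq t ht x hx).symm) (B_meas R)
  · obtain ⟨E, hE⟩ := qE
    refine ⟨E, fun t ht => ?_⟩
    rw [setIntegral_congr_fun (B_meas R) (eq t ht)]
    exact hE t ht

end ConeH
end

section
open Real MeasureTheory Set Filter Topology
open scoped ENNReal

namespace ConeH

noncomputable def d1 (g : ℝ × ℝ → ℝ) (z : ℝ × ℝ) : ℝ := fderiv ℝ g z (1,0)
noncomputable def d2 (g : ℝ × ℝ → ℝ) (z : ℝ × ℝ) : ℝ := fderiv ℝ g z (0,1)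

section
variable {g : ℝ × ℝ → ℝ} {Ω : Set (ℝ × ℝ)}

lemma cd_d1 (hΩ : IsOpen Ω) (hg : ContDiffOn ℝ 2 g Ω) : ContDiffOn ℝ 1 (d1 g) Ω :=
  (hg.fderiv_of_isOpen hΩ (by norm_num)).clm_apply contDiffOn_const

lemma cd_d2 (hΩ : IsOpen Ω) (hg : ContDiffOn ℝ 2 g Ω) : ContDiffOn ℝ 1 (d2 g) Ω :=
  (hg.fderiv_of_isOpen hΩ (by norm_num)).clm_apply contDiffOn_const

lemma cont_d1 (hΩ : IsOpen Ω) (hg : ContDiffOn ℝ 1 g Ω) : ContinuousOn (d1 g) Ω :=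
  (hg.continuousOn_fderiv_of_isOpen hΩ le_rfl).clm_apply continuousOn_const

lemma cont_d2 (hΩ : IsOpen Ω) (hg : ContDiffOn ℝ 1 g Ω) : ContinuousOn (d2 g) Ω :=
  (hg.continuousOn_fderiv_of_isOpen hΩ le_rfl).clm_apply continuousOn_const

lemma da (hΩ : IsOpen Ω) (hg : ContDiffOn ℝ 1 g Ω) {z : ℝ × ℝ} (hz : z ∈ Ω) : DifferentiableAt ℝ g z :=
  (hg.differentiableOn one_ne_zero).differentiableAt (hΩ.mem_nhds hz)

/-- chain rule along a curve -/
lemma chain {z : ℝ × ℝ} (h : DifferentiableAt ℝ g z) {c1 c2 : ℝ → ℝ} {a b s : ℝ} (h1 : HasDerivAt c1 a s)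
    (h2 : HasDerivAt c2 b s) (hz : (c1 s, c2 s) = z) :
    HasDerivAt (fun s => g (c1 s, c2 s)) (a * d1 g z + b * d2 g z) s := by
  subst hz
  have := h.hasFDerivAt.comp_hasDerivAt s (h1.prodMk h2)
  refine this.congr_deriv ?_
  have e : ((a, b) : ℝ × ℝ) = a • ((1:ℝ),(0:ℝ)) + b • ((0:ℝ),(1:ℝ)) := by ext <;> simp
  rw [e, map_add, map_smul, map_smul]; rfl

lemma slice1 {z : ℝ × ℝ} (h : DifferentiableAt ℝ g z) : HasDerivAt (fun r => g (r, z.2)) (d1 g z) z.1 :=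
  (chain h (hasDerivAt_id' _) (hasDerivAt_const _ _) rfl).congr_deriv (by ring)

lemma slice2 {z : ℝ × ℝ} (h : DifferentiableAt ℝ g z) : HasDerivAt (fun s => g (z.1, s)) (d2 g z) z.2 :=
  (chain h (hasDerivAt_const _ _) (hasDerivAt_id' _) rfl).congr_deriv (by ring)

/-- Slices of a C² function in the given coordinates -/
lemma Sl_of_C2 {R : ℝ} (hg : ContDiffOn ℝ 2 g (B R)) (per : ∀ x ∈ B R, g (x.1, x.2+2*π) = g x) :
    Sl R g (d1 g) (d2 g) (d1 (d1 g)) (d2 (d2 g)) where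
  per := per
  hr := fun x hx => slice1 (da (B_open R) (hg.of_le (by norm_num)) hx)
  ht := fun x hx => slice2 (da (B_open R) (hg.of_le (by norm_num)) hx)
  c0 := hg.continuousOn
  cr := (cd_d1 (B_open R) hg).continuousOn
  ct := (cd_d2 (B_open R) hg).continuousOn
  hrr := fun x hx => slice1 (da (B_open R) (cd_d1 (B_open R) hg) hx)
  htt := fun x hx => slice2 (da (B_open R) (cd_d2 (B_open R) hg) hx)
  crr := cont_d1 (B_open R) (cd_d1 (B_open R) hg)
  ctt := cont_d2 (B_open R) (cd_d2 (B_open R) hg)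

noncomputable def pr (V : ℝ × ℝ → ℝ) (y x : ℝ × ℝ) : ℝ := cos x.2 * d1 V (pol y x) + sin x.2 * d2 V (pol y x)
noncomputable def pt (V : ℝ × ℝ → ℝ) (y x : ℝ × ℝ) : ℝ :=
  (x.1 * -sin x.2) * d1 V (pol y x) + (x.1 * cos x.2) * d2 V (pol y x)
noncomputable def prr (V : ℝ × ℝ → ℝ) (y x : ℝ × ℝ) : ℝ := cos x.2 * pr (d1 V) y x + sin x.2 * pr (d2 V) y x
noncomputable def ptt (V : ℝ × ℝ → ℝ) (y x : ℝ × ℝ) : ℝ :=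
  (x.1 * -cos x.2) * d1 V (pol y x) + (x.1 * -sin x.2) * pt (d1 V) y x
    + ((x.1 * -sin x.2) * d2 V (pol y x) + (x.1 * cos x.2) * pt (d2 V) y x)

lemma pol_r (h : DifferentiableAt ℝ g (pol y x)) : HasDerivAt (fun r => g (pol y (r, x.2))) (pr g y x) x.1 := by
  refine chain (g := g) (c1 := fun r => y.1 + r * cos x.2) (c2 := fun r => y.2 + r * sin x.2) h
    (((hasDerivAt_id' x.1).mul_const (cos x.2)).const_add y.1 |>.congr_deriv (one_mul _)) 
    (((hasDerivAt_id' x.1).mul_const (sin x.2)).const_add y.2 |>.congr_deriv (one_mul _)) rfl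

lemma pol_t (h : DifferentiableAt ℝ g (pol y x)) : HasDerivAt (fun s => g (pol y (x.1, s))) (pt g y x) x.2 := by
  refine chain (g := g) (c1 := fun r => y.1 + x.1 * cos r) (c2 := fun r => y.2 + x.1 * sin r) h
    (((hasDerivAt_cos x.2).const_mul x.1).const_add y.1) 
    (((hasDerivAt_sin x.2).const_mul x.1).const_add y.2) rfl

lemma Sl_pol {V : ℝ × ℝ → ℝ} {y : ℝ × ℝ} {r : ℝ} (hΩ : IsOpen Ω) (hV : ContDiffOn ℝ 2 V Ω) (hs : Dc y r ⊆ Ω) :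
    Sl r (fun x => V (pol y x)) (pr V y) (pt V y) (prr V y) (ptt V y) := by
  have mt : MapsTo (pol y) (B r) Ω := fun x hx => hs (pol_mem hx)
  have c1 := (cd_d1 hΩ hV).continuousOn.comp (pol_cont y).continuousOn mt
  have c2 := (cd_d2 hΩ hV).continuousOn.comp (pol_cont y).continuousOn mt
  have c11 := (cont_d1 hΩ (cd_d1 hΩ hV)).comp (pol_cont y).continuousOn mt
  have c12 := (cont_d2 hΩ (cd_d1 hΩ hV)).comp (pol_cont y).continuousOn mt
  have c21 := (cont_d1 hΩ (cd_d2 hΩ hV)).comp (pol_cont y).continuousOn mt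
  have c22 := (cont_d2 hΩ (cd_d2 hΩ hV)).comp (pol_cont y).continuousOn mt
  have cs : ContinuousOn (fun x : ℝ × ℝ => cos x.2) (B r) := by fun_prop
  have sn : ContinuousOn (fun x : ℝ × ℝ => sin x.2) (B r) := by fun_prop
  have f1 : ContinuousOn (fun x : ℝ × ℝ => x.1 * -sin x.2) (B r) := by fun_prop
  have f2 : ContinuousOn (fun x : ℝ × ℝ => x.1 * cos x.2) (B r) := by fun_prop
  have f3 : ContinuousOn (fun x : ℝ × ℝ => x.1 * -cos x.2) (B r) := by fun_prop
  refine ⟨⟨?_, ?_, ?_, ?_, ?_, ?_⟩, ?_, ?_, ?_, ?_⟩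
  · intro x hx; simp [pol]
  · intro x hx; exact pol_r (da hΩ (hV.of_le (by norm_num)) (mt hx))
  · intro x hx; exact pol_t (da hΩ (hV.of_le (by norm_num)) (mt hx))
  · exact hV.continuousOn.comp (pol_cont y).continuousOn mt
  · exact (cs.mul c1).add (sn.mul c2)
  · exact (f1.mul c1).add (f2.mul c2)
  · intro x hx
    have h1 := pol_r (da hΩ (cd_d1 hΩ hV) (mt hx))
    have h2 := pol_r (da hΩ (cd_d2 hΩ hV) (mt hx))
    exact (h1.const_mul (cos x.2)).add (h2.const_mul (sin x.2))
  · intro x hx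
    have h1 := pol_t (da hΩ (cd_d1 hΩ hV) (mt hx))
    have h2 := pol_t (da hΩ (cd_d2 hΩ hV) (mt hx))
    exact ((((hasDerivAt_sin x.2).neg).const_mul x.1).mul h1).add ((((hasDerivAt_cos x.2)).const_mul x.1).mul h2)
  · exact (cs.mul ((cs.mul c11).add (sn.mul c12))).add (sn.mul ((cs.mul c21).add (sn.mul c22)))
  · exact ((f3.mul c1).add (f1.mul ((f1.mul c11).add (f2.mul c12)))).add
      ((f1.mul c2).add (f2.mul ((f1.mul c21).add (f2.mul c22))))

lemma lap_pol {V : ℝ × ℝ → ℝ} {y x : ℝ × ℝ} (hx : 0 < x.1) :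
    lap 1 (pr V y) (prr V y) (ptt V y) x = d1 (d1 V) (pol y x) + d2 (d2 V) (pol y x) := by
  have h := sin_sq_add_cos_sq x.2
  have h' : cos x.2^2 = 1 - sin x.2^2 := by linarith
  unfold lap prr ptt pr pt
  field_simp
  ring_nf
  rw [h']; ring

lemma q_pol {V : ℝ × ℝ → ℝ} {y x : ℝ × ℝ} (hx : 0 < x.1) :
    q 1 (pr V y) (pt V y) x = d1 V (pol y x)^2 + d2 V (pol y x)^2 := by
  have h := sin_sq_add_cos_sq x.2
  have h' : cos x.2^2 = 1 - sin x.2^2 := by linarith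
  unfold q pr pt
  field_simp
  ring_nf
  rw [h']; ring

end

/-- exponential coordinates -/
noncomputable def Ex (κ : ℝ) (z : ℝ × ℝ) : ℝ × ℝ := (exp z.1, z.2/κ)

lemma Ex_mem {κ : ℝ} {z : ℝ × ℝ} (hz : z.1 < 0) : Ex κ z ∈ B 1 :=
  mem_B.2 ⟨exp_pos _, by simpa [Ex] using hz⟩

def Hp : Set (ℝ × ℝ) := {z | z.1 < 0}
lemma Hp_open : IsOpen Hp := isOpen_lt continuous_fst continuous_const

section
variable {g : ℝ × ℝ → ℝ} {κ : ℝ}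

lemma cd_Ex (hg : ContDiffOn ℝ 2 g (B 1)) : ContDiffOn ℝ 2 (fun z => g (Ex κ z)) Hp := by
  have : ContDiff ℝ 2 (Ex κ) := by unfold Ex; fun_prop
  exact hg.comp this.contDiffOn (fun z hz => Ex_mem hz)

lemma d1_Ex (hg : ContDiffOn ℝ 1 g (B 1)) {z : ℝ × ℝ} (hz : z.1 < 0) :
    HasDerivAt (fun r => g (Ex κ (r, z.2))) (exp z.1 * d1 g (Ex κ z)) z.1 := by
  have h := da (B_open 1) hg (Ex_mem (κ := κ) hz)
  exact (chain h (c1 := fun r => exp r) (c2 := fun _ => z.2/κ) (Real.hasDerivAt_exp z.1) (hasDerivAt_const _ _) rfl).congr_deriv (by ring)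

lemma d2_Ex (hg : ContDiffOn ℝ 1 g (B 1)) {z : ℝ × ℝ} (hz : z.1 < 0) :
    HasDerivAt (fun s => g (Ex κ (z.1, s))) (κ⁻¹ * d2 g (Ex κ z)) z.2 := by
  have h := da (B_open 1) hg (Ex_mem (κ := κ) hz)
  exact (chain h (c1 := fun _ => exp z.1) (c2 := fun s => s/κ) (hasDerivAt_const _ _) ((hasDerivAt_id' z.2).div_const κ) rfl).congr_deriv (by ring)

lemma d1V (hg : ContDiffOn ℝ 2 g (B 1)) {z : ℝ × ℝ} (hz : z.1 < 0) :
    d1 (fun z => g (Ex κ z)) z = exp z.1 * d1 g (Ex κ z) :=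
  (slice1 (da Hp_open ((cd_Ex hg).of_le (by norm_num)) hz)).unique (d1_Ex (hg.of_le (by norm_num)) hz)

lemma d2V (hg : ContDiffOn ℝ 2 g (B 1)) {z : ℝ × ℝ} (hz : z.1 < 0) :
    d2 (fun z => g (Ex κ z)) z = κ⁻¹ * d2 g (Ex κ z) :=
  (slice2 (da Hp_open ((cd_Ex hg).of_le (by norm_num)) hz)).unique (d2_Ex (hg.of_le (by norm_num)) hz)

lemma d11V (hg : ContDiffOn ℝ 2 g (B 1)) {z : ℝ × ℝ} (hz : z.1 < 0) :
    d1 (d1 (fun z => g (Ex κ z))) z = exp z.1 * d1 g (Ex κ z) + exp z.1 * (exp z.1 * d1 (d1 g) (Ex κ z)) := by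
  have h1 := slice1 (da Hp_open (cd_d1 Hp_open (cd_Ex (κ := κ) hg)) hz)
  have h2 := (Real.hasDerivAt_exp z.1).mul (d1_Ex (κ := κ) (cd_d1 (B_open 1) hg) hz)
  refine h1.unique (h2.congr_of_eventuallyEq ?_)
  filter_upwards [gt_mem_nhds hz] with r hr
  exact d1V (z := (r, z.2)) hg hr

lemma d22V (hg : ContDiffOn ℝ 2 g (B 1)) {z : ℝ × ℝ} (hz : z.1 < 0) :
    d2 (d2 (fun z => g (Ex κ z))) z = κ⁻¹ * (κ⁻¹ * d2 (d2 g) (Ex κ z)) := by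
  have h1 := slice2 (da Hp_open (cd_d2 Hp_open (cd_Ex (κ := κ) hg)) hz)
  have h2 := (d2_Ex (κ := κ) (cd_d2 (B_open 1) hg) hz).const_mul κ⁻¹
  refine h1.unique (h2.congr_of_eventuallyEq (Eventually.of_forall fun s => ?_))
  exact d2V (z := (z.1, s)) hg hz

lemma Dc_sub {y : ℝ × ℝ} {r : ℝ} (hr : 0 < r) (hy : y.1 + r ≤ 0) : Dc y r ⊆ Hp := by
  intro z hz
  have hz : (z.1-y.1)^2 + (z.2-y.2)^2 < r^2 := hz
  have h1 : z.1 - y.1 < r := lt_of_pow_lt_pow_left₀ 2 hr.le (by nlinarith)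
  change z.1 < 0
  linarith

lemma lap_U (hκ : 0 < κ) (hg : ContDiffOn ℝ 2 g (B 1)) {y x : ℝ × ℝ} {r : ℝ} (hr : 0 < r) (hy : y.1 + r ≤ 0) (hx : x ∈ B r) :
    lap 1 (pr (fun z => g (Ex κ z)) y) (prr (fun z => g (Ex κ z)) y) (ptt (fun z => g (Ex κ z)) y) x
      = exp (pol y x).1^2 * lap κ (d1 g) (d1 (d1 g)) (d2 (d2 g)) (Ex κ (pol y x)) := by
  have hz := Dc_sub hr hy (pol_mem hx)
  rw [lap_pol (mem_B.1 hx).1, d11V hg hz, d22V hg hz]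
  have h0 : (Ex κ (pol y x)).1 = exp (pol y x).1 := rfl
  unfold lap
  rw [h0]
  have := exp_pos (pol y x).1
  field_simp
  ring

lemma q_U (hκ : 0 < κ) (hg : ContDiffOn ℝ 2 g (B 1)) {y x : ℝ × ℝ} {r : ℝ} (hr : 0 < r) (hy : y.1 + r ≤ 0) (hx : x ∈ B r) :
    q 1 (pr (fun z => g (Ex κ z)) y) (pt (fun z => g (Ex κ z)) y) x
      = exp (pol y x).1^2 * q κ (d1 g) (d2 g) (Ex κ (pol y x)) := by
  have hz := Dc_sub hr hy (pol_mem hx)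
  rw [q_pol (mem_B.1 hx).1, d1V hg hz, d2V hg hz]
  have h0 : (Ex κ (pol y x)).1 = exp (pol y x).1 := rfl
  unfold q
  rw [h0]
  have := exp_pos (pol y x).1
  field_simp

end

end ConeH
end

section
open Real MeasureTheory Set Filter Topology
open scoped ENNReal

namespace ConeH

/-- clamp to `[0,T]` -/
noncomputable def cl (T t : ℝ) : ℝ := max 0 (min t T)
lemma cl_mem {T : ℝ} (hT : 0 < T) (t : ℝ) : cl T t ∈ Icc 0 T :=
  ⟨le_max_left _ _, max_le hT.le (min_le_right _ _)⟩
lemma cl_eq {T t : ℝ} (ht : t ∈ Icc 0 T) : cl T t = t := by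
  unfold cl; rw [min_eq_left ht.2, max_eq_right ht.1]
lemma cl_cont (T : ℝ) : Continuous (cl T) := by unfold cl; fun_prop

lemma meas_tderiv {T : ℝ} (hT : 0 < T) {h v : ℝ × ℝ → ℝ → ℝ}
    (hd : ∀ x, ∀ t ∈ Icc 0 T, HasDerivWithinAt (h x) (v x t) (Icc 0 T) t)
    (hm : ∀ t ∈ Icc 0 T, Measurable (fun x => h x t)) {t : ℝ} (ht : t ∈ Icc 0 T) :
    Measurable (fun x => v x t) := by
  have nb : (𝓝[Icc 0 T \ {t}] t).NeBot :=
    accPt_principal_iff_nhdsWithin.1 (uniqueDiffWithinAt_iff_accPt.1 (uniqueDiffOn_Icc hT t ht))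
  obtain ⟨s, hs⟩ := (𝓝[Icc 0 T \ {t}] t).exists_seq_tendsto
  have hs2 : ∀ᶠ n in atTop, s n ∈ Icc 0 T \ {t} := hs (self_mem_nhdsWithin)
  obtain ⟨N, hN⟩ := eventually_atTop.1 hs2
  refine measurable_of_tendsto_metrizable (f := fun n x => slope (h x) t (s (n+N))) (fun n => ?_) ?_
  · have h1 := hm t ht
    have h2 := hm (s (n+N)) (hN _ (by omega)).1
    simp only [slope_def_field]
    exact (h2.sub h1).div_const _
  · rw [tendsto_pi_nhds]
    intro x
    exact ((hasDerivWithinAt_iff_tendsto_slope.1 (hd x t ht)).comp hs).comp (tendsto_add_atTop_nat N)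

/-- the packaged solution -/
structure Sol (κ T Λ G M : ℝ) (g v : ℝ × ℝ → ℝ → ℝ) : Prop where
  cd : ∀ t ∈ Icc 0 T, ContDiffOn ℝ 2 (fun x => g x t) (B 1)
  per : ∀ x t, g (x.1, x.2 + 2 * π) t = g x t
  perv : ∀ x t, v (x.1, x.2 + 2 * π) t = v x t
  gc : ∀ x, Continuous (g x)
  sys : Sys κ 1 T Λ G M g (ind 1 T (fun x t => d1 (fun y => g y t) x)) (ind 1 T (fun x t => d2 (fun y => g y t) x))
    (ind 1 T (fun x t => d1 (d1 (fun y => g y t)) x)) (ind 1 T (fun x t => d2 (d2 (fun y => g y t)) x)) v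

lemma tonelli {κ : ℝ} (hκ : 0 < κ) {h : ℝ × ℝ → ℝ} (hm : AEMeasurable h (volume.restrict (Rc 1))) :
    ∫⁻ θ in Icc (0:ℝ) (2 * π), ∫⁻ ρ in Ioo (0:ℝ) 1, ENNReal.ofReal (h (ρ, θ) * (κ * ρ)) =
      ENNReal.ofReal κ * ∫⁻ x in B 1, ENNReal.ofReal (h x) ∂mu := by
  rw [lint_B _ _ hm.ennreal_ofReal, Rc_vol, ← Measure.restrict_congr_set Ioc_ae_eq_Icc, lintegral_prod_symm]
  · rw [← lintegral_const_mul'' _]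
    · refine lintegral_congr fun θ => ?_
      rw [← lintegral_const_mul' _ _ ENNReal.ofReal_ne_top]
      refine setLIntegral_congr_fun measurableSet_Ioo (fun ρ hρ => ?_)
      have : 0 ≤ ρ := hρ.1.le
      rw [mul_comm (h _), ENNReal.ofReal_mul (by positivity), ENNReal.ofReal_mul hκ.le, mul_assoc]
    · have : AEMeasurable (fun x : ℝ × ℝ => ENNReal.ofReal x.1 * ENNReal.ofReal (h x)) 
        ((volume.restrict (Ioo (0:ℝ) 1)).prod (volume.restrict (Ioc (0:ℝ) (2*π)))) := by
        rw [← Rc_vol]; exact (by fun_prop : AEMeasurable (fun x : ℝ × ℝ => ENNReal.ofReal x.1) _).mul hm.ennreal_ofReal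
      exact this.lintegral_prod_left'
  · rw [← Rc_vol]
    exact (by fun_prop : AEMeasurable (fun x : ℝ × ℝ => ENNReal.ofReal x.1) _).mul hm.ennreal_ofReal

section
variable {w g : ℝ × ℝ → ℝ}

lemma dr_eq (hg : ContDiffOn ℝ 2 g (B 1)) (e : ∀ x ∈ B 1, w x = g x) {x : ℝ × ℝ} (hx : x ∈ B 1) :
    deriv (fun r => w (r, x.2)) x.1 = d1 g x := by
  rw [← (slice1 (da (B_open 1) (hg.of_le (by norm_num)) hx)).deriv]
  refine Filter.EventuallyEq.deriv_eq ?_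
  filter_upwards [ev_r hx] with r hr using e _ hr

lemma dt_eq (hg : ContDiffOn ℝ 2 g (B 1)) (e : ∀ x ∈ B 1, w x = g x) {x : ℝ × ℝ} (hx : x ∈ B 1) :
    deriv (fun s => w (x.1, s)) x.2 = d2 g x := by
  rw [← (slice2 (da (B_open 1) (hg.of_le (by norm_num)) hx)).deriv]
  refine Filter.EventuallyEq.deriv_eq (Eventually.of_forall fun s => e _ (ev_t hx s))

lemma drr_eq (hg : ContDiffOn ℝ 2 g (B 1)) (e : ∀ x ∈ B 1, w x = g x) {x : ℝ × ℝ} (hx : x ∈ B 1) :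
    deriv (fun r => deriv (fun r' => w (r', x.2)) r) x.1 = d1 (d1 g) x := by
  rw [← (slice1 (da (B_open 1) (cd_d1 (B_open 1) hg) hx)).deriv]
  refine Filter.EventuallyEq.deriv_eq ?_
  filter_upwards [ev_r hx] with r hr using dr_eq hg e hr

lemma dtt_eq (hg : ContDiffOn ℝ 2 g (B 1)) (e : ∀ x ∈ B 1, w x = g x) {x : ℝ × ℝ} (hx : x ∈ B 1) :
    deriv (fun s => deriv (fun s' => w (x.1, s')) s) x.2 = d2 (d2 g) x := by
  rw [← (slice2 (da (B_open 1) (cd_d2 (B_open 1) hg) hx)).deriv]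
  exact Filter.EventuallyEq.deriv_eq (Eventually.of_forall fun s => dt_eq hg e (ev_t hx s))
end

lemma alg_e {Λ C1 M a b f w v u : ℝ} (hM : 0 ≤ M) (hC : 0 < C1) (hΛ : Λ = C1) (ha : 0 < a) (hb : a + a⁻¹ + |b| + |f| ≤ C1)
    (hu : |u| ≤ M) (hv : v = a * w + b * u + f) :
    |w| ≤ Λ * (|v| + C1*(1+M)) ∧ v^2/(2*Λ) - Λ*(C1*(1+M))^2/2 ≤ v * w := by
  subst hΛ
  have hi : 0 < a⁻¹ := inv_pos.2 ha
  have b0 := abs_nonneg b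
  have f0 := abs_nonneg f
  have hG : |b*u+f| ≤ Λ*(1+M) := by
    calc |b*u+f| ≤ |b*u| + |f| := abs_add_le _ _
      _ ≤ Λ*M + Λ := by
        rw [abs_mul]; exact add_le_add (mul_le_mul (by linarith) hu (abs_nonneg _) hC.le) (by linarith)
      _ = _ := by ring
  set G := Λ*(1+M)
  set k := b*u+f
  have hw : w = a⁻¹*(v - k) := by rw [hv]; simp only [k]; field_simp; ring
  have h1 : a⁻¹ ≤ Λ := by linarith
  have h2 : Λ⁻¹ ≤ a⁻¹ := inv_anti₀ ha (by linarith)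
  constructor
  · rw [hw, abs_mul, abs_of_pos hi]
    exact mul_le_mul h1 ((abs_sub _ _).trans (by linarith)) (abs_nonneg _) hC.le
  · have e : v * w = a⁻¹ * (v^2 - v*k) := by rw [hw]; ring
    have h3 : v^2/2 - k^2/2 ≤ v^2 - v*k := by nlinarith [sq_nonneg (v-k)]
    have hk : k^2 ≤ G^2 := by rw [← sq_abs k]; exact pow_le_pow_left₀ (abs_nonneg _) hG 2
    have h4 : a⁻¹ * (v^2/2 - k^2/2) ≤ v*w := by rw [e]; exact mul_le_mul_of_nonneg_left h3 hi.le
    have h5 : v^2/(2*Λ) = Λ⁻¹*(v^2/2) := by field_simp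
    have h6 : Λ⁻¹*(v^2/2) ≤ a⁻¹*(v^2/2) := mul_le_mul_of_nonneg_right h2 (by positivity)
    have h7 : a⁻¹*(k^2/2) ≤ Λ*(G^2/2) := mul_le_mul h1 (by linarith) (by positivity) hC.le
    rw [h5]; nlinarith

lemma Sol_exists {β C₁ T M : ℝ} (hβ : -1 < β) (hC₁ : 0 < C₁) (hM : 0 ≤ M) (hT : 0 < T) {u a b f : ℝ → ℝ → ℝ → ℝ}
    (hper : ∀ ρ θ t : ℝ, u ρ (θ + 2 * π) t = u ρ θ t)
    (hbd : ∀ ρ θ t : ℝ, 0 < ρ → ρ < 1 → t ∈ Icc 0 T → |u ρ θ t| ≤ M)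
    (h2 : ∀ t ∈ Icc (0:ℝ) T, ContDiffOn ℝ 2 (fun p : ℝ × ℝ => u p.1 p.2 t) {p : ℝ × ℝ | 0 < p.1 ∧ p.1 < 1})
    (h1 : ∀ ρ θ : ℝ, 0 < ρ → ρ < 1 → ContDiffOn ℝ 1 (fun t => u ρ θ t) (Icc 0 T))
    (hab : ∀ ρ θ t : ℝ, 0 < ρ → ρ < 1 → t ∈ Icc 0 T →
                0 < a ρ θ t ∧
                a ρ θ t + (a ρ θ t)⁻¹ + |dtime T (fun s => a ρ θ s) t|
                  + |b ρ θ t| + |f ρ θ t| ≤ C₁)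
    (heq : ∀ ρ θ t : ℝ, 0 < ρ → ρ < 1 → t ∈ Icc 0 T →
                dtime T (fun s => u ρ θ s) t
                  = a ρ θ t * coneLapT β u ρ θ t + b ρ θ t * u ρ θ t + f ρ θ t)
    (hE : ∃ E : ℝ≥0∞, E ≠ ⊤ ∧ ∀ t ∈ Icc (0:ℝ) T,
                (∫⁻ θ in Icc (0:ℝ) (2 * π), ∫⁻ ρ in Ioo (0:ℝ) 1,
                  ENNReal.ofReal (gradSq β u ρ θ t * ((β + 1) * ρ))) ≤ E)
    (hv2 : (∫⁻ t in Icc (0:ℝ) T, ∫⁻ θ in Icc (0:ℝ) (2 * π), ∫⁻ ρ in Ioo (0:ℝ) 1,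
                  ENNReal.ofReal ((dtime T (fun s => u ρ θ s) t) ^ 2 * ((β + 1) * ρ))) ≠ ⊤) :
    ∃ g v : ℝ × ℝ → ℝ → ℝ, (∀ x ∈ B 1, ∀ t ∈ Icc 0 T, g x t = u x.1 x.2 t) ∧
      Sol (β+1) T C₁ (C₁*(1+M)) M g v := by
  classical
  have hκ : 0 < β + 1 := by linarith
  set h : ℝ × ℝ → ℝ → ℝ := fun x t => if x ∈ B 1 then u x.1 x.2 t else 0 with hh
  set v0 : ℝ × ℝ → ℝ → ℝ := fun x t => if x ∈ B 1 then dtime T (fun s => u x.1 x.2 s) t else 0 with hv0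
  set g : ℝ × ℝ → ℝ → ℝ := fun x t => h x (cl T t) with hg
  set v : ℝ × ℝ → ℝ → ℝ := fun x t => v0 x (cl T t) with hv
  have gh : ∀ x, ∀ t ∈ Icc 0 T, g x t = h x t := fun x t ht => by simp only [hg, cl_eq ht]
  have vh : ∀ x, ∀ t ∈ Icc 0 T, v x t = v0 x t := fun x t ht => by simp only [hv, cl_eq ht]
  have hB : ∀ x ∈ B 1, ∀ t, h x t = u x.1 x.2 t := fun x hx t => by simp only [hh, if_pos hx]
  have vB : ∀ x ∈ B 1, ∀ t, v0 x t = dtime T (fun s => u x.1 x.2 s) t := fun x hx t => by simp only [hv0, if_pos hx]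
  have gu : ∀ x ∈ B 1, ∀ t ∈ Icc 0 T, g x t = u x.1 x.2 t := fun x hx t ht => by rw [gh x t ht, hB x hx]
  have hset : {p : ℝ × ℝ | 0 < p.1 ∧ p.1 < 1} = B 1 := by ext x; exact mem_B.symm
  have cd : ∀ t ∈ Icc 0 T, ContDiffOn ℝ 2 (fun x => g x t) (B 1) := fun t ht =>
    ((hset ▸ h2 t ht)).congr (fun x hx => gu x hx t ht)
  have pB : ∀ x : ℝ × ℝ, (x.1, x.2+2*π) ∈ B 1 ↔ x ∈ B 1 := fun x => by rw [mem_B, mem_B]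
  have hd : ∀ x, ∀ t ∈ Icc 0 T, HasDerivWithinAt (h x) (v0 x t) (Icc 0 T) t := by
    intro x t ht
    by_cases hx : x ∈ B 1
    · have e1 : h x = fun t => u x.1 x.2 t := funext (hB x hx)
      rw [e1, vB x hx]
      exact ((h1 x.1 x.2 (mem_B.1 hx).1 (mem_B.1 hx).2).differentiableOn one_ne_zero t ht).hasDerivWithinAt
    · have e1 : h x = fun t => 0 := funext fun t => by simp only [hh, if_neg hx]
      have e2 : v0 x t = 0 := by simp only [hv0, if_neg hx]
      rw [e1, e2]; exact hasDerivWithinAt_const _ _ _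
  have hm : ∀ t ∈ Icc 0 T, Measurable (fun x => h x t) := by
    intro t ht
    have hc : ContinuousOn (fun x => h x t) (B 1) := ((cd t ht).continuousOn).congr (fun x hx => (gh x t ht).symm)
    have e : (fun x => h x t) = (B 1).piecewise (fun x => h x t) (fun _ => 0) := by
      funext x
      by_cases hx : x ∈ B 1
      · rw [piecewise_eq_of_mem _ _ _ hx]
      · rw [piecewise_eq_of_notMem _ _ _ hx]; simp only [hh, if_neg hx]
    rw [e]
    exact hc.measurable_piecewise continuousOn_const (B_meas 1)
  have v0m : ∀ t ∈ Icc 0 T, Measurable (fun x => v0 x t) := fun t ht => meas_tderiv hT hd hm ht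
  have v0c : ∀ x, ContinuousOn (v0 x) (Icc 0 T) := by
    intro x
    by_cases hx : x ∈ B 1
    · have e1 : v0 x = fun t => dtime T (fun s => u x.1 x.2 s) t := funext (vB x hx)
      rw [e1]
      exact (h1 x.1 x.2 (mem_B.1 hx).1 (mem_B.1 hx).2).continuousOn_derivWithin (uniqueDiffOn_Icc hT) le_rfl
    · have e1 : v0 x = fun t => 0 := funext fun t => by simp only [hv0, if_neg hx]
      rw [e1]; exact continuousOn_const
  have vc : ∀ x, Continuous (v x) := fun x =>
    (v0c x).comp_continuous (cl_cont T) (fun t => cl_mem hT t)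
  have gc : ∀ x, Continuous (g x) := fun x =>
    ContinuousOn.comp_continuous (g := h x) (s := Icc 0 T) (fun t ht => (hd x t ht).continuousWithinAt) (cl_cont T) (fun t => cl_mem hT t)
  have gm : Measurable (fun p : (ℝ × ℝ) × ℝ => g p.1 p.2) := by
    have := measurable_uncurry_of_continuous_of_measurable (u := fun t x => g x t) gc (fun t => hm _ (cl_mem hT t))
    exact this.comp measurable_swap
  have vm : Measurable (fun p : (ℝ × ℝ) × ℝ => v p.1 p.2) := by
    have := measurable_uncurry_of_continuous_of_measurable (u := fun t x => v x t) vc (fun t => v0m _ (cl_mem hT t))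
    exact this.comp measurable_swap
  have sl : ∀ t ∈ Icc 0 T, Sl 1 (fun x => g x t) (fun x => d1 (fun y => g y t) x) (fun x => d2 (fun y => g y t) x)
      (fun x => d1 (d1 (fun y => g y t)) x) (fun x => d2 (d2 (fun y => g y t)) x) := fun t ht =>
    Sl_of_C2 (cd t ht) (fun x hx => by
      have h1 := gu x hx t ht
      have h2 := gu (x.1, x.2+2*π) ((pB x).2 hx) t ht
      rw [h1, h2]; exact hper _ _ _)
  have lapE : ∀ x ∈ B 1, ∀ t ∈ Icc 0 T, coneLapT β u x.1 x.2 t =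
      lap (β+1) (fun x => d1 (fun y => g y t) x) (fun x => d1 (d1 (fun y => g y t)) x) (fun x => d2 (d2 (fun y => g y t)) x) x := by
    intro x hx t ht
    have e : ∀ x ∈ B 1, (fun p : ℝ × ℝ => u p.1 p.2 t) x = (fun y => g y t) x := fun x hx => (gu x hx t ht).symm
    unfold coneLapT lap
    beta_reduce
    rw [← drr_eq (cd t ht) e hx, ← dtt_eq (cd t ht) e hx, ← dr_eq (cd t ht) e hx]
  have qE : ∀ x ∈ B 1, ∀ t ∈ Icc 0 T, gradSq β u x.1 x.2 t =
      q (β+1) (fun x => d1 (fun y => g y t) x) (fun x => d2 (fun y => g y t) x) x := by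
    intro x hx t ht
    have e : ∀ x ∈ B 1, (fun p : ℝ × ℝ => u p.1 p.2 t) x = (fun y => g y t) x := fun x hx => (gu x hx t ht).symm
    unfold gradSq q
    beta_reduce
    rw [← dt_eq (cd t ht) e hx, ← dr_eq (cd t ht) e hx, mul_pow]
  have ee : ∀ x ∈ B 1, ∀ t ∈ Icc 0 T, _ ∧ _ := fun x hx t ht => by
    have hh1 := hab x.1 x.2 t (mem_B.1 hx).1 (mem_B.1 hx).2 ht
    have hh2 := heq x.1 x.2 t (mem_B.1 hx).1 (mem_B.1 hx).2 ht
    rw [lapE x hx t ht, ← vB x hx, ← vh x t ht] at hh2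
    exact alg_e hM hC₁ rfl hh1.1 (by linarith [hh1.2, abs_nonneg (dtime T (fun s => a x.1 x.2 s) t)])
      (hbd x.1 x.2 t (mem_B.1 hx).1 (mem_B.1 hx).2 ht) hh2
  obtain ⟨E, hEt, hE⟩ := hE
  have qL : ∀ t ∈ Icc 0 T, ∫⁻ x in B 1, ENNReal.ofReal (q (β+1) (fun x => d1 (fun y => g y t) x) (fun x => d2 (fun y => g y t) x) x) ∂mu
      ≤ (ENNReal.ofReal (β+1))⁻¹ * E := by
    intro t ht
    have := hE t ht
    rw [mul_comm, ← div_eq_mul_inv, ENNReal.le_div_iff_mul_le (by left; simpa using hκ) (by left; simp), mul_comm, ← tonelli hκ]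
    · refine le_trans (le_of_eq ?_) this
      refine lintegral_congr fun θ => ?_
      refine setLIntegral_congr_fun measurableSet_Ioo (fun ρ hρ => ?_)
      rw [← qE (ρ, θ) (mem_B.2 hρ) t ht]
    · refine (ContinuousOn.mono ((sl t ht).toSl1.contOn_q) ?_).aemeasurable (Rc_meas 1)
      exact fun x hx => mem_B.2 hx.1
  have ELt : (ENNReal.ofReal (β+1))⁻¹ * E ≠ ⊤ := ENNReal.mul_ne_top (by simpa using hκ) hEt
  have qi : ∀ t ∈ Icc 0 T, IntegrableOn (q (β+1) (fun x => d1 (fun y => g y t) x) (fun x => d2 (fun y => g y t) x)) (B 1) mu := by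
    intro t ht
    refine ⟨aesm_B ((sl t ht).toSl1.contOn_q), ?_⟩
    rw [hasFiniteIntegral_iff_ofReal (Eventually.of_forall fun x => q_nonneg _ _ _ _)]
    exact (qL t ht).trans_lt ELt.lt_top
  refine ⟨g, v, gu, cd, ?_, ?_, gc, Sys.build hκ one_pos hT hC₁ (by positivity) hM sl ?_ vc ?_ 
    (fun x hx t ht => (ee x hx t ht).1) (fun x hx t ht => (ee x hx t ht).2) gm vm qi ?_ ?_⟩
  · intro x t
    simp only [hg, hh, pB, hper]
  · intro x t
    simp only [hv, hv0, pB, hper]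
  · intro t ht x hx
    rw [gu x hx t ht]; exact hbd _ _ _ (mem_B.1 hx).1 (mem_B.1 hx).2 ht
  · have key : ∀ x ∈ B 1, ∀ s ∈ Icc 0 T, ∀ t ∈ Icc 0 T, s ≤ t → g x t - g x s = ∫ τ in s..t, v x τ := by
      intro x hx s hs t ht hst
      rw [intervalIntegral.integral_eq_sub_of_hasDerivAt_of_le hst (gc x).continuousOn _ ((vc x).intervalIntegrable _ _)]
      intro τ hτ
      have hτ' : τ ∈ Ioo 0 T := ⟨hs.1.trans_lt hτ.1, hτ.2.trans_le ht.2⟩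
      rw [vh x τ (Ioo_subset_Icc_self hτ')]
      refine ((hd x τ (Ioo_subset_Icc_self hτ')).hasDerivAt (Icc_mem_nhds hτ'.1 hτ'.2)).congr_of_eventuallyEq ?_
      filter_upwards [Icc_mem_nhds hτ'.1 hτ'.2] with y hy using gh x y hy
    intro x hx s hs t ht
    rcases le_total s t with hst | hst
    · exact key x hx s hs t ht hst
    · have := key x hx t ht s hs hst
      rw [intervalIntegral.integral_symm, ← this]; ring
  · refine ⟨((ENNReal.ofReal (β+1))⁻¹ * E).toReal, fun t ht => ?_⟩
    rw [integral_eq_lintegral_of_nonneg_ae (Eventually.of_forall fun x => q_nonneg _ _ _ _) (aesm_B ((sl t ht).toSl1.contOn_q))]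
    exact ENNReal.toReal_mono ELt (qL t ht)
  · refine ⟨(vm.pow_const 2).aestronglyMeasurable, ?_⟩
    rw [hasFiniteIntegral_iff_ofReal (Eventually.of_forall fun x => sq_nonneg _)]
    rw [lintegral_prod_symm _ (vm.pow_const 2).ennreal_ofReal.aemeasurable]
    have : ∫⁻ t in Icc 0 T, ∫⁻ x in B 1, ENNReal.ofReal (v x t ^ 2) ∂mu = (ENNReal.ofReal (β+1))⁻¹ * ∫⁻ t in Icc (0:ℝ) T, ∫⁻ θ in Icc (0:ℝ) (2 * π), ∫⁻ ρ in Ioo (0:ℝ) 1,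
                  ENNReal.ofReal ((dtime T (fun s => u ρ θ s) t) ^ 2 * ((β + 1) * ρ)) := by
      rw [← lintegral_const_mul' _ _ (by simpa using hκ)]
      refine setLIntegral_congr_fun measurableSet_Icc (fun t ht => ?_)
      have e := tonelli hκ (h := fun x => v x t ^ 2) (((vm.comp (measurable_id.prodMk measurable_const)).pow_const 2).aemeasurable)
      have e2 : ∫⁻ θ in Icc (0:ℝ) (2 * π), ∫⁻ ρ in Ioo (0:ℝ) 1, ENNReal.ofReal (v (ρ, θ) t ^ 2 * ((β+1) * ρ)) = 
        ∫⁻ θ in Icc (0:ℝ) (2 * π), ∫⁻ ρ in Ioo (0:ℝ) 1,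
                  ENNReal.ofReal ((dtime T (fun s => u ρ θ s) t) ^ 2 * ((β + 1) * ρ)) := by
        refine lintegral_congr fun θ => setLIntegral_congr_fun measurableSet_Ioo (fun ρ hρ => ?_)
        rw [vh _ _ ht, vB (ρ, θ) (mem_B.2 hρ)]
      rw [← e2, e, ← mul_assoc, ENNReal.inv_mul_cancel (by simpa using hκ) (by simp), one_mul]
    rw [this]
    exact (ENNReal.mul_ne_top (by simpa using hκ) hv2).lt_top

end ConeH
end

section
open Real MeasureTheory Set Filter Topology
open scoped ENNReal

namespace ConeH

lemma Sys.v_mono {κ R T Λ G M : ℝ} {u ur ut urr utt v : ℝ × ℝ → ℝ → ℝ} (S : Sys κ R T Λ G M u ur ut urr utt v)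
    {r r' s s' t : ℝ} (hr : r ≤ r') (hr' : r' ≤ R) (hs : s' ≤ s) (hs0 : 0 ≤ s') (ht : t ≤ T) :
    ∫ p, v p.1 p.2^2 ∂(stm r s t) ≤ ∫ p, v p.1 p.2^2 ∂(stm r' s' t) :=
  integral_mono_measure (stm_mono hr hs le_rfl) (Eventually.of_forall fun p => sq_nonneg _)
    (S.v2.mono_measure ((stm_mono hr' le_rfl le_rfl).trans (stm_le_pm hs0 ht)))

lemma tip (κ Λ : ℝ) (hκ : 0 < κ) (hΛ : 0 < Λ) : ∃ α : ℝ, 0 < α ∧ ∀ α' : ℝ, 0 < α' → α' ≤ α →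
    ∀ G M δ : ℝ, 0 ≤ G → 0 ≤ M → 0 < δ → δ < 1 → ∃ C : ℝ, 0 < C ∧ 
    ∀ (T : ℝ) (u ur ut urr utt v : ℝ × ℝ → ℝ → ℝ), Sys κ 1 T Λ G M u ur ut urr utt v →
    ∀ t0 ∈ Icc δ T, ∀ r, 0 < r → r ≤ 1 - δ/2 → ∀ᵐ t ∂(volume.restrict (Ioc (t0 - (δ*r/2)^2) t0)),
      (∫ x in B r, Q κ ur ut x t ∂mu) ≤ C * r^(2*α') ∧ ∫ p, v p.1 p.2^2 ∂(stm r (t0-(δ*r/2)^2) t) ≤ C * r^(2*α') := by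
  obtain ⟨α, Cd, α0, Cd0, hdec⟩ := decay κ Λ hκ hΛ
  refine ⟨α, α0, fun α' α'0 hα G M δ hG hM δ0 δ1 => ?_⟩
  obtain ⟨Ci, Ci0, hin⟩ := initial (κ := κ) hΛ hG hM δ0 δ1
  set R := δ/2 with hR
  have R0 : 0 < R := by positivity
  have hRα : 0 < R^(2*α') := rpow_pos_of_pos R0 _
  set C1 := Cd * (Ci + G^2*R^4) with hC1
  have C10 : 0 < C1 := by positivity
  refine ⟨(C1 + Ci)/R^(2*α'), by positivity, ?_⟩
  intro T u ur ut urr utt v S t0 ht0 r r0 hr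
  have key : ∀ A : ℝ, A ≤ (C1+Ci) * (r/R)^(2*α') → A ≤ (C1 + Ci)/R^(2*α') * r^(2*α') := by
    intro A hA
    rw [div_rpow r0.le R0.le] at hA
    refine hA.trans (le_of_eq (by ring))
  have hw : (δ*r/2)^2 ≤ δ/2 := by
    have h1 : δ*r/2 ≤ δ/2 := by nlinarith
    have h2 : 0 ≤ δ*r/2 := by positivity
    nlinarith
  have hRR : R^2 ≤ δ/2 := by rw [hR]; nlinarith
  have hini := hin T u ur ut urr utt v S t0 ht0
  have t01 := ht0.1
  have t02 := ht0.2
  by_cases hrR : r ≤ R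
  · have SR := S.mono R0 (by linarith : R ≤ 1)
    have hb : Sys.Bnd κ ur ut v R t0 Ci := by
      unfold Sys.Bnd
      filter_upwards [ae_sub' hini (by linarith : t0 - δ/2 ≤ t0 - R^2) le_rfl, ae_restrict_mem measurableSet_Ioc] with t ht hm
      have it : t ∈ Icc 0 T := ⟨by linarith [hm.1], by linarith [hm.2]⟩
      refine ⟨((S.mono (by linarith : 0 < 1-δ/2) (by linarith)).Q_mono (by linarith) it).trans ht.1, (S.v_mono (by linarith) (by linarith) (by linarith) (by linarith) it.2).trans ht.2⟩
    have hb2 := hdec R T G M u ur ut urr utt v SR t0 Ci (by linarith) t02 Ci0.le hb r r0 hrR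
    have hwr : (δ*r/2)^2 ≤ r^2 := pow_le_pow_left₀ (by positivity) (by nlinarith) 2
    have r1 : r^2 ≤ δ/2 := (pow_le_pow_left₀ r0.le hrR 2).trans hRR
    have hc : Cd * (r/R)^(2*α) * (Ci + G^2*R^4) ≤ (C1+Ci) * (r/R)^(2*α') := by
      have h1 : (r/R)^(2*α) ≤ (r/R)^(2*α') := rpow_le_rpow_of_exponent_ge (by positivity) ((div_le_one R0).2 hrR) (by linarith)
      have h2 : 0 < (r/R)^(2*α') := by positivity
      calc Cd * (r/R)^(2*α) * (Ci + G^2*R^4) = C1 * (r/R)^(2*α) := by rw [hC1]; ring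
        _ ≤ C1 * (r/R)^(2*α') := mul_le_mul_of_nonneg_left h1 C10.le
        _ ≤ _ := by nlinarith
    filter_upwards [ae_sub' hb2 (by linarith : t0 - r^2 ≤ t0 - (δ*r/2)^2) le_rfl, ae_restrict_mem measurableSet_Ioc] with t ht hm
    have it : t ∈ Icc 0 T := ⟨by linarith [hm.1], by linarith [hm.2]⟩
    exact ⟨key _ (ht.1.trans hc), key _ (((S.v_mono le_rfl (by linarith) (by linarith) (by linarith) it.2).trans ht.2).trans hc)⟩
  · push Not at hrR
    have hc : Ci ≤ (C1+Ci) * (r/R)^(2*α') := by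
      have : 1 ≤ (r/R)^(2*α') := one_le_rpow ((one_le_div R0).2 hrR.le) (by linarith)
      nlinarith
    filter_upwards [ae_sub' hini (by linarith : t0 - δ/2 ≤ t0 - (δ*r/2)^2) le_rfl, ae_restrict_mem measurableSet_Ioc] with t ht hm
    have it : t ∈ Icc 0 T := ⟨by linarith [hm.1], by linarith [hm.2]⟩
    refine ⟨key _ ((((S.mono (by linarith : 0 < 1-δ/2) (by linarith)).Q_mono hr it).trans ht.1).trans hc), key _ (((S.v_mono hr (by linarith) (by linarith) (by linarith) it.2).trans ht.2).trans hc)⟩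

end ConeH
end

section
open Real MeasureTheory Set Filter Topology
open scoped ENNReal

namespace ConeH

lemma fst_pol {y x : ℝ × ℝ} {r : ℝ} (hx : x ∈ B r) : |(pol y x).1 - y.1| ≤ r := by
  have h := mem_B.1 hx
  have : (pol y x).1 - y.1 = x.1 * cos x.2 := by simp [pol]
  rw [this, abs_mul, abs_of_pos h.1]
  calc x.1 * |cos x.2| ≤ x.1 * 1 := mul_le_mul_of_nonneg_left (abs_cos_le_one _) h.1.le
    _ ≤ r := by linarith

lemma Ex_meas (κ : ℝ) (y : ℝ × ℝ) : Measurable (fun x => Ex κ (pol y x)) := by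
  have h : Continuous (Ex κ) := by unfold Ex; fun_prop
  exact (h.comp (pol_cont y)).measurable

lemma lintU {κ : ℝ} (hκ : 0 < κ) (y : ℝ × ℝ) {r : ℝ} (hr : 0 < r) (hrκ : r ≤ κ) {F : ℝ × ℝ → ℝ}
    (hF : Measurable F) (per : ∀ x : ℝ × ℝ, F (x.1, x.2 + 2*π) = F x) :
    ∫⁻ x in B r, ENNReal.ofReal ((Ex κ (pol y x)).1^2 * F (Ex κ (pol y x))) ∂mu ≤
      ENNReal.ofReal κ * ∫⁻ x in B (exp (y.1+r)), ENNReal.ofReal (F x) ∂mu := by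
  set F1 : ℝ × ℝ → ℝ≥0∞ := fun x => ENNReal.ofReal (x.1^2 * F x)
  have hF1 : Measurable F1 := ((measurable_fst.pow_const 2).mul hF).ennreal_ofReal
  have p1 : ∀ x : ℝ × ℝ, F1 (x.1, x.2 + 2*π) = F1 x := fun x => by simp only [F1, per]
  have h := lint_log hκ y hr hrκ hF1 p1
  have hE : Measurable (Ex κ) := by unfold Ex; fun_prop
  have h0 := lint_pol y hr (F := fun z => F1 (Ex κ z)) (hF1.comp hE)
  calc _ = ∫⁻ x in B r, F1 (Ex κ (pol y x)) ∂mu := rfl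
    _ = ∫⁻ z in Dc y r, F1 (exp z.1, z.2/κ) := h0
    _ ≤ _ := h
    _ = _ := by
      congr 1
      refine setLIntegral_congr_fun (B_meas _) (fun x hx => ?_)
      have hx0 := (mem_B.1 hx).1
      simp only [F1]
      rw [← ENNReal.ofReal_mul' (by positivity)]
      congr 1
      field_simp

lemma fd_per {g : ℝ × ℝ → ℝ} (per : ∀ x : ℝ × ℝ, g (x.1, x.2 + 2 * π) = g x) (x : ℝ × ℝ) :
    fderiv ℝ g (x.1, x.2 + 2*π) = fderiv ℝ g x := by
  have h := fderiv_comp_add_right (𝕜 := ℝ) (f := g) (x := x) ((0:ℝ), 2*π)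
  have e1 : (fun x => g (x + ((0:ℝ), 2*π))) = g := by
    funext x
    rw [← per x]; congr 1; ext <;> simp
  rw [e1] at h
  rw [h]; congr 1; ext <;> simp

lemma ind_per {R T : ℝ} {f : ℝ × ℝ → ℝ → ℝ} (per : ∀ x t, f (x.1, x.2 + 2*π) t = f x t) (x : ℝ × ℝ) (t : ℝ) :
    ind R T f (x.1, x.2+2*π) t = ind R T f x t := by
  classical
  have : (((x.1, x.2+2*π), t) : (ℝ × ℝ) × ℝ) ∈ B R ×ˢ Icc 0 T ↔ ((x, t) : (ℝ × ℝ) × ℝ) ∈ B R ×ˢ Icc 0 T := by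
    simp [mem_B, mem_prod]
  simp only [ind, indicator_apply, this, per]

section
variable {κ T Λ G M : ℝ} {g v : ℝ × ℝ → ℝ → ℝ}

/-- the Dirichlet density of a packaged solution -/
noncomputable def QS (κ T : ℝ) (g : ℝ × ℝ → ℝ → ℝ) : ℝ × ℝ → ℝ → ℝ :=
  Q κ (ind 1 T (fun x t => d1 (fun y => g y t) x)) (ind 1 T (fun x t => d2 (fun y => g y t) x))

lemma Sol.QS_per (S : Sol κ T Λ G M g v) (x : ℝ × ℝ) (t : ℝ) : QS κ T g (x.1, x.2+2*π) t = QS κ T g x t := by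
  have h1 := ind_per (R := 1) (T := T) (f := fun x t => d1 (fun y => g y t) x)
    (fun x t => by simp only [d1, fd_per (g := fun y => g y t) (fun x => S.per x t)]) x t
  have h2 := ind_per (R := 1) (T := T) (f := fun x t => d2 (fun y => g y t) x)
    (fun x t => by simp only [d2, fd_per (g := fun y => g y t) (fun x => S.per x t)]) x t
  unfold QS Q q
  beta_reduce
  rw [h1, h2]

noncomputable def Ug (κ : ℝ) (g : ℝ × ℝ → ℝ → ℝ) (y x : ℝ × ℝ) (t : ℝ) : ℝ := g (Ex κ (pol y x)) (exp y.1^2 * t)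
noncomputable def Vg (κ : ℝ) (v : ℝ × ℝ → ℝ → ℝ) (y x : ℝ × ℝ) (t : ℝ) : ℝ := exp y.1^2 * v (Ex κ (pol y x)) (exp y.1^2 * t)
noncomputable def Sli (κ : ℝ) (g : ℝ × ℝ → ℝ → ℝ) (y : ℝ × ℝ) (t : ℝ) (z : ℝ × ℝ) : ℝ := g (Ex κ z) (exp y.1^2 * t)

lemma tsc {y : ℝ × ℝ} {T t : ℝ} (ht : t ∈ Icc 0 (T/exp y.1^2)) : exp y.1^2 * t ∈ Icc 0 T := by
  have h : 0 < exp y.1^2 := by positivity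
  refine ⟨mul_nonneg h.le ht.1, ?_⟩
  have := ht.2
  rw [le_div_iff₀ h] at this; linarith

lemma alg_int {k ρ0 ρ Λ G v w : ℝ} (hρ0 : 0 < ρ0) (hΛ : 0 < Λ) (hG : 0 ≤ G) (hk : ρ^2 = k * ρ0^2)
    (k1 : k ≤ exp 2) (k2 : (exp 2)⁻¹ ≤ k) (h1 : |w| ≤ Λ * (|v|+G)) (h2 : v^2/(2*Λ) - Λ*G^2/2 ≤ v*w) :
    |ρ^2*w| ≤ (exp 2*Λ) * (|ρ0^2*v| + ρ0^2*G) ∧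
    (ρ0^2*v)^2/(2*(exp 2*Λ)) - (exp 2*Λ)*(ρ0^2*G)^2/2 ≤ (ρ0^2*v) * (ρ^2*w) := by
  have e0 : 0 < exp 2 := exp_pos 2
  have k0 : 0 < k := lt_of_lt_of_le (inv_pos.2 e0) k2
  have r0 : 0 < ρ0^2 := by positivity
  constructor
  · rw [abs_mul, hk, abs_of_pos (by positivity : 0 < k*ρ0^2), abs_mul, abs_of_pos r0]
    calc k*ρ0^2*|w| ≤ exp 2 * ρ0^2 * (Λ*(|v|+G)) := by
          refine mul_le_mul (mul_le_mul_of_nonneg_right k1 r0.le) h1 (abs_nonneg _) (by positivity)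
      _ = _ := by ring
  · rw [hk]
    have h3 : (k*ρ0^4) * (v^2/(2*Λ) - Λ*G^2/2) ≤ (k*ρ0^4)*(v*w) := mul_le_mul_of_nonneg_left h2 (by positivity)
    have h4 : (exp 2)⁻¹ * (ρ0^4*v^2/(2*Λ)) ≤ k*(ρ0^4*v^2/(2*Λ)) := mul_le_mul_of_nonneg_right k2 (by positivity)
    have h5 : k * (Λ*ρ0^4*G^2/2) ≤ exp 2 * (Λ*ρ0^4*G^2/2) := mul_le_mul_of_nonneg_right k1 (by positivity)
    have h6 : (ρ0^2*v)^2/(2*(exp 2*Λ)) = (exp 2)⁻¹ * (ρ0^4*v^2/(2*Λ)) := by field_simp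
    have h7 : (k*ρ0^4) * (v^2/(2*Λ) - Λ*G^2/2) = k*(ρ0^4*v^2/(2*Λ)) - k * (Λ*ρ0^4*G^2/2) := by ring
    have h8 : (ρ0^2*v) * (k*ρ0^2*w) = (k*ρ0^4)*(v*w) := by ring
    have h9 : (exp 2*Λ)*(ρ0^2*G)^2/2 = exp 2 * (Λ*ρ0^4*G^2/2) := by ring
    rw [h6, h8, h9]
    linarith

lemma Sol.lintQ (S : Sol κ T Λ G M g v) {y : ℝ × ℝ} {r : ℝ} (hr : 0 < r) (hrκ : r ≤ κ) (hy : y.1 + r ≤ 0)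
    {t : ℝ} (ht : t ∈ Icc 0 (T/exp y.1^2)) :
    ∫⁻ x in B r, ENNReal.ofReal (q 1 (pr (Sli κ g y t) y) (pt (Sli κ g y t) y) x) ∂mu ≤
      ENNReal.ofReal κ * ∫⁻ x in B (exp (y.1+r)), ENNReal.ofReal (QS κ T g x (exp y.1^2*t)) ∂mu := by
  have mQ : Measurable (fun x => QS κ T g x (exp y.1^2*t)) := 
    S.sys.mQ.comp (measurable_id.prodMk measurable_const)
  refine le_trans (le_of_eq ?_) (lintU S.sys.κ0 y hr hrκ mQ (fun x => S.QS_per x _))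
  refine setLIntegral_congr_fun (B_meas _) (fun x hx => ?_)
  have hz : Ex κ (pol y x) ∈ B 1 := Ex_mem (Dc_sub hr hy (pol_mem hx))
  have := q_U S.sys.κ0 (S.cd _ (tsc ht)) hr hy hx
  change ENNReal.ofReal (q 1 (pr (fun z => g (Ex κ z) (exp y.1^2*t)) y) (pt (fun z => g (Ex κ z) (exp y.1^2*t)) y) x) = _
  rw [this]
  congr 1
  simp only [QS, Q, q, ind_eq hz (tsc ht)]
  rfl

lemma Sol.lintV (S : Sol κ T Λ G M g v) {y : ℝ × ℝ} {r : ℝ} (hr : 0 < r) (hrκ : r ≤ κ) (hr1 : r ≤ 1) (t : ℝ) :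
    ∫⁻ x in B r, ENNReal.ofReal (Vg κ v y x t^2) ∂mu ≤
      ENNReal.ofReal (κ * exp 2) * (ENNReal.ofReal (exp y.1^2) * ∫⁻ x in B (exp (y.1+r)), ENNReal.ofReal (v x (exp y.1^2*t)^2) ∂mu) := by
  have mv : Measurable (fun x => v x (exp y.1^2*t)) := 
    S.sys.mv.comp (measurable_id.prodMk measurable_const)
  have h := lintU S.sys.κ0 y hr hrκ (mv.pow_const 2) (fun x => by simp only [S.perv])
  calc ∫⁻ x in B r, ENNReal.ofReal (Vg κ v y x t^2) ∂mu 
      ≤ ∫⁻ x in B r, ENNReal.ofReal (exp 2 * exp y.1^2) * ENNReal.ofReal ((Ex κ (pol y x)).1^2 * v (Ex κ (pol y x)) (exp y.1^2*t)^2) ∂mu := by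
        refine setLIntegral_mono' (B_meas _) (fun x hx => ?_)
        rw [← ENNReal.ofReal_mul (by positivity)]
        refine ENNReal.ofReal_le_ofReal ?_
        have h1 : exp y.1 ≤ exp 1 * (Ex κ (pol y x)).1 := by
          have := abs_le.1 (fst_pol (y := y) hx)
          simp only [Ex]
          rw [← exp_add]; exact exp_le_exp.2 (by linarith)
        have h2 : exp y.1^2 ≤ exp 2 * (Ex κ (pol y x)).1^2 := by
          have := pow_le_pow_left₀ (exp_pos _).le h1 2
          have e : exp 1^2 = exp 2 := by rw [← exp_nat_mul]; norm_num
          rw [mul_pow, e] at this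
          exact this
        unfold Vg
        have : 0 ≤ exp y.1^2 * v (Ex κ (pol y x)) (exp y.1^2*t)^2 := by positivity
        nlinarith [mul_le_mul_of_nonneg_right h2 this]
    _ = ENNReal.ofReal (exp 2 * exp y.1^2) * ∫⁻ x in B r, ENNReal.ofReal ((Ex κ (pol y x)).1^2 * v (Ex κ (pol y x)) (exp y.1^2*t)^2) ∂mu := 
        lintegral_const_mul' _ _ ENNReal.ofReal_ne_top
    _ ≤ ENNReal.ofReal (exp 2 * exp y.1^2) * (ENNReal.ofReal κ * ∫⁻ x in B (exp (y.1+r)), ENNReal.ofReal (v x (exp y.1^2*t)^2) ∂mu) := by gcongr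
    _ = _ := by
        rw [ENNReal.ofReal_mul (exp_pos 2).le, ENNReal.ofReal_mul S.sys.κ0.le]; ring

lemma Sol.lintVV (S : Sol κ T Λ G M g v) {y : ℝ × ℝ} {r : ℝ} (hr : 0 < r) (hrκ : r ≤ κ) (hr1 : r ≤ 1) {I : Set ℝ} (hI : MeasurableSet I) :
    ∫⁻ t in I, ∫⁻ x in B r, ENNReal.ofReal (Vg κ v y x t^2) ∂mu ≤
      ENNReal.ofReal (κ * exp 2) * ∫⁻ t in (fun t => exp y.1^2 * t) '' I, ∫⁻ x in B (exp (y.1+r)), ENNReal.ofReal (v x t^2) ∂mu := by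
  have h0 : 0 < exp y.1^2 := by positivity
  have hd : ∀ x ∈ I, HasDerivWithinAt (fun t => exp y.1^2 * t) (exp y.1^2) I x := fun x _ => by
    simpa using ((hasDerivAt_id x).const_mul (exp y.1^2)).hasDerivWithinAt
  rw [lintegral_image_eq_lintegral_abs_deriv_mul hI hd (fun a _ b _ h => mul_left_cancel₀ h0.ne' h),
    ← lintegral_const_mul' _ _ ENNReal.ofReal_ne_top]
  refine lintegral_mono fun t => ?_
  have := S.lintV (y := y) hr hrκ hr1 t
  rwa [abs_of_pos h0]

end
end ConeH
end

section
open Real MeasureTheory Set Filter Topology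
open scoped ENNReal

namespace ConeH
section
variable {κ T Λ G M : ℝ} {g v : ℝ × ℝ → ℝ → ℝ}

noncomputable def Ur (κ T : ℝ) (g : ℝ × ℝ → ℝ → ℝ) (y : ℝ × ℝ) (r : ℝ) : ℝ × ℝ → ℝ → ℝ :=
  ind r (T/exp y.1^2) (fun x t => pr (Sli κ g y t) y x)
noncomputable def Ut (κ T : ℝ) (g : ℝ × ℝ → ℝ → ℝ) (y : ℝ × ℝ) (r : ℝ) : ℝ × ℝ → ℝ → ℝ :=
  ind r (T/exp y.1^2) (fun x t => pt (Sli κ g y t) y x)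
noncomputable def Urr (κ T : ℝ) (g : ℝ × ℝ → ℝ → ℝ) (y : ℝ × ℝ) (r : ℝ) : ℝ × ℝ → ℝ → ℝ :=
  ind r (T/exp y.1^2) (fun x t => prr (Sli κ g y t) y x)
noncomputable def Utt (κ T : ℝ) (g : ℝ × ℝ → ℝ → ℝ) (y : ℝ × ℝ) (r : ℝ) : ℝ × ℝ → ℝ → ℝ :=
  ind r (T/exp y.1^2) (fun x t => ptt (Sli κ g y t) y x)

lemma Sol.QS_int (S : Sol κ T Λ G M g v) {t : ℝ} (ht : t ∈ Icc 0 T) {R : ℝ} (hR : R ≤ 1) : 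
    IntegrableOn (fun x => QS κ T g x t) (B R) mu := (S.sys.qi t ht).mono_set (B_mono hR)

lemma Sol.interior (S : Sol κ T Λ G M g v) {y : ℝ × ℝ} {r : ℝ} (hr : 0 < r) (hrκ : r ≤ κ) (hr1 : r ≤ 1) (hy : y.1 + r ≤ 0) :
    Sys 1 r (T/exp y.1^2) (exp 2*Λ) (exp y.1^2*G) M (Ug κ g y) (Ur κ T g y r) (Ut κ T g y r) (Urr κ T g y r) (Utt κ T g y r) (Vg κ v y) := by
  have h0 : 0 < exp y.1^2 := by positivity
  have κ0 := S.sys.κ0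
  have Λ0 := S.sys.Λ0
  have G0 := S.sys.G0
  have T0 := S.sys.T0
  have hz : ∀ x ∈ B r, Ex κ (pol y x) ∈ B 1 := fun x hx => Ex_mem (Dc_sub hr hy (pol_mem hx))
  have sl : ∀ t ∈ Icc 0 (T/exp y.1^2), Sl r (fun x => Ug κ g y x t) (fun x => pr (Sli κ g y t) y x)
      (fun x => pt (Sli κ g y t) y x) (fun x => prr (Sli κ g y t) y x) (fun x => ptt (Sli κ g y t) y x) := fun t ht =>
    Sl_pol Hp_open (cd_Ex (S.cd _ (tsc ht))) (Dc_sub hr hy)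
  have ee : ∀ x ∈ B r, ∀ t ∈ Icc 0 (T/exp y.1^2),
      |lap 1 (fun x => pr (Sli κ g y t) y x) (fun x => prr (Sli κ g y t) y x) (fun x => ptt (Sli κ g y t) y x) x| ≤
        (exp 2 * Λ) * (|Vg κ v y x t| + exp y.1^2*G) ∧
      Vg κ v y x t^2/(2*(exp 2*Λ)) - (exp 2*Λ)*(exp y.1^2*G)^2/2 ≤ Vg κ v y x t *
        lap 1 (fun x => pr (Sli κ g y t) y x) (fun x => prr (Sli κ g y t) y x) (fun x => ptt (Sli κ g y t) y x) x := by
    intro x hx t ht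
    have e1 := S.sys.e1 _ (hz x hx) _ (tsc ht)
    have e2 := S.sys.e2 _ (hz x hx) _ (tsc ht)
    simp only [lap, ind_eq (hz x hx) (tsc ht)] at e1 e2
    have e3 := lap_U κ0 (S.cd _ (tsc ht)) hr hy hx
    have e4 : lap 1 (fun x => pr (Sli κ g y t) y x) (fun x => prr (Sli κ g y t) y x) (fun x => ptt (Sli κ g y t) y x) x
      = _ := e3
    rw [e4]
    unfold Vg
    have hp := abs_le.1 (fst_pol (y := y) hx)
    refine alg_int (k := exp (2*((pol y x).1 - y.1))) (exp_pos _) Λ0 G0 ?_ ?_ ?_ e1 e2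
    · rw [← exp_nat_mul, ← exp_nat_mul, ← exp_add]; congr 1; push_cast; ring
    · exact exp_le_exp.2 (by linarith)
    · rw [← exp_neg]; exact exp_le_exp.2 (by linarith)
  have mt : Measurable (fun p : (ℝ × ℝ) × ℝ => ((Ex κ (pol y p.1), exp y.1^2 * p.2) : (ℝ × ℝ) × ℝ)) :=
    ((Ex_meas κ y).comp measurable_fst).prodMk (measurable_snd.const_mul _)
  have mV : Measurable (fun p : (ℝ × ℝ) × ℝ => Vg κ v y p.1 p.2) := (S.sys.mv.comp mt).const_mul _
  have QL : ∀ t ∈ Icc 0 (T/exp y.1^2), 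
    ∫⁻ x in B r, ENNReal.ofReal (q 1 (fun x => pr (Sli κ g y t) y x) (fun x => pt (Sli κ g y t) y x) x) ∂mu ≤
      ENNReal.ofReal κ * ENNReal.ofReal (∫ x in B 1, QS κ T g x (exp y.1^2*t) ∂mu) := by
    intro t ht
    refine (S.lintQ hr hrκ hy ht).trans ?_
    gcongr
    rw [ofReal_integral_eq_lintegral_ofReal (S.QS_int (tsc ht) le_rfl) (Eventually.of_forall fun x => Q_nonneg _ _ _ _ _)]
    exact lintegral_mono_set (B_mono (by rw [← exp_zero]; exact exp_le_exp.2 hy))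
  obtain ⟨E, hE⟩ := S.sys.qE
  refine Sys.build one_pos hr (by positivity) (by positivity) (by positivity) S.sys.M0 sl ?_ ?_ ?_ (fun x hx t ht => (ee x hx t ht).1) (fun x hx t ht => (ee x hx t ht).2)
    (S.sys.mu'.comp mt) mV ?_ ?_ ?_
  · intro t ht x hx
    exact S.sys.bd _ (tsc ht) _ (hz x hx)
  · intro x
    exact ((S.sys.vc _).comp (continuous_const.mul continuous_id)).const_smul (exp y.1^2)
  · intro x hx s hs t ht
    have := S.sys.hv _ (hz x hx) _ (tsc hs) _ (tsc ht)
    unfold Ug Vg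
    rw [this, intervalIntegral.integral_const_mul, intervalIntegral.mul_integral_comp_mul_left]
  · intro t ht
    refine ⟨aesm_B ((sl t ht).toSl1.contOn_q), ?_⟩
    rw [hasFiniteIntegral_iff_ofReal (Eventually.of_forall fun x => q_nonneg _ _ _ _)]
    exact (QL t ht).trans_lt (ENNReal.mul_lt_top ENNReal.ofReal_lt_top ENNReal.ofReal_lt_top)
  · refine ⟨κ * E, fun t ht => ?_⟩
    have h1 : 0 ≤ ∫ x in B 1, QS κ T g x (exp y.1^2*t) ∂mu := integral_nonneg (fun x => Q_nonneg _ _ _ _ _)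
    rw [integral_eq_lintegral_of_nonneg_ae (Eventually.of_forall fun x => q_nonneg _ _ _ _) (aesm_B ((sl t ht).toSl1.contOn_q))]
    have h2 := ENNReal.toReal_mono (by finiteness) (QL t ht)
    rw [← ENNReal.ofReal_mul κ0.le, ENNReal.toReal_ofReal (by positivity)] at h2
    exact h2.trans (mul_le_mul_of_nonneg_left (hE _ (tsc ht)) κ0.le)
  · refine ⟨(mV.pow_const 2).aestronglyMeasurable, ?_⟩
    rw [hasFiniteIntegral_iff_ofReal (Eventually.of_forall fun x => sq_nonneg _),
      lintegral_prod_symm _ (mV.pow_const 2).ennreal_ofReal.aemeasurable]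
    refine (S.lintVV hr hrκ hr1 measurableSet_Icc).trans_lt ?_
    refine ENNReal.mul_lt_top ENNReal.ofReal_lt_top ?_
    have hv := S.sys.v2.2
    rw [hasFiniteIntegral_iff_ofReal (Eventually.of_forall fun x => sq_nonneg _),
      lintegral_prod_symm _ (S.sys.mv.pow_const 2).ennreal_ofReal.aemeasurable] at hv
    rw [image_mul_left_Icc' h0, mul_zero, mul_div_cancel₀ _ h0.ne']
    refine lt_of_le_of_lt (lintegral_mono fun t => ?_) hv
    exact lintegral_mono_set (B_mono (by rw [← exp_zero]; exact exp_le_exp.2 hy))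

lemma Sol.boundQ (S : Sol κ T Λ G M g v) {y : ℝ × ℝ} {r : ℝ} (hr : 0 < r) (hrκ : r ≤ κ) (hr1 : r ≤ 1) (hy : y.1 + r ≤ 0)
    {t : ℝ} (ht : t ∈ Icc 0 (T/exp y.1^2)) :
    ∫ x in B r, Q 1 (Ur κ T g y r) (Ut κ T g y r) x t ∂mu ≤ κ * ∫ x in B (exp (y.1+r)), QS κ T g x (exp y.1^2*t) ∂mu := by
  have I := S.interior hr hrκ hr1 hy
  have he : exp (y.1+r) ≤ 1 := by rw [← exp_zero]; exact exp_le_exp.2 hy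
  have h1 : 0 ≤ ∫ x in B (exp (y.1+r)), QS κ T g x (exp y.1^2*t) ∂mu := integral_nonneg (fun x => Q_nonneg _ _ _ _ _)
  have hκ := S.sys.κ0
  rw [integral_eq_lintegral_of_nonneg_ae (Eventually.of_forall fun x => Q_nonneg _ _ _ _ _) (I.qi t ht).1]
  refine ENNReal.toReal_le_of_le_ofReal (by positivity) ?_
  rw [ENNReal.ofReal_mul hκ.le, ofReal_integral_eq_lintegral_ofReal (S.QS_int (tsc ht) he) (Eventually.of_forall fun x => Q_nonneg _ _ _ _ _)]
  refine le_trans (le_of_eq ?_) (S.lintQ hr hrκ hy ht)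
  refine setLIntegral_congr_fun (B_meas _) (fun x hx => ?_)
  simp only [Q, q, Ur, Ut, ind_eq hx ht]

lemma Sol.boundV (S : Sol κ T Λ G M g v) {y : ℝ × ℝ} {r : ℝ} (hr : 0 < r) (hrκ : r ≤ κ) (hr1 : r ≤ 1) (hy : y.1 + r ≤ 0)
    {s t : ℝ} (hs : s ∈ Icc 0 (T/exp y.1^2)) (ht : t ∈ Icc 0 (T/exp y.1^2)) :
    ∫ p, Vg κ v y p.1 p.2^2 ∂(stm r s t) ≤ κ * exp 2 * ∫ p, v p.1 p.2^2 ∂(stm (exp (y.1+r)) (exp y.1^2*s) (exp y.1^2*t)) := by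
  have I := S.interior hr hrκ hr1 hy
  have h0 : 0 < exp y.1^2 := by positivity
  have he : exp (y.1+r) ≤ 1 := by rw [← exp_zero]; exact exp_le_exp.2 hy
  have h1 : 0 ≤ ∫ p, v p.1 p.2^2 ∂(stm (exp (y.1+r)) (exp y.1^2*s) (exp y.1^2*t)) := integral_nonneg (fun x => sq_nonneg _)
  have hκ := S.sys.κ0
  have hvi := S.sys.v2.mono_measure ((stm_mono he le_rfl le_rfl).trans (stm_le_pm (tsc hs).1 (tsc ht).2))
  rw [integral_eq_lintegral_of_nonneg_ae (Eventually.of_forall fun x => sq_nonneg _) (I.mv.pow_const 2).aestronglyMeasurable]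
  refine ENNReal.toReal_le_of_le_ofReal (by positivity) ?_
  rw [ENNReal.ofReal_mul (by positivity), ofReal_integral_eq_lintegral_ofReal hvi (Eventually.of_forall fun x => sq_nonneg _)]
  unfold stm
  rw [lintegral_prod_symm _ (I.mv.pow_const 2).ennreal_ofReal.aemeasurable, lintegral_prod_symm _ (S.sys.mv.pow_const 2).ennreal_ofReal.aemeasurable]
  have := S.lintVV (y := y) hr hrκ hr1 (measurableSet_Ioc (a := s) (b := t))
  rwa [image_mul_left_Ioc h0] at this

end
end ConeH
end

section
open Real MeasureTheory Set Filter Topology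
open scoped ENNReal

namespace ConeH

lemma ae_scale {c a b : ℝ} (hc : 0 < c) {P : ℝ → Prop} (h : ∀ᵐ t ∂(volume.restrict (Ioc (c*a) (c*b))), P t) :
    ∀ᵐ t ∂(volume.restrict (Ioc a b)), P (c*t) := by
  have hq : Measure.QuasiMeasurePreserving (fun t : ℝ => c*t) volume volume := by
    refine ⟨measurable_const_mul c, ?_⟩
    rw [Real.map_volume_mul_left hc.ne']
    exact Measure.smul_absolutelyContinuous
  rw [ae_restrict_iff' measurableSet_Ioc] at h ⊢
  filter_upwards [hq.ae h] with t ht hm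
  exact ht ⟨by nlinarith [hm.1], by nlinarith [hm.2]⟩

lemma exp_r0 {δ r0 y1 : ℝ} (δ0 : 0 < δ) (δ1 : δ < 1) (hr0 : r0 ≤ δ/4) (hy : exp y1 ≤ 1 - δ) : exp (y1 + r0) ≤ 1 - δ/2 := by
  rw [exp_add]
  have h1 : 1 - δ/4 ≤ exp (-r0) := by linarith [add_one_le_exp (-r0)]
  have h2 : exp (-r0) * exp r0 = 1 := by rw [← exp_add]; simp
  have h3 : (1-δ/4) * exp r0 ≤ 1 := (mul_le_mul_of_nonneg_right h1 (exp_pos _).le).trans h2.le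
  have h4 : 0 < exp r0 := exp_pos _
  have h5 : exp y1 * exp r0 ≤ (1-δ) * exp r0 := mul_le_mul_of_nonneg_right hy h4.le
  have h6 : (1-δ) ≤ (1-δ/2)*(1-δ/4) := by nlinarith
  have h7 : (1-δ) * exp r0 ≤ (1-δ/2)*((1-δ/4) * exp r0) := by nlinarith
  nlinarith

noncomputable def rz (κ δ : ℝ) : ℝ := min (δ/4) κ

set_option maxHeartbeats 1000000 in
lemma intBnd (κ Λ : ℝ) (hκ : 0 < κ) (hΛ : 0 < Λ) : ∃ α : ℝ, 0 < α ∧ α ≤ 1 ∧ 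
    ∀ G M δ : ℝ, 0 ≤ G → 0 ≤ M → 0 < δ → δ < 1 → ∃ C : ℝ, 0 < C ∧ 
    ∀ (T : ℝ) (g v : ℝ × ℝ → ℝ → ℝ), Sol κ T Λ G M g v → ∀ y : ℝ × ℝ, exp y.1 ≤ 1 - δ → 
    ∀ t0 ∈ Icc δ T, ∀ r, 0 < r → r ≤ rz κ δ → 
      Sys.Bnd 1 (Ur κ T g y (rz κ δ)) (Ut κ T g y (rz κ δ)) (Vg κ v y) r (t0/exp y.1^2) (C * (r * exp y.1)^(2*α)) := by
  obtain ⟨α1, α10, htip⟩ := tip κ Λ hκ hΛ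
  obtain ⟨α2, Cd, α20, Cd0, hdec⟩ := decay 1 (exp 2*Λ) one_pos (by positivity)
  set α := min (min α1 α2) 1 with hα
  have α0 : 0 < α := by positivity
  have αle1 : α ≤ 1 := min_le_right _ _
  have αα1 : α ≤ α1 := (min_le_left _ _).trans (min_le_left _ _)
  have αα2 : α ≤ α2 := (min_le_left _ _).trans (min_le_right _ _)
  refine ⟨α, α0, αle1, fun G M δ hG hM δ0 δ1 => ?_⟩
  obtain ⟨Ct, Ct0, ht⟩ := htip α α0 αα1 G M δ hG hM δ0 δ1
  set r0 := rz κ δ with hr0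
  have r00 : 0 < r0 := lt_min (by positivity) hκ
  have r0δ : r0 ≤ δ/4 := min_le_left _ _
  have r0κ : r0 ≤ κ := min_le_right _ _
  have r01 : r0 ≤ 1 := by linarith
  have hp0 : 0 < r0^(2*α) := rpow_pos_of_pos r00 _
  refine ⟨Cd / r0^(2*α) * (κ * exp 2 * Ct * exp 2 + G^2), by positivity, ?_⟩
  intro T g v S y hy t0 ht0 r hr hrr
  set ρ := exp y.1 with hρ
  have ρ0 : 0 < ρ := exp_pos _
  have ρ1 : ρ ≤ 1 := by linarith
  have hR := exp_r0 δ0 δ1 r0δ hy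
  have hy0 : y.1 + r0 ≤ 0 := by
    by_contra h
    push Not at h
    have := one_lt_exp_iff.2 h
    linarith
  have I := S.interior r00 r0κ r01 hy0
  have hE : exp (y.1+r0) = ρ * exp r0 := exp_add _ _
  have e1 : 1 ≤ exp r0 := one_le_exp r00.le
  have hρ2 : 0 < ρ^2 := by positivity
  have t0p : t0/ρ^2 ≤ T/ρ^2 := div_le_div_of_nonneg_right ht0.2 hρ2.le
  have hrt : r0^2 ≤ t0/ρ^2 := by
    rw [le_div_iff₀ hρ2]
    calc r0^2*ρ^2 ≤ 1*r0*1 := by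
          have : ρ^2 ≤ 1 := by nlinarith
          have : r0^2 ≤ r0 := by nlinarith
          nlinarith [sq_nonneg r0]
      _ ≤ t0 := by linarith [ht0.1]
  have key := ht T _ _ _ _ _ _ S.sys t0 ht0 (exp (y.1+r0)) (exp_pos _) hR
  set w := (δ*exp (y.1+r0)/2)^2 with hw
  have hwin : ρ^2*r0^2 ≤ w := by
    rw [hw, ← mul_pow]
    refine pow_le_pow_left₀ (by positivity) ?_ 2
    rw [hE]
    nlinarith [mul_pos ρ0 r00, mul_pos δ0 ρ0, mul_le_mul_of_nonneg_left e1 (mul_pos δ0 ρ0).le]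
  have hb : Sys.Bnd 1 (Ur κ T g y r0) (Ut κ T g y r0) (Vg κ v y) r0 (t0/ρ^2) (κ * exp 2 * (Ct * (exp (y.1+r0))^(2*α))) := by
    have e2 : ρ^2*(t0/ρ^2) = t0 := mul_div_cancel₀ _ hρ2.ne'
    have k2 := ae_scale (c := ρ^2) (a := t0/ρ^2 - r0^2) (b := t0/ρ^2) hρ2 (P := _) (ae_sub' key (by rw [mul_sub, e2]; linarith) (by rw [e2]))
    unfold Sys.Bnd
    filter_upwards [k2, ae_restrict_mem measurableSet_Ioc] with t ⟨h1, h2⟩ hm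
    have it : t ∈ Icc 0 (T/ρ^2) := ⟨by linarith [hm.1], by linarith [hm.2]⟩
    have is : t0/ρ^2 - r0^2 ∈ Icc 0 (T/ρ^2) := ⟨by linarith, by linarith [sq_nonneg r0]⟩
    have hx0 : 0 < Ct * (exp (y.1+r0))^(2*α) := mul_pos Ct0 (rpow_pos_of_pos (exp_pos _) _)
    constructor
    · refine (S.boundQ r00 r0κ r01 hy0 it).trans ?_
      refine (mul_le_mul_of_nonneg_left h1 hκ.le).trans ?_
      have : 1 ≤ exp 2 := one_le_exp (by norm_num)
      have h3 : κ * 1 ≤ κ * exp 2 := mul_le_mul_of_nonneg_left this hκ.le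
      calc _ = (κ * 1) * (Ct * (exp (y.1+r0))^(2*α)) := by ring
        _ ≤ _ := mul_le_mul_of_nonneg_right h3 hx0.le
    · refine (S.boundV r00 r0κ r01 hy0 is it).trans ?_
      refine mul_le_mul_of_nonneg_left (le_trans ?_ h2) (by positivity)
      have tT := tsc it
      have q1 : t0 - w ≤ ρ^2 * (t0/ρ^2 - r0^2) := by rw [mul_sub, e2]; linarith
      have he : exp (y.1+r0) ≤ 1 := by linarith
      have : 0 ≤ t0 - w := by
        have : w ≤ δ := by
          have : δ*exp (y.1+r0)/2 ≤ δ := by nlinarith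
          have p : 0 ≤ δ*exp (y.1+r0)/2 := by positivity
          rw [hw]; nlinarith
        linarith [ht0.1]
      exact integral_mono_measure (stm_mono le_rfl q1 le_rfl) (Eventually.of_forall fun x => sq_nonneg _)
        (S.sys.v2.mono_measure ((stm_mono he le_rfl le_rfl).trans (stm_le_pm this tT.2)))
  have hx0 : 0 < (exp (y.1+r0))^(2*α) := (rpow_pos_of_pos (exp_pos _) _)
  have hd := hdec r0 _ _ _ _ _ _ _ _ _ I (t0/ρ^2) _ hrt t0p (by positivity) hb r hr hrr
  have Ir := I.mono hr hrr
  have r2 : r^2 ≤ r0^2 := pow_le_pow_left₀ hr.le hrr 2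
  unfold Sys.Bnd at hd ⊢
  have c1 : (r/r0)^(2*α2) ≤ r^(2*α)/r0^(2*α) := by
    rw [← div_rpow hr.le r00.le]
    exact rpow_le_rpow_of_exponent_ge (by positivity) ((div_le_one r00).2 hrr) (by linarith)
  have c2 : (exp (y.1+r0))^(2*α) ≤ ρ^(2*α) * exp 2 := by
    have h9 : exp r0^(2*α) ≤ exp 2 := by
      rw [← exp_mul]; exact exp_le_exp.2 (by nlinarith)
    rw [hE, mul_rpow ρ0.le (exp_pos _).le]
    exact mul_le_mul_of_nonneg_left h9 (rpow_nonneg ρ0.le _)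
  have c3 : (ρ^2*G)^2*r0^4 ≤ G^2 * ρ^(2*α) := by
    have h4 : ρ^4 ≤ ρ^(2*α) := by
      rw [← Real.rpow_natCast]
      exact rpow_le_rpow_of_exponent_ge ρ0 ρ1 (by push_cast; linarith)
    have h5 : r0^4 ≤ 1 := pow_le_one₀ r00.le r01
    calc (ρ^2*G)^2*r0^4 = G^2 * (ρ^4 * r0^4) := by ring
      _ ≤ G^2 * (ρ^(2*α) * 1) := by
        refine mul_le_mul_of_nonneg_left (mul_le_mul h4 h5 (by positivity) (rpow_nonneg ρ0.le _)) (sq_nonneg _)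
      _ = _ := by ring
  have hfin : Cd * (r/r0)^(2*α2) * (κ * exp 2 * (Ct * (exp (y.1+r0))^(2*α)) + (ρ^2*G)^2*r0^4) ≤
      Cd / r0^(2*α) * (κ * exp 2 * Ct * exp 2 + G^2) * (r * ρ)^(2*α) := by
    rw [mul_rpow hr.le ρ0.le]
    have p1 : 0 ≤ (r/r0)^(2*α2) := rpow_nonneg (by positivity) _
    have p2 : 0 < ρ^(2*α) := rpow_pos_of_pos ρ0 _
    have p3 : 0 < r^(2*α) := rpow_pos_of_pos hr _
    have c4 : κ * exp 2 * (Ct * (exp (y.1+r0))^(2*α)) + (ρ^2*G)^2*r0^4 ≤ (κ * exp 2 * Ct * exp 2 + G^2) * ρ^(2*α) := by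
      have := mul_le_mul_of_nonneg_left c2 (show 0 ≤ κ * exp 2 * Ct by positivity)
      nlinarith
    calc _ ≤ Cd * (r^(2*α)/r0^(2*α)) * ((κ * exp 2 * Ct * exp 2 + G^2) * ρ^(2*α)) := by
          refine mul_le_mul (mul_le_mul_of_nonneg_left c1 Cd0.le) c4 (by positivity) (by positivity)
      _ = _ := by ring
  filter_upwards [hd] with t ht
  exact ⟨ht.1.trans hfin, ht.2.trans hfin⟩

end ConeH
end

section
open Real MeasureTheory Set Filter Topology
open scoped ENNReal

namespace ConeH
section
variable {κ R T Λ G M : ℝ} {u ur ut urr utt v : ℝ × ℝ → ℝ → ℝ}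

lemma pass_lim {F : ℝ → ℝ} {w t0 T A : ℝ} (hw : 0 < w) (hwt : w ≤ t0) (hT : t0 ≤ T)
    (hF : ContinuousWithinAt F (Icc 0 T) t0) (h : ∀ᵐ t ∂(volume.restrict (Ioc (t0-w) t0)), F t ≤ A) : F t0 ≤ A := by
  by_contra hc
  push Not at hc
  have h1 : ∀ᶠ t in 𝓝[Icc 0 T] t0, A < F t := hF.eventually (lt_mem_nhds hc)
  rw [eventually_nhdsWithin_iff, Metric.eventually_nhds_iff] at h1
  obtain ⟨ε, ε0, hε⟩ := h1
  set w' := min (ε/2) w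
  have w'0 : 0 < w' := by positivity
  have w'1 : w' ≤ w := min_le_right _ _
  have w'2 : w' ≤ ε/2 := min_le_left _ _
  obtain ⟨τ, hτ, hP⟩ := exists_good (s := t0 - w') (t := t0) (by linarith) (ae_sub' h (by linarith) le_rfl)
  have := hε (y := τ) (by rw [dist_eq, abs_lt]; constructor <;> linarith [hτ.1, hτ.2]) ⟨by linarith [hτ.1], by linarith [hτ.2]⟩
  linarith

namespace Sys

lemma circ (S : Sys κ R T Λ G M u ur ut urr utt v) (gc : ∀ x, Continuous (u x)) {t0 r a : ℝ} (hr : 0 < r) (hrR : r < R)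
    (h0 : r^2 ≤ t0) (hT : t0 ≤ T) (ha : 0 < a) (hB : Bnd κ ur ut v r t0 (a^2)) :
    ∫ θ in (0:ℝ)..(2*π), |u (r/2,θ) t0 - u (r,θ) t0| ≤ 4*a := by
  have m1 : ∀ θ, (r/2, θ) ∈ B R := fun θ => mem_B.2 ⟨by simpa using hr, by simp; linarith⟩
  have m2 : ∀ θ, (r, θ) ∈ B R := fun θ => mem_B.2 ⟨hr, hrR⟩
  have r2 : 0 < r^2 := by positivity
  have cw : ∀ t ∈ Icc 0 T, Continuous (fun θ => u (r/2,θ) t - u (r,θ) t) := fun t ht =>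
    (slice_t (S.sl t ht).c0 (by positivity) (by linarith)).sub (slice_t (S.sl t ht).c0 hr hrR)
  refine pass_lim (F := fun t => ∫ θ in (0:ℝ)..(2*π), |u (r/2,θ) t - u (r,θ) t|) r2 h0 hT ?_ ?_
  · refine intervalIntegral.continuousWithinAt_of_dominated_interval (bound := fun _ => 2*M) ?_ ?_ (by simp) ?_
    · filter_upwards [self_mem_nhdsWithin] with t ht
      exact (cw t ht).abs.aestronglyMeasurable
    · filter_upwards [self_mem_nhdsWithin] with t ht
      refine Eventually.of_forall fun θ _ => ?_
      rw [norm_eq_abs, abs_abs]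
      have := abs_sub (u (r/2,θ) t) (u (r,θ) t)
      linarith [S.bd t ht _ (m1 θ), S.bd t ht _ (m2 θ)]
    · refine Eventually.of_forall fun θ _ => ?_
      exact ((gc _).sub (gc _)).abs.continuousWithinAt
  · unfold Bnd at hB
    filter_upwards [hB, ae_restrict_mem measurableSet_Ioc] with t ⟨h1, _⟩ hm
    have it : t ∈ Icc 0 T := ⟨by linarith [hm.1], by linarith [hm.2]⟩
    have h2 := rad_int (S.sl t it).toSl1 (ρ := r/2) (r := r) (by positivity) (by linarith) hrR (S.qi t it)
    beta_reduce at h2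
    rw [intervalIntegral.integral_const_mul] at h2
    change ∫ x in B r, q κ (fun x => ur x t) (fun x => ut x t) x ∂mu ≤ a^2 at h1
    have h3 : ∫ θ in (0:ℝ)..(2*π), (u (r/2,θ) t - u (r,θ) t)^2 ≤ a^2 := by
      have : r/2 * (∫ θ in (0:ℝ)..(2*π), (u (r/2,θ) t - u (r,θ) t)^2) ≤ r/2 * a^2 := by
        refine h2.trans ?_
        rw [show r - r/2 = r/2 by ring]
        exact mul_le_mul_of_nonneg_left h1 (by positivity)
      exact le_of_mul_le_mul_left this (by positivity)
    have c := cw t it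
    calc ∫ θ in (0:ℝ)..(2*π), |u (r/2,θ) t - u (r,θ) t| ≤ ∫ θ in (0:ℝ)..(2*π), ((2*a)⁻¹ * (u (r/2,θ) t - u (r,θ) t)^2 + a/2) := by
          refine intervalIntegral.integral_mono_on (by positivity) (c.abs.intervalIntegrable _ _)
            ((((c.pow 2).const_mul _).add continuous_const).intervalIntegrable _ _) (fun θ _ => ?_)
          set w := u (r/2,θ) t - u (r,θ) t
          rw [← sq_abs w]
          have : (2*a)⁻¹ * |w|^2 + a/2 - |w| = (2*a)⁻¹ * (|w| - a)^2 := by field_simp; ring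
          have : 0 ≤ (2*a)⁻¹ * (|w| - a)^2 := by positivity
          linarith
      _ = (2*a)⁻¹ * (∫ θ in (0:ℝ)..(2*π), (u (r/2,θ) t - u (r,θ) t)^2) + 2*π*(a/2) := by
          have ci : IntervalIntegrable (fun θ => (2*a)⁻¹ * (u (r/2,θ) t - u (r,θ) t)^2) volume 0 (2*π) :=
            ((c.pow 2).const_mul _).intervalIntegrable _ _
          rw [intervalIntegral.integral_add ci (by simp), intervalIntegral.integral_const_mul]
          simp
          ring
      _ ≤ (2*a)⁻¹ * a^2 + 2*π*(a/2) := by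
          gcongr
      _ = a/2 + π * a := by field_simp
      _ ≤ 4*a := by nlinarith [pi_lt_d2]

lemma center (S : Sys κ R T Λ G M u ur ut urr utt v) (gc : ∀ x, Continuous (u x)) {t0 K α c : ℝ}
    (h0 : R^2 ≤ t0) (hT : t0 ≤ T) (hK : 0 < K) (hα : 0 < α) (hB : ∀ r, 0 < r → r ≤ R → Bnd κ ur ut v r t0 ((K*r^α)^2))
    (hc : ∀ ε > 0, ∃ η > 0, ∀ x ∈ B η, |u x t0 - c| ≤ ε) {ρ : ℝ} (hρ : 0 < ρ) (hρR : ρ < R) :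
    ∫ θ in (0:ℝ)..(2*π), |u (ρ,θ) t0 - c| ≤ 4*K/(1-(1/2)^α)*ρ^α := by
  have it : t0 ∈ Icc 0 T := ⟨(sq_nonneg R).trans h0, hT⟩
  have cs : ∀ r, 0 < r → r < R → Continuous (fun θ => u (r,θ) t0) := fun r hr hrR => slice_t (S.sl t0 it).c0 hr hrR
  set I : ℝ → ℝ := fun r => ∫ θ in (0:ℝ)..(2*π), |u (r,θ) t0 - c| with hI
  have hh : ((1:ℝ)/2)^α < 1 := rpow_lt_one (by norm_num) (by norm_num) hα
  set L := 4*K/(1-(1/2)^α) with hL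
  have L0 : 0 < L := div_pos (by positivity) (by linarith)
  have step : ∀ r, 0 < r → r < R → I r ≤ I (r/2) + (L*r^α - L*(r/2)^α) := by
    intro r hr hrR
    have hr2 : r/2 < R := by linarith
    have h1 := S.circ gc hr hrR ((pow_le_pow_left₀ hr.le hrR.le 2).trans h0) hT (a := K*r^α) (mul_pos hK (rpow_pos_of_pos hr _)) (hB r hr hrR.le)
    have h2 : L*r^α - L*(r/2)^α = 4*(K*r^α) := by
      have e : (r/2)^α = r^α*(1/2)^α := by rw [← mul_rpow hr.le (by norm_num)]; congr 1; ring
      have : L * (1-(1/2)^α) = 4*K := by rw [hL]; exact div_mul_cancel₀ _ (by linarith)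
      rw [e]
      linear_combination r^α*this
    rw [h2]
    have c1 := cs r hr hrR
    have c2 := cs (r/2) (by positivity) hr2
    calc I r ≤ ∫ θ in (0:ℝ)..(2*π), (|u (r/2,θ) t0 - c| + |u (r/2,θ) t0 - u (r,θ) t0|) := by
          refine intervalIntegral.integral_mono_on (by positivity) ((c1.sub continuous_const).abs.intervalIntegrable _ _)
            (((c2.sub continuous_const).abs.add (c2.sub c1).abs).intervalIntegrable _ _) (fun θ _ => ?_)
          have := abs_sub_le (u (r,θ) t0) (u (r/2,θ) t0) c
          rw [abs_sub_comm (u (r,θ) t0) (u (r/2,θ) t0)] at this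
          linarith
      _ = I (r/2) + ∫ θ in (0:ℝ)..(2*π), |u (r/2,θ) t0 - u (r,θ) t0| := 
          intervalIntegral.integral_add ((c2.sub continuous_const).abs.intervalIntegrable _ _) ((c2.sub c1).abs.intervalIntegrable _ _)
      _ ≤ _ := by linarith
  have ind : ∀ n : ℕ, I ρ ≤ I (ρ/2^n) + (L*ρ^α - L*(ρ/2^n)^α) := by
    intro n
    induction n with
    | zero => simp
    | succ n ih =>
      have hp : ρ/2^n ≤ ρ := div_le_self hρ.le (one_le_pow₀ (by norm_num))
      have h := step (ρ/2^n) (by positivity) (by linarith)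
      have e : ρ/2^n/2 = ρ/2^(n+1) := by rw [pow_succ (2:ℝ), div_div]
      rw [e] at h
      linarith
  refine le_of_forall_pos_le_add (fun ε ε0 => ?_)
  obtain ⟨η, η0, hη⟩ := hc (ε/(2*π)) (by positivity)
  obtain ⟨n, hn⟩ := exists_pow_lt_of_lt_one (show 0 < η/ρ by positivity) (show (1:ℝ)/2 < 1 by norm_num)
  have hn' : ρ/2^n < η := by
    rw [lt_div_iff₀ hρ] at hn
    calc ρ/2^n = (1/2)^n*ρ := by rw [one_div, inv_pow]; ring
      _ < η := hn
  have hp : ρ/2^n ≤ ρ := div_le_self hρ.le (one_le_pow₀ (by norm_num))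
  have hIn : I (ρ/2^n) ≤ ε := by
    calc I (ρ/2^n) ≤ ∫ θ in (0:ℝ)..(2*π), ε/(2*π) := by
          refine intervalIntegral.integral_mono_on (by positivity) (((cs _ (by positivity) (by linarith)).sub continuous_const).abs.intervalIntegrable _ _)
            (by simp) (fun θ _ => hη _ (mem_B.2 ⟨by simpa using (by positivity : 0 < ρ/2^n), hn'⟩))
      _ = ε := by rw [intervalIntegral.integral_const, smul_eq_mul]; field_simp; simp
  have h5 := ind n
  have : 0 ≤ L*(ρ/2^n)^α := mul_nonneg L0.le (rpow_nonneg (by positivity) _)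
  change I ρ ≤ _
  linarith

lemma contInt (S : Sys κ R T Λ G M u ur ut urr utt v) {t : ℝ} (ht : t ∈ Icc 0 T) (c : ℝ) {d : ℝ} (hd : d ≤ R) :
    IntegrableOn (fun x => |u x t - c|) (B d) mu := by
  have : IntegrableOn (fun x => |u x t - c|) (B R) mu := by
    refine intB_of_le (g := fun _ => M + |c|) (integrable_const _) (((S.sl t ht).c0.sub continuousOn_const).abs) (fun x hx => ?_)
    rw [abs_abs]
    linarith [abs_sub (u x t) c, S.bd t ht x hx]
  exact this.mono_set (B_mono hd)

lemma centerB (S : Sys κ R T Λ G M u ur ut urr utt v) (gc : ∀ x, Continuous (u x)) {t0 K α c : ℝ}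
    (h0 : R^2 ≤ t0) (hT : t0 ≤ T) (hK : 0 < K) (hα : 0 < α) (hB : ∀ r, 0 < r → r ≤ R → Bnd κ ur ut v r t0 ((K*r^α)^2))
    (hc : ∀ ε > 0, ∃ η > 0, ∀ x ∈ B η, |u x t0 - c| ≤ ε) {d : ℝ} (hd : 0 < d) (hdR : d ≤ R) :
    ∫ x in B d, |u x t0 - c| ∂mu ≤ 4*K/(1-(1/2)^α)*d^α*d^2 := by
  have it : t0 ∈ Icc 0 T := ⟨(sq_nonneg R).trans h0, hT⟩
  have hi := S.contInt it c hdR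
  rw [int_B hd.le hi]
  have hh : ((1:ℝ)/2)^α < 1 := rpow_lt_one (by norm_num) (by norm_num) hα
  have L0 : 0 < 4*K/(1-(1/2)^α) := div_pos (by positivity) (by linarith)
  have hdα : 0 < d^α := rpow_pos_of_pos hd _
  calc _ ≤ ∫ ρ in (0:ℝ)..d, d * (4*K/(1-(1/2)^α)*d^α) := by
        refine intervalIntegral.integral_mono_on_of_le_Ioo hd.le (int_B_ii hd.le hi) (by simp) (fun ρ hρ => ?_)
        rw [intervalIntegral.integral_const_mul]
        have h1 := S.center gc h0 hT hK hα hB hc hρ.1 (hρ.2.trans_le hdR)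
        have h2 : ρ^α ≤ d^α := rpow_le_rpow hρ.1.le hρ.2.le hα.le
        refine mul_le_mul hρ.2.le (h1.trans (mul_le_mul_of_nonneg_left h2 L0.le)) ?_ hd.le
        exact intervalIntegral.integral_nonneg (by positivity) (fun _ _ => abs_nonneg _)
    _ = _ := by simp; ring

lemma timeB (S : Sys κ R T Λ G M u ur ut urr utt v) (gc : ∀ x, Continuous (u x)) {t0 s a d : ℝ} (hd : 0 < d) (hdR : d ≤ R)
    (h0 : d^2 ≤ t0) (hT : t0 ≤ T) (ha : 0 < a) (hB : Bnd κ ur ut v d t0 (a^2)) (hs : t0 - d^2 ≤ s) (hst : s < t0) :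
    ∫ x in B d, |u x t0 - u x s| ∂mu ≤ 3*a*d^2 := by
  have is : s ∈ Icc 0 T := ⟨by linarith, by linarith⟩
  have S' := S.mono hd hdR
  have dR := B_mono hdR
  have cw : ∀ t ∈ Icc 0 T, ContinuousOn (fun x => |u x t - u x s|) (B d) := fun t ht =>
    ((S'.sl t ht).c0.sub (S'.sl s is).c0).abs
  have hbd : ∀ t ∈ Icc 0 T, ∀ x ∈ B d, |u x t - u x s| ≤ 2*M := fun t ht x hx => by
    have := abs_sub (u x t) (u x s)
    linarith [S'.bd t ht _ hx, S'.bd s is _ hx]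
  refine pass_lim (F := fun t => ∫ x in B d, |u x t - u x s| ∂mu) (w := t0 - s) (T := T) (by linarith) (by linarith [is.1]) hT ?_ ?_
  · refine continuousWithinAt_of_dominated (bound := fun _ => 2*M) ?_ ?_ (integrable_const _) ?_
    · filter_upwards [self_mem_nhdsWithin] with t ht
      exact aesm_B (cw t ht)
    · filter_upwards [self_mem_nhdsWithin] with t ht
      filter_upwards [ae_restrict_mem (B_meas d)] with x hx
      rw [norm_eq_abs, abs_abs]
      exact hbd t ht x hx
    · refine Eventually.of_forall fun x => ?_
      exact ((gc _).sub continuous_const).abs.continuousWithinAt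
  · unfold Bnd at hB
    rw [show t0 - (t0 - s) = s by ring]
    filter_upwards [ae_sub' hB hs le_rfl, ae_restrict_mem measurableSet_Ioc] with t ⟨_, h1⟩ hm
    have it : t ∈ Icc 0 T := ⟨by linarith [hm.1], by linarith [hm.2]⟩
    set l := a/d^2 with hl
    have l0 : 0 < l := by positivity
    have vi : Integrable (fun p : (ℝ × ℝ) × ℝ => v p.1 p.2^2) (stm d (t0-d^2) t) := 
      S'.v2.mono_measure (stm_le_pm (by linarith) it.2)
    have vi2 := vi.mono_measure (stm_mono (R := d) le_rfl hs (le_refl t))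
    have h2 : ∫ p, v p.1 p.2^2 ∂(stm d s t) ≤ a^2 :=
      (integral_mono_measure (stm_mono le_rfl hs le_rfl) (Eventually.of_forall fun x => sq_nonneg _) vi).trans h1
    set F : (ℝ × ℝ) × ℝ → ℝ := fun p => (2*l)⁻¹ * v p.1 p.2^2 + l/2 with hF
    have Fi : Integrable F (stm d s t) := (vi2.const_mul _).add (integrable_const _)
    calc ∫ x in B d, |u x t - u x s| ∂mu ≤ ∫ x in B d, (∫ τ in Ioc s t, F (x,τ)) ∂mu := by
          refine integral_mono_ae (intB_of_le (g := fun _ => 2*M) (integrable_const _) (cw t it) (fun x hx => by rw [abs_abs]; exact hbd t it x hx))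
            Fi.integral_prod_left ?_
          filter_upwards [ae_restrict_mem (B_meas d)] with x hx
          rw [S'.hv x hx s is t it, intervalIntegral.integral_of_le hm.1.le]
          refine (abs_integral_le_integral_abs).trans ?_
          have cv := S.vc x
          refine setIntegral_mono_on ((cv.abs.integrableOn_Icc).mono_set Ioc_subset_Icc_self) 
            (((((cv.pow 2).const_mul _).add continuous_const).integrableOn_Icc).mono_set Ioc_subset_Icc_self) measurableSet_Ioc (fun τ _ => ?_)
          change |v x τ| ≤ (2*l)⁻¹ * v x τ^2 + l/2
          rw [← sq_abs (v x τ)]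
          have : (2*l)⁻¹ * |v x τ|^2 + l/2 - |v x τ| = (2*l)⁻¹ * (|v x τ| - l)^2 := by field_simp; ring
          have : 0 ≤ (2*l)⁻¹ * (|v x τ| - l)^2 := by positivity
          linarith
      _ = ∫ p, F p ∂(stm d s t) := (integral_prod _ Fi).symm
      _ = (2*l)⁻¹ * (∫ p, v p.1 p.2^2 ∂(stm d s t)) + l/2 * (π*d^2*(t-s)) := by
          rw [hF, integral_add (vi2.const_mul _) (integrable_const _), integral_const_mul, stm_const hd.le hm.1.le]
      _ ≤ (2*l)⁻¹ * a^2 + l/2 * (π*d^2*d^2) := by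
          have : t - s ≤ d^2 := by linarith [hm.2]
          gcongr
      _ = (a/2 + π*a/2)*d^2 := by rw [hl]; field_simp
      _ ≤ 3*a*d^2 := by
          refine mul_le_mul_of_nonneg_right ?_ (sq_nonneg _)
          nlinarith [pi_lt_d2]

end Sys
end
end ConeH
end

section
open Real MeasureTheory Set Filter Topology
open scoped ENNReal

namespace ConeH

lemma Ug_at {κ : ℝ} {g : ℝ × ℝ → ℝ → ℝ} (y x : ℝ × ℝ) (t : ℝ) : Ug κ g y x (t/exp y.1^2) = g (Ex κ (pol y x)) t := by
  unfold Ug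
  rw [mul_div_cancel₀ _ (by positivity)]

lemma Sol.hc {κ T Λ G M : ℝ} {g v : ℝ × ℝ → ℝ → ℝ} (S : Sol κ T Λ G M g v) {y : ℝ × ℝ} (hy : y.1 < 0) {t : ℝ} (ht : t ∈ Icc 0 T) :
    ∀ ε > 0, ∃ η > 0, ∀ x ∈ B η, |Ug κ g y x (t/exp y.1^2) - g (Ex κ y) t| ≤ ε := by
  intro ε ε0
  have h1 : ContinuousOn (fun z => g (Ex κ z) t) Hp := (cd_Ex (S.cd t ht)).continuousOn
  have h2 : ContinuousAt (fun z => g (Ex κ z) t) y := h1.continuousAt (Hp_open.mem_nhds hy)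
  rw [Metric.continuousAt_iff] at h2
  obtain ⟨η, η0, hη⟩ := h2 ε ε0
  refine ⟨η, η0, fun x hx => ?_⟩
  rw [Ug_at]
  have hp : (((pol y x).1 - y.1)^2 + ((pol y x).2-y.2)^2 < η^2) := pol_mem hx
  have := hη (x := pol y x) (by
    rw [Prod.dist_eq, max_lt_iff, dist_eq, dist_eq]
    constructor
    · exact abs_lt_of_sq_lt_sq (by nlinarith [sq_nonneg ((pol y x).2-y.2)]) η0.le
    · exact abs_lt_of_sq_lt_sq (by nlinarith [sq_nonneg ((pol y x).1-y.1)]) η0.le)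
  rw [dist_eq] at this
  exact this.le

lemma Dc_lint (z : ℝ × ℝ) {D : ℝ} (hD : 0 < D) (c : ℝ≥0∞) : ∫⁻ _ in Dc z D, c = c * ENNReal.ofReal (π*D^2) := by
  rw [← lint_pol z hD (F := fun _ => c) measurable_const]
  simp [mu_B hD.le]

set_option maxHeartbeats 1000000 in
lemma ptwise (κ Λ : ℝ) (hκ : 0 < κ) (hΛ : 0 < Λ) : ∃ α : ℝ, 0 < α ∧ α ≤ 1 ∧ 
    ∀ G M δ : ℝ, 0 ≤ G → 0 ≤ M → 0 < δ → δ < 1 → ∃ C : ℝ, 0 < C ∧ 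
    ∀ (T : ℝ) (g v : ℝ × ℝ → ℝ → ℝ), Sol κ T Λ G M g v → 
    (∀ y : ℝ × ℝ, exp y.1 ≤ 1 - δ → ∀ t ∈ Icc δ T, ∀ s ∈ Icc δ T, s < t → √(t-s) ≤ rz κ δ * exp y.1 → 
      |g (Ex κ y) t - g (Ex κ y) s| ≤ C * (√(t-s))^α) ∧
    (∀ y z : ℝ × ℝ, ∀ t ∈ Icc δ T, ∀ m D : ℝ, exp y.1 ≤ m → exp z.1 ≤ m → m ≤ 1 - δ → 0 < D →
      (z.1-y.1)^2 + (z.2-y.2)^2 ≤ D^2 → 2*D ≤ rz κ δ → |g (Ex κ y) t - g (Ex κ z) t| ≤ C * (D*m)^α) := by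
  obtain ⟨α, α0, α1, hbnd⟩ := intBnd κ Λ hκ hΛ
  refine ⟨α, α0, α1, fun G M δ hG hM δ0 δ1 => ?_⟩
  obtain ⟨C, C0, hb⟩ := hbnd G M δ hG hM δ0 δ1
  set r0 := rz κ δ with hr0
  have r00 : 0 < r0 := lt_min (by positivity) hκ
  have r0δ : r0 ≤ δ/4 := min_le_left _ _
  have r0κ : r0 ≤ κ := min_le_right _ _
  have r01 : r0 ≤ 1 := by linarith
  have hh : ((1:ℝ)/2)^α < 1 := rpow_lt_one (by norm_num) (by norm_num) α0
  have hh' : 0 < 1 - ((1:ℝ)/2)^α := by linarith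
  set L := 4/(1-((1:ℝ)/2)^α) with hL
  have L0 : 0 < L := by positivity
  set k := √C with hk
  have k0 : 0 < k := Real.sqrt_pos.2 C0
  refine ⟨9*L*k + 3*k, by positivity, fun T g v S => ?_⟩
  -- data at a point
  have hy0 : ∀ y : ℝ × ℝ, exp y.1 ≤ 1 - δ → y.1 + r0 ≤ 0 := fun y hy => by
    by_contra h
    push Not at h
    have := one_lt_exp_iff.2 h
    linarith [exp_r0 δ0 δ1 r0δ hy]
  have I : ∀ y : ℝ × ℝ, exp y.1 ≤ 1 - δ → _ := fun y hy => S.interior r00 r0κ r01 (hy0 y hy)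
  have gcU : ∀ y x : ℝ × ℝ, Continuous (Ug κ g y x) := fun y x => by
    unfold Ug
    exact (S.gc _).comp (by fun_prop)
  have hrt : ∀ y : ℝ × ℝ, exp y.1 ≤ 1 - δ → ∀ t ∈ Icc δ T, r0^2 ≤ t/exp y.1^2 := fun y hy t ht => by
    rw [le_div_iff₀ (by positivity)]
    have e0 := exp_pos y.1
    have h1 : exp y.1^2 ≤ 1 := by nlinarith
    have h2 : r0^2 ≤ δ := by nlinarith
    calc r0^2*exp y.1^2 ≤ δ*1 := mul_le_mul h2 h1 (by positivity) δ0.le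
      _ ≤ t := by linarith [ht.1]
  have htT : ∀ y : ℝ × ℝ, ∀ t ∈ Icc δ T, t/exp y.1^2 ≤ T/exp y.1^2 := fun y t ht =>
    div_le_div_of_nonneg_right ht.2 (by positivity)
  have hBn : ∀ y : ℝ × ℝ, exp y.1 ≤ 1 - δ → ∀ t ∈ Icc δ T, ∀ r, 0 < r → r ≤ r0 → 
      Sys.Bnd 1 (Ur κ T g y r0) (Ut κ T g y r0) (Vg κ v y) r (t/exp y.1^2) (((k*exp y.1^α)*r^α)^2) := fun y hy t ht r hr hrr => by
    have h := hb T g v S y hy t ht r hr hrr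
    have e : C * (r * exp y.1)^(2*α) = ((k*exp y.1^α)*r^α)^2 := by
      rw [mul_rpow hr.le (exp_pos _).le, mul_comm 2 α, rpow_mul hr.le, rpow_mul (exp_pos _).le, rpow_two, rpow_two, mul_pow, mul_pow, hk, sq_sqrt C0.le]
      ring
    rwa [e] at h
  have hcen : ∀ y : ℝ × ℝ, exp y.1 ≤ 1 - δ → ∀ t ∈ Icc δ T, ∀ d, 0 < d → d ≤ r0 → 
      ∫ x in B d, |Ug κ g y x (t/exp y.1^2) - g (Ex κ y) t| ∂mu ≤ L*k*(d*exp y.1)^α*d^2 := fun y hy t ht d hd hdr => by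
    have h := (I y hy).centerB (gcU y) (hrt y hy t ht) (htT y t ht) (K := k*exp y.1^α) (mul_pos k0 (rpow_pos_of_pos (exp_pos _) _)) α0 (hBn y hy t ht)
      (S.hc (by linarith [hy0 y hy]) ⟨by linarith [ht.1], ht.2⟩) hd hdr
    refine h.trans (le_of_eq ?_)
    rw [mul_rpow hd.le (exp_pos _).le, hL]
    ring
  constructor
  · intro y hy t ht s hs hst hd
    set ρ := exp y.1 with hρ
    have ρ0 : 0 < ρ := exp_pos _
    set d := √(t-s)/ρ with hdd
    have sq0 : 0 < √(t-s) := Real.sqrt_pos.2 (by linarith)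
    have d0 : 0 < d := by positivity
    have dr : d ≤ r0 := by rw [hdd, div_le_iff₀ ρ0]; exact hd
    have dρ : d*ρ = √(t-s) := div_mul_cancel₀ _ ρ0.ne'
    have d2 : d^2 = t/ρ^2 - s/ρ^2 := by
      rw [hdd, div_pow, sq_sqrt (by linarith), sub_div]
    have q1 := hcen y hy t ht d d0 dr
    have q2 := hcen y hy s hs d d0 dr
    have hsp : 0 < s/ρ^2 := div_pos (by linarith [hs.1]) (by positivity)
    have q3 := (I y hy).timeB (gcU y) d0 dr (t0 := t/ρ^2) (s := s/ρ^2) (a := k*ρ^α*d^α) (by linarith) (htT y t ht)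
      (mul_pos (mul_pos k0 (rpow_pos_of_pos ρ0 _)) (rpow_pos_of_pos d0 _)) (hBn y hy t ht d d0 dr) (by linarith) (by nlinarith)
    have iT : t/ρ^2 ∈ Icc 0 (T/ρ^2) := ⟨by nlinarith, htT y t ht⟩
    have iS : s/ρ^2 ∈ Icc 0 (T/ρ^2) := ⟨hsp.le, htT y s hs⟩
    have i1 := (I y hy).contInt iT (g (Ex κ y) t) dr
    have i2 := (I y hy).contInt iS (g (Ex κ y) s) dr
    have i3 : IntegrableOn (fun x => |Ug κ g y x (t/ρ^2) - Ug κ g y x (s/ρ^2)|) (B d) mu := by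
      have S' := (I y hy).mono d0 dr
      refine intB_of_le (g := fun _ => 2*M) (integrable_const _) (((S'.sl _ iT).c0.sub (S'.sl _ iS).c0).abs) (fun x hx => ?_)
      rw [abs_abs]
      have := abs_sub (Ug κ g y x (t/ρ^2)) (Ug κ g y x (s/ρ^2))
      linarith [S'.bd _ iT _ hx, S'.bd _ iS _ hx]
    have hm : ∫ _ in B d, |g (Ex κ y) t - g (Ex κ y) s| ∂mu ≤ ∫ x in B d, ((|Ug κ g y x (t/ρ^2) - g (Ex κ y) t|
        + |Ug κ g y x (s/ρ^2) - g (Ex κ y) s|) + |Ug κ g y x (t/ρ^2) - Ug κ g y x (s/ρ^2)|) ∂mu := by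
      refine integral_mono (integrable_const _) ((i1.add i2).add i3) (fun x => ?_)
      change |g (Ex κ y) t - g (Ex κ y) s| ≤ |Ug κ g y x (t/ρ^2) - g (Ex κ y) t|
        + |Ug κ g y x (s/ρ^2) - g (Ex κ y) s| + |Ug κ g y x (t/ρ^2) - Ug κ g y x (s/ρ^2)|
      have a1 := abs_sub_le (g (Ex κ y) t) (Ug κ g y x (t/ρ^2)) (g (Ex κ y) s)
      have a2 := abs_sub_le (Ug κ g y x (t/ρ^2)) (Ug κ g y x (s/ρ^2)) (g (Ex κ y) s)
      rw [abs_sub_comm (g (Ex κ y) t) (Ug κ g y x (t/ρ^2))] at a1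
      linarith
    have i12 : Integrable (fun x => |Ug κ g y x (t/ρ^2) - g (Ex κ y) t|
        + |Ug κ g y x (s/ρ^2) - g (Ex κ y) s|) (mu.restrict (B d)) := i1.add i2
    rw [integral_add i12 i3, integral_add i1 i2, setIntegral_const, mu_B_real d0.le, smul_eq_mul] at hm
    have e3 : 3*(k*ρ^α*d^α)*d^2 = 3*k*√(t-s)^α*d^2 := by
      rw [← dρ, mul_rpow d0.le ρ0.le]; ring
    rw [e3] at q3
    rw [dρ] at q1 q2
    have hs0 : 0 ≤ √(t-s)^α := rpow_nonneg sq0.le _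
    have f1 : d^2 * |g (Ex κ y) t - g (Ex κ y) s| ≤ d^2 * ((9*L*k+3*k)*√(t-s)^α) := by
      calc d^2 * |g (Ex κ y) t - g (Ex κ y) s| ≤ π * d^2 * |g (Ex κ y) t - g (Ex κ y) s| := by
            refine mul_le_mul_of_nonneg_right ?_ (abs_nonneg _)
            nlinarith [pi_gt_three, sq_nonneg d]
        _ ≤ L*k*√(t-s)^α*d^2 + L*k*√(t-s)^α*d^2 + 3*k*√(t-s)^α*d^2 := by linarith
        _ ≤ _ := by
          have : 0 ≤ L*k*√(t-s)^α*d^2 := by positivity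
          linarith
    exact le_of_mul_le_mul_left f1 (by positivity)
  · intro y z t ht m D hym hzm hm D0 hD hDr
    have it : t ∈ Icc 0 T := ⟨by linarith [ht.1], ht.2⟩
    set h : ℝ × ℝ → ℝ := fun w => g (Ex κ w) t with hh0
    have mh : Measurable h := (S.sys.mu'.comp (measurable_id.prodMk measurable_const)).comp (by unfold Ex; fun_prop : Measurable (Ex κ))
    have m0 : 0 < m := (exp_pos _).trans_le hym
    have key : ∀ y : ℝ × ℝ, exp y.1 ≤ m → ∀ d, 0 < d → d ≤ r0 → 
        ∫⁻ w in Dc y d, ENNReal.ofReal |h w - h y| ≤ ENNReal.ofReal (L*k*(d*m)^α*d^2) := by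
      intro y hy d d0 hd
      have hyδ := hy.trans hm
      rw [← lint_pol y d0 (F := fun w => ENNReal.ofReal |h w - h y|) (mh.sub measurable_const).abs.ennreal_ofReal]
      have hi := (I y hyδ).contInt (t := t/exp y.1^2) ⟨(sq_nonneg r0).trans (hrt y hyδ t ht), htT y t ht⟩ (g (Ex κ y) t) hd
      have e : ∀ x, |Ug κ g y x (t/exp y.1^2) - g (Ex κ y) t| = |h (pol y x) - h y| := fun x => by rw [Ug_at]
      have hq := hcen y hyδ t ht d d0 hd
      simp only [e] at hi hq
      rw [← ofReal_integral_eq_lintegral_ofReal hi (Eventually.of_forall fun x => abs_nonneg _)]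
      refine ENNReal.ofReal_le_ofReal (hq.trans ?_)
      have : (d*exp y.1)^α ≤ (d*m)^α := rpow_le_rpow (by positivity) (mul_le_mul_of_nonneg_left hy d0.le) α0.le
      gcongr
    have k1 := key z hzm D D0 (by linarith)
    have k2 := key y hym (2*D) (by positivity) hDr
    have hsub : Dc z D ⊆ Dc y (2*D) := by
      intro w hw
      change (w.1-z.1)^2 + (w.2-z.2)^2 < D^2 at hw
      change (w.1-y.1)^2 + (w.2-y.2)^2 < (2*D)^2
      nlinarith [sq_nonneg ((w.1-z.1) - (z.1-y.1)), sq_nonneg ((w.2-z.2) - (z.2-y.2))]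
    have tot : ENNReal.ofReal |h y - h z| * ENNReal.ofReal (π*D^2) ≤ ENNReal.ofReal (L*k*(D*m)^α*D^2 + L*k*(2*D*m)^α*(2*D)^2) := by
      rw [ENNReal.ofReal_add (by positivity) (by positivity), ← Dc_lint z D0]
      refine le_trans ?_ (add_le_add k1 ((lintegral_mono_set hsub).trans k2))
      have mm : Measurable (fun w => ENNReal.ofReal |h w - h z|) := (mh.sub measurable_const).abs.ennreal_ofReal
      rw [← lintegral_add_left mm]
      refine lintegral_mono (fun w => ?_)
      rw [← ENNReal.ofReal_add (abs_nonneg _) (abs_nonneg _)]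
      refine ENNReal.ofReal_le_ofReal ?_
      have := abs_sub_le (h y) (h w) (h z)
      rw [abs_sub_comm (h y) (h w)] at this
      linarith
    rw [← ENNReal.ofReal_mul (abs_nonneg _), ENNReal.ofReal_le_ofReal_iff (by positivity)] at tot
    have e2 : (2*D*m)^α ≤ 2*(D*m)^α := by
      rw [mul_assoc, mul_rpow (by norm_num) (by positivity)]
      refine mul_le_mul_of_nonneg_right ?_ (rpow_nonneg (by positivity) _)
      calc (2:ℝ)^α ≤ 2^(1:ℝ) := rpow_le_rpow_of_exponent_le (by norm_num) α1
        _ = 2 := rpow_one _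
    have p0 : 0 ≤ (D*m)^α := rpow_nonneg (by positivity) _
    have f1 : D^2 * |h y - h z| ≤ D^2 * ((9*L*k+3*k)*(D*m)^α) := by
      calc D^2 * |h y - h z| ≤ |h y - h z| * (π * D^2) := by
            rw [mul_comm]
            refine mul_le_mul_of_nonneg_left ?_ (abs_nonneg _)
            nlinarith [pi_gt_three, sq_nonneg D]
        _ ≤ L*k*(D*m)^α*D^2 + L*k*(2*(D*m)^α)*(2*D)^2 := by
            refine tot.trans ?_
            gcongr
        _ = D^2 * ((9*L*k)*(D*m)^α) := by ring
        _ ≤ _ := by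
          refine mul_le_mul_of_nonneg_left (mul_le_mul_of_nonneg_right ?_ p0) (sq_nonneg _)
          linarith
    exact le_of_mul_le_mul_left f1 (by positivity)

end ConeH
end

section
open Real MeasureTheory Set Filter Topology
open scoped ENNReal

namespace ConeH

/-- bundled two-point estimates, in polar coordinates -/
structure Two (κ r0 α C δ : ℝ) (J : Set ℝ) (w : ℝ → ℝ → ℝ → ℝ) : Prop where
  per : ∀ ρ θ t, w ρ (θ + 2*π) t = w ρ θ t
  hA : ∀ ρ θ t s, 0 < ρ → ρ ≤ 1 - δ → t ∈ J → s ∈ J → s < t → √(t-s) ≤ r0*ρ → |w ρ θ t - w ρ θ s| ≤ C * √(t-s)^α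
  hB : ∀ ρ₁ θ₁ ρ₂ θ₂ t m D, 0 < ρ₁ → 0 < ρ₂ → ρ₁ ≤ m → ρ₂ ≤ m → m ≤ 1 - δ → t ∈ J → 0 < D → 
    |log ρ₁ - log ρ₂| + κ * |θ₁ - θ₂| ≤ D → 2*D ≤ r0 → |w ρ₁ θ₁ t - w ρ₂ θ₂ t| ≤ C * (D*m)^α

section
variable {κ r0 α C δ : ℝ} {J : Set ℝ} {w : ℝ → ℝ → ℝ → ℝ}

lemma red_angle (θ₁ θ₂ : ℝ) : ∃ n : ℤ, |θ₁ - (θ₂ + n * (2*π))| ≤ π := by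
  refine ⟨round ((θ₁-θ₂)/(2*π)), ?_⟩
  have h := abs_sub_round ((θ₁-θ₂)/(2*π))
  set n := round ((θ₁-θ₂)/(2*π))
  have e : θ₁ - (θ₂ + n*(2*π)) = (2*π) * ((θ₁-θ₂)/(2*π) - n) := by field_simp; ring
  rw [e, abs_mul, abs_of_pos (by positivity)]
  nlinarith [pi_pos]

lemma Two.per_int (h : Two κ r0 α C δ J w) (ρ θ t : ℝ) (n : ℤ) : w ρ (θ + n*(2*π)) t = w ρ θ t :=
  (show Function.Periodic (fun θ => w ρ θ t) (2*π) from fun θ => h.per ρ θ t).int_mul n θ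

lemma Two.radial (h : Two κ r0 α C δ J w) (hr0 : 0 < r0) (hr1 : r0 ≤ 1) (hα : 0 < α) (hC : 0 < C) {ρ₁ ρ₂ θ t : ℝ}
    (h2 : 0 < ρ₂) (h12 : ρ₂ ≤ ρ₁) (h1 : ρ₁ ≤ 1 - δ) (ht : t ∈ J) :
    |w ρ₁ θ t - w ρ₂ θ t| ≤ C/(1-exp (-(r0/2))^α) * ρ₁^α := by
  set l := exp (-(r0/2)) with hl
  have l0 : 0 < l := exp_pos _
  have l1 : l < 1 := by rw [hl, exp_lt_one_iff]; linarith
  have lα : l^α < 1 := rpow_lt_one l0.le l1 hα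
  set L := C/(1-l^α) with hL
  have hLC : L*(1-l^α) = C := div_mul_cancel₀ _ (by linarith)
  have L0 : 0 < L := div_pos hC (by linarith)
  have CL : C ≤ L := by
    rw [← hLC]
    have : 0 < l^α := rpow_pos_of_pos l0 _
    nlinarith
  have one : ∀ a b : ℝ, 0 < b → b ≤ a → a ≤ 1 - δ → l*a ≤ b → |w a θ t - w b θ t| ≤ C * a^α := by
    intro a b b0 hba ha hb
    have a0 : 0 < a := b0.trans_le hba
    have h3 : log a - log b ≤ r0/2 := by
      have := Real.log_le_log (by positivity) hb
      rw [log_mul l0.ne' a0.ne', hl, log_exp] at this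
      linarith
    have h4 : log b ≤ log a := Real.log_le_log b0 hba
    refine (h.hB a θ b θ t a (r0/2) a0 b0 le_rfl hba ha ht (by positivity) ?_ (by linarith)).trans ?_
    · rw [abs_of_nonneg (by linarith)]; simpa using h3
    · refine mul_le_mul_of_nonneg_left (rpow_le_rpow (by positivity) ?_ hα.le) hC.le
      nlinarith
  have main : ∀ n : ℕ, ∀ a b : ℝ, 0 < b → b ≤ a → a ≤ 1 - δ → l^n*a ≤ b → |w a θ t - w b θ t| ≤ L * a^α := by
    intro n
    induction n with
    | zero =>
      intro a b b0 hba ha hb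
      have : a = b := by linarith
      rw [this]; simp; exact mul_nonneg L0.le (rpow_nonneg b0.le _)
    | succ n ih =>
      intro a b b0 hba ha hb
      have a0 : 0 < a := b0.trans_le hba
      by_cases hc : l*a ≤ b
      · exact (one a b b0 hba ha hc).trans (mul_le_mul_of_nonneg_right CL (rpow_nonneg a0.le _))
      · push Not at hc
        have h5 := ih (l*a) b b0 hc.le (by nlinarith) (by rw [← mul_assoc, ← pow_succ l]; exact hb)
        have h6 := one a (l*a) (by positivity) (by nlinarith) ha le_rfl
        rw [mul_rpow l0.le a0.le] at h5
        have h7 := abs_sub_le (w a θ t) (w (l*a) θ t) (w b θ t)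
        have : L * (l^α*a^α) + C*a^α = L*a^α := by rw [← hLC]; ring
        linarith
  have h10 : 0 < ρ₁ := h2.trans_le h12
  obtain ⟨n, hn⟩ := exists_pow_lt_of_lt_one (show 0 < ρ₂/ρ₁ by positivity) l1
  refine main n ρ₁ ρ₂ h2 h12 h1 ?_
  rw [lt_div_iff₀ h10] at hn
  exact hn.le

lemma Two.ang (h : Two κ r0 α C δ J w) (hκ : 0 < κ) (hr0 : 0 < r0) (hr1 : r0 ≤ 1) (hα : 0 < α) (hC : 0 < C) {N : ℕ} (hN : 2*π*κ/r0 ≤ N)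
    {ρ θ₁ θ₂ t : ℝ} (h0 : 0 < ρ) (h1 : ρ ≤ 1 - δ) (ht : t ∈ J) : |w ρ θ₁ t - w ρ θ₂ t| ≤ N*C*ρ^α := by
  obtain ⟨n, hn⟩ := red_angle θ₁ θ₂
  rw [← h.per_int ρ θ₂ t n]
  set θ' := θ₂ + n*(2*π)
  have N0 : (0:ℝ) < N := lt_of_lt_of_le (by positivity) hN
  set ε := (θ₁-θ')/N with hε
  have e1 : κ*|ε| ≤ r0/2 := by
    rw [hε, abs_div, Nat.abs_cast, ← mul_div_assoc, div_le_iff₀ N0]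
    rw [div_le_iff₀ hr0] at hN
    have := mul_le_mul_of_nonneg_left hn hκ.le
    linarith
  have main : ∀ k : ℕ, |w ρ (θ' + k*ε) t - w ρ θ' t| ≤ k*(C*ρ^α) := by
    intro k
    induction k with
    | zero => simp
    | succ k ih =>
      have h3 : |w ρ (θ' + (k+1:ℕ)*ε) t - w ρ (θ' + k*ε) t| ≤ C*ρ^α := by
        refine (h.hB ρ _ ρ _ t ρ (r0/2) h0 h0 le_rfl le_rfl h1 ht (by positivity) ?_ (by linarith)).trans ?_
        · rw [show θ' + (k+1:ℕ)*ε - (θ' + k*ε) = ε by push_cast; ring]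
          simpa using e1
        · refine mul_le_mul_of_nonneg_left (rpow_le_rpow (by positivity) ?_ hα.le) hC.le
          nlinarith
      have h4 := abs_sub_le (w ρ (θ' + (k+1:ℕ)*ε) t) (w ρ (θ' + k*ε) t) (w ρ θ' t)
      push_cast at h3 h4 ⊢
      linarith
  have := main N
  rw [hε, mul_div_cancel₀ _ N0.ne', show θ' + (θ₁ - θ') = θ₁ by ring] at this
  linarith

end
end ConeH
end

section
open Real MeasureTheory Set Filter Topology
open scoped ENNReal

namespace ConeH

section
variable {κ r0 α C δ : ℝ} {J : Set ℝ} {w : ℝ → ℝ → ℝ → ℝ}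

lemma Two.osc (h : Two κ r0 α C δ J w) (hκ : 0 < κ) (hr0 : 0 < r0) (hr1 : r0 ≤ 1) (hα : 0 < α) (hC : 0 < C) {N : ℕ} (hN : 2*π*κ/r0 ≤ N)
    {ρ₁ ρ₂ θ₁ θ₂ t : ℝ} (h2 : 0 < ρ₂) (h12 : ρ₂ ≤ ρ₁) (h1 : ρ₁ ≤ 1 - δ) (ht : t ∈ J) : 
    |w ρ₁ θ₁ t - w ρ₂ θ₂ t| ≤ (N*C + C/(1-exp (-(r0/2))^α))*ρ₁^α := by
  have a1 := h.ang hκ hr0 hr1 hα hC hN (θ₁ := θ₁) (θ₂ := θ₂) (h2.trans_le h12) h1 ht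
  have a2 := h.radial hr0 hr1 hα hC h2 h12 h1 ht (θ := θ₂)
  have := abs_sub_le (w ρ₁ θ₁ t) (w ρ₁ θ₂ t) (w ρ₂ θ₂ t)
  rw [add_mul]
  linarith

noncomputable def dP (ρ₁ θ₁ ρ₂ θ₂ : ℝ) : ℝ := √((ρ₁ * cos θ₁ - ρ₂ * cos θ₂)^2 + (ρ₁ * sin θ₁ - ρ₂ * sin θ₂)^2)

lemma dP_sq (ρ₁ θ₁ ρ₂ θ₂ : ℝ) : dP ρ₁ θ₁ ρ₂ θ₂^2 = (ρ₁-ρ₂)^2 + 2*ρ₁*ρ₂*(1-cos (θ₁-θ₂)) := by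
  unfold dP
  rw [sq_sqrt (by positivity), cos_sub]
  linear_combination ρ₁^2 * sin_sq_add_cos_sq θ₁ + ρ₂^2 * sin_sq_add_cos_sq θ₂

lemma dP_nonneg (ρ₁ θ₁ ρ₂ θ₂ : ℝ) : 0 ≤ dP ρ₁ θ₁ ρ₂ θ₂ := sqrt_nonneg _

lemma dP_comm (ρ₁ θ₁ ρ₂ θ₂ : ℝ) : dP ρ₁ θ₁ ρ₂ θ₂ = dP ρ₂ θ₂ ρ₁ θ₁ := by
  unfold dP; congr 1; ring

lemma dP_per (ρ₁ θ₁ ρ₂ θ₂ : ℝ) (n : ℤ) : dP ρ₁ θ₁ ρ₂ (θ₂ + n*(2*π)) = dP ρ₁ θ₁ ρ₂ θ₂ := by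
  unfold dP; rw [cos_add_int_mul_two_pi, sin_add_int_mul_two_pi]

set_option maxHeartbeats 1000000 in
lemma Two.space (h : Two κ r0 α C δ J w) (hκ : 0 < κ) (hr0 : 0 < r0) (hr1 : r0 ≤ 1) (hα : 0 < α) (hC : 0 < C) {K c : ℝ} (hK : 0 < K)
    (hosc : ∀ ρ₁ ρ₂ θ₁ θ₂ t, 0 < ρ₂ → ρ₂ ≤ ρ₁ → ρ₁ ≤ 1 - δ → t ∈ J → |w ρ₁ θ₁ t - w ρ₂ θ₂ t| ≤ K * ρ₁^α)
    (hc : c = r0/(2*(2+3*κ)))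
    {ρ₁ ρ₂ θ₁ θ₂ t : ℝ} (h2 : 0 < ρ₂) (h12 : ρ₂ ≤ ρ₁) (h1 : ρ₁ ≤ 1 - δ) (ht : t ∈ J) : 
    |w ρ₁ θ₁ t - w ρ₂ θ₂ t| ≤ (K/c^α + C*(2+3*κ)^α)*dP ρ₁ θ₁ ρ₂ θ₂^α := by
  obtain ⟨n, hn⟩ := red_angle θ₁ θ₂
  rw [← h.per_int ρ₂ θ₂ t n, ← dP_per _ _ _ _ n]
  set θ' := θ₂ + n*(2*π)
  have h10 : 0 < ρ₁ := h2.trans_le h12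
  have c0 : 0 < c := by rw [hc]; positivity
  have c4 : c ≤ 1/4 := by
    rw [hc, div_le_div_iff₀ (by positivity) (by norm_num)]
    nlinarith
  have hsq := dP_sq ρ₁ θ₁ ρ₂ θ'
  have e0 := dP_nonneg ρ₁ θ₁ ρ₂ θ'
  set e := dP ρ₁ θ₁ ρ₂ θ' with he
  have p1 : 0 ≤ C*(2+3*κ)^α*e^α := by positivity
  have p2 : 0 ≤ K/c^α*e^α := by positivity
  rw [add_mul]
  by_cases hce : c*ρ₁ ≤ e
  · have h3 := hosc ρ₁ ρ₂ θ₁ θ' t h2 h12 h1 ht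
    have h4 : ρ₁^α ≤ e^α/c^α := by
      rw [← div_rpow e0 c0.le]
      exact rpow_le_rpow h10.le (by rw [le_div_iff₀ c0]; linarith) hα.le
    have h5 : K*ρ₁^α ≤ K/c^α*e^α := (mul_le_mul_of_nonneg_left h4 hK.le).trans (le_of_eq (by ring))
    linarith
  · push Not at hce
    set Δ := θ₁ - θ' with hΔ
    have hcos := cos_le_one_sub_mul_cos_sq hn
    have hge : 0 ≤ 2*ρ₁*ρ₂*(1-cos Δ) := by
      have := cos_le_one Δ
      have : 0 ≤ 1 - cos Δ := by linarith
      positivity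
    have hd : ρ₁ - ρ₂ ≤ e := by
      apply le_of_sq_le_sq _ e0
      linarith
    have hhalf : ρ₁/2 ≤ ρ₂ := by nlinarith
    have hang : ρ₁ * |Δ| ≤ 3*e := by
      apply le_of_sq_le_sq _ (by positivity)
      rw [mul_pow, sq_abs, mul_pow]
      have hp : 2/π^2*Δ^2 ≤ 1 - cos Δ := by linarith
      have hp2 : Δ^2 * (1/5) ≤ 2/π^2*Δ^2 := by
        rw [mul_comm]
        refine mul_le_mul_of_nonneg_right ?_ (sq_nonneg _)
        rw [div_le_div_iff₀ (by norm_num) (by positivity)]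
        nlinarith [pi_lt_d2, pi_pos]
      have hp3 : ρ₁^2 * (Δ^2*(1/5)) ≤ 2*ρ₁*ρ₂*(1-cos Δ) := by
        refine mul_le_mul ?_ (hp2.trans hp) (by positivity) (by positivity)
        nlinarith
      nlinarith [sq_nonneg (ρ₁ - ρ₂), sq_nonneg e]
    rcases e0.eq_or_lt with hz | hpos
    · have z1 : ρ₁ = ρ₂ := by linarith
      have z2 : Δ = 0 := by
        rw [← hz] at hang
        have : |Δ| ≤ 0 := by nlinarith [abs_nonneg Δ]
        exact abs_nonpos_iff.1 this
      have z3 : θ₁ = θ' := by linarith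
      rw [z1, z3, sub_self, abs_zero]
      linarith
    · have hlog : |log ρ₁ - log ρ₂| ≤ 2*e/ρ₁ := by
        rw [abs_of_nonneg (by linarith [Real.log_le_log h2 h12]), ← log_div h10.ne' h2.ne']
        refine (log_le_sub_one_of_pos (by positivity)).trans ?_
        rw [div_sub_one h2.ne', div_le_div_iff₀ h2 h10]
        nlinarith
      have hang' : κ*|Δ| ≤ 3*κ*e/ρ₁ := by
        rw [le_div_iff₀ h10]
        nlinarith
      have hcm : c*(2*(2+3*κ)) = r0 := by rw [hc]; field_simp
      have hD : 2*((2+3*κ)*e/ρ₁) ≤ r0 := by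
        rw [← hcm, mul_div_assoc]
        have : e/ρ₁ ≤ c := by rw [div_le_iff₀ h10]; exact hce.le
        nlinarith
      have h6 := h.hB ρ₁ θ₁ ρ₂ θ' t ρ₁ ((2+3*κ)*e/ρ₁) h10 h2 le_rfl h12 h1 ht (by positivity) (by
        refine (add_le_add hlog hang').trans (le_of_eq ?_)
        ring) hD
      rw [div_mul_cancel₀ _ h10.ne', mul_rpow (by positivity) e0] at h6
      linarith

lemma Two.time (h : Two κ r0 α C δ J w) (hr0 : 0 < r0) (hα : 0 < α) (hC : 0 < C) {K M : ℝ} (hK : 0 < K) (hδ : δ < 1) (hM : 0 ≤ M)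
    (hbd : ∀ ρ θ t, 0 < ρ → ρ ≤ 1 - δ → t ∈ J → |w ρ θ t| ≤ M)
    (hosc : ∀ ρ₁ ρ₂ θ₁ θ₂ t, 0 < ρ₂ → ρ₂ ≤ ρ₁ → ρ₁ ≤ 1 - δ → t ∈ J → |w ρ₁ θ₁ t - w ρ₂ θ₂ t| ≤ K * ρ₁^α)
    {ρ θ t s : ℝ} (h0 : 0 < ρ) (h1 : ρ ≤ 1 - δ) (ht : t ∈ J) (hs : s ∈ J) (hst : s < t) :
    |w ρ θ t - w ρ θ s| ≤ (C + 2*K/r0^α + 2*M/(r0*(1-δ))^α) * √(t-s)^α := by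
  have q0 : 0 < √(t-s) := sqrt_pos.2 (by linarith)
  set τ := √(t-s) with hτ
  have hδ' : 0 < 1 - δ := by linarith
  have p0 : 0 < τ^α := rpow_pos_of_pos q0 _
  have p1 : 0 ≤ C*τ^α := by positivity
  have p2 : 0 ≤ 2*K/r0^α*τ^α := by positivity
  have p3 : 0 ≤ 2*M/(r0*(1-δ))^α*τ^α := by positivity
  rw [add_mul, add_mul]
  by_cases c1 : τ ≤ r0*ρ
  · have := h.hA ρ θ t s h0 h1 ht hs hst c1
    linarith
  · push Not at c1
    by_cases c2 : τ ≤ r0*(1-δ)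
    · have hρ : ρ ≤ τ/r0 := by rw [le_div_iff₀ hr0]; linarith
      have hρ1 : τ/r0 ≤ 1 - δ := by rw [div_le_iff₀ hr0]; linarith
      have b1 := hosc (τ/r0) ρ θ θ t h0 hρ hρ1 ht
      have b2 := hosc (τ/r0) ρ θ θ s h0 hρ hρ1 hs
      have b3 := h.hA (τ/r0) θ t s (by positivity) hρ1 ht hs hst (by rw [mul_div_cancel₀ _ hr0.ne'])
      rw [div_rpow q0.le hr0.le] at b1 b2
      have e : K*(τ^α/r0^α) + K*(τ^α/r0^α) = 2*K/r0^α*τ^α := by ring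
      have t1 := abs_sub_le (w ρ θ t) (w (τ/r0) θ t) (w ρ θ s)
      have t2 := abs_sub_le (w (τ/r0) θ t) (w (τ/r0) θ s) (w ρ θ s)
      rw [abs_sub_comm] at b1
      change _ ≤ C*τ^α at b3
      linarith
    · push Not at c2
      have t1 := abs_sub (w ρ θ t) (w ρ θ s)
      have t2 := hbd ρ θ t h0 h1 ht
      have t3 := hbd ρ θ s h0 h1 hs
      have h5 : 1 ≤ τ^α/(r0*(1-δ))^α := by
        rw [one_le_div (rpow_pos_of_pos (by positivity) _)]
        exact rpow_le_rpow (by positivity) c2.le hα.le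
      have h6 : 2*M ≤ 2*M/(r0*(1-δ))^α*τ^α := by
        calc 2*M = 2*M*1 := by ring
          _ ≤ 2*M*(τ^α/(r0*(1-δ))^α) := mul_le_mul_of_nonneg_left h5 (by positivity)
          _ = _ := by ring
      linarith

end

lemma Two_final {κ r0 α C δ M : ℝ} (hκ : 0 < κ) (hr0 : 0 < r0) (hr1 : r0 ≤ 1) (hα : 0 < α) (hC : 0 < C) (hδ : δ < 1) (hM : 0 ≤ M) :
    ∃ C₂ : ℝ, ∀ (J : Set ℝ) (w : ℝ → ℝ → ℝ → ℝ), Two κ r0 α C δ J w → (∀ ρ θ t, 0 < ρ → ρ ≤ 1 - δ → t ∈ J → |w ρ θ t| ≤ M) →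
    ∀ ρ₁ θ₁ ρ₂ θ₂ t s, 0 < ρ₁ → ρ₁ ≤ 1 - δ → 0 < ρ₂ → ρ₂ ≤ 1 - δ → t ∈ J → s ∈ J → 
      |w ρ₁ θ₁ t - w ρ₂ θ₂ s| ≤ C₂ * (dP ρ₁ θ₁ ρ₂ θ₂ + √|t-s|)^α := by
  obtain ⟨N, hN⟩ := exists_nat_ge (2*π*κ/r0)
  have l1 : exp (-(r0/2))^α < 1 := rpow_lt_one (exp_pos _).le (by rw [exp_lt_one_iff]; linarith) hα
  set K := N*C + C/(1-exp (-(r0/2))^α) with hKd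
  have hK : 0 < K := by
    have : 0 < C/(1-exp (-(r0/2))^α) := div_pos hC (by linarith)
    positivity
  set c := r0/(2*(2+3*κ)) with hc
  have c0 : 0 < c := by positivity
  have hδ' : 0 < 1 - δ := by linarith
  set A1 := K/c^α + C*(2+3*κ)^α with hA1
  set A2 := C + 2*K/r0^α + 2*M/(r0*(1-δ))^α with hA2
  have A10 : 0 ≤ A1 := by positivity
  have A20 : 0 ≤ A2 := by positivity
  refine ⟨A1 + A2, fun J w h hbd ρ₁ θ₁ ρ₂ θ₂ t s h10 h11 h20 h21 ht hs => ?_⟩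
  have hosc : ∀ ρ₁ ρ₂ θ₁ θ₂ t, 0 < ρ₂ → ρ₂ ≤ ρ₁ → ρ₁ ≤ 1 - δ → t ∈ J → |w ρ₁ θ₁ t - w ρ₂ θ₂ t| ≤ K * ρ₁^α :=
    fun ρ₁ ρ₂ θ₁ θ₂ t a b d f => h.osc hκ hr0 hr1 hα hC hN a b d f
  have sp : |w ρ₁ θ₁ t - w ρ₂ θ₂ t| ≤ A1 * dP ρ₁ θ₁ ρ₂ θ₂^α := by
    rcases le_total ρ₂ ρ₁ with h12 | h12
    · exact h.space hκ hr0 hr1 hα hC hK hosc hc h20 h12 h11 ht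
    · rw [abs_sub_comm, dP_comm]
      exact h.space hκ hr0 hr1 hα hC hK hosc hc h10 h12 h21 ht
  have tm : |w ρ₂ θ₂ t - w ρ₂ θ₂ s| ≤ A2 * √|t-s|^α := by
    rcases lt_trichotomy s t with hst | hst | hst
    · rw [abs_of_pos (show 0 < t - s by linarith)]
      exact h.time hr0 hα hC hK hδ hM hbd hosc h20 h21 ht hs hst
    · rw [hst]; simp [zero_rpow hα.ne']
    · rw [abs_sub_comm, abs_sub_comm t s, abs_of_pos (show 0 < s - t by linarith)]
      exact h.time hr0 hα hC hK hδ hM hbd hosc h20 h21 hs ht hst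
  have d0 := dP_nonneg ρ₁ θ₁ ρ₂ θ₂
  have s0 := sqrt_nonneg |t-s|
  have e1 : dP ρ₁ θ₁ ρ₂ θ₂^α ≤ (dP ρ₁ θ₁ ρ₂ θ₂ + √|t-s|)^α := rpow_le_rpow d0 (by linarith) hα.le
  have e2 : √|t-s|^α ≤ (dP ρ₁ θ₁ ρ₂ θ₂ + √|t-s|)^α := rpow_le_rpow s0 (by linarith) hα.le
  have := abs_sub_le (w ρ₁ θ₁ t) (w ρ₂ θ₂ t) (w ρ₂ θ₂ s)
  have f1 := mul_le_mul_of_nonneg_left e1 A10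
  have f2 := mul_le_mul_of_nonneg_left e2 A20
  rw [add_mul]
  linarith

end ConeH
end

section
open Real MeasureTheory Set Filter Topology
open scoped ENNReal
namespace ConeH

lemma Two_of_Sol {κ T Λ G M α C δ : ℝ} (hκ : 0 < κ) {g v : ℝ × ℝ → ℝ → ℝ} (S : Sol κ T Λ G M g v)
    (hA : ∀ y : ℝ × ℝ, exp y.1 ≤ 1 - δ → ∀ t ∈ Icc δ T, ∀ s ∈ Icc δ T, s < t → √(t-s) ≤ rz κ δ * exp y.1 →
      |g (Ex κ y) t - g (Ex κ y) s| ≤ C * (√(t-s))^α)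
    (hB : ∀ y z : ℝ × ℝ, ∀ t ∈ Icc δ T, ∀ m D : ℝ, exp y.1 ≤ m → exp z.1 ≤ m → m ≤ 1 - δ → 0 < D →
      (z.1-y.1)^2 + (z.2-y.2)^2 ≤ D^2 → 2*D ≤ rz κ δ → |g (Ex κ y) t - g (Ex κ z) t| ≤ C * (D*m)^α) :
    Two κ (rz κ δ) α C δ (Icc δ T) (fun ρ θ t => g (ρ, θ) t) := by
  have hE : ∀ ρ θ : ℝ, 0 < ρ → Ex κ (log ρ, κ * θ) = (ρ, θ) := fun ρ θ h => by
    simp only [Ex, exp_log h, mul_div_cancel_left₀ θ hκ.ne']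
  refine ⟨fun ρ θ t => S.per (ρ, θ) t, ?_, ?_⟩
  · intro ρ θ t s h0 h1 ht hs hst hr
    have := hA (log ρ, κ * θ) (by simpa [exp_log h0] using h1) t ht s hs hst (by simpa [exp_log h0] using hr)
    rwa [hE ρ θ h0] at this
  · intro ρ₁ θ₁ ρ₂ θ₂ t m D h1 h2 h1m h2m hm ht hD hl hr
    have := hB (log ρ₁, κ * θ₁) (log ρ₂, κ * θ₂) t ht m D (by simpa [exp_log h1] using h1m)
      (by simpa [exp_log h2] using h2m) hm hD ?_ hr
    · rwa [hE ρ₁ θ₁ h1, hE ρ₂ θ₂ h2] at this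
    · have e1 : (log ρ₂ - log ρ₁)^2 = |log ρ₁ - log ρ₂|^2 := by rw [sq_abs]; ring
      have e2 : (κ*θ₂ - κ*θ₁)^2 = (κ * |θ₁ - θ₂|)^2 := by rw [mul_pow, sq_abs]; ring
      have p1 : 0 ≤ |log ρ₁ - log ρ₂| := abs_nonneg _
      have p2 : 0 ≤ κ * |θ₁ - θ₂| := by positivity
      have p3 : (|log ρ₁ - log ρ₂| + κ * |θ₁ - θ₂|)^2 ≤ D^2 := pow_le_pow_left₀ (by positivity) hl 2
      change (log ρ₂ - log ρ₁)^2 + (κ*θ₂ - κ*θ₁)^2 ≤ D^2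
      rw [e1, e2]
      nlinarith [mul_nonneg p1 p2]

end ConeH
end

/-- interior parabolic Hölder continuity for bounded weak solutions of
`∂_t u = a △̃u + b u + f` on the punctured cone ball; the exponent `α'` depends only on
`β` and `C₁`, and the constant `C₂` only on `δ`, `C₁` and the sup bound of `u`. -/
theorem stmt9 (β C₁ : ℝ) (hβ : -1 < β) (hC₁ : 0 < C₁) :
    ∃ α' : ℝ, 0 < α' ∧
      ∀ δ M : ℝ, δ ∈ Set.Ioo (0:ℝ) 1 → 0 ≤ M →
        ∃ C₂ : ℝ,
          ∀ T : ℝ, 0 < T →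
            ∀ u a b f : ℝ → ℝ → ℝ → ℝ,
              -- 2π-periodicity in θ
              (∀ ρ θ t : ℝ, u ρ (θ + 2 * π) t = u ρ θ t ∧ a ρ (θ + 2 * π) t = a ρ θ t ∧
                b ρ (θ + 2 * π) t = b ρ θ t ∧ f ρ (θ + 2 * π) t = f ρ θ t) →
              -- boundedness of u
              (∀ ρ θ t : ℝ, 0 < ρ → ρ < 1 → t ∈ Icc 0 T → |u ρ θ t| ≤ M) →
              -- regularity: C² in (ρ,θ), C¹ in t
              (∀ t ∈ Icc (0:ℝ) T, ContDiffOn ℝ 2 (fun p : ℝ × ℝ => u p.1 p.2 t)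
                {p : ℝ × ℝ | 0 < p.1 ∧ p.1 < 1}) →
              (∀ ρ θ : ℝ, 0 < ρ → ρ < 1 →
                ContDiffOn ℝ 1 (fun t => u ρ θ t) (Icc 0 T)) →
              -- bounds on the coefficients: a > 0 and a + 1/a + |∂_t a| + |b| + |f| ≤ C₁
              (∀ ρ θ t : ℝ, 0 < ρ → ρ < 1 → t ∈ Icc 0 T →
                0 < a ρ θ t ∧
                a ρ θ t + (a ρ θ t)⁻¹ + |dtime T (fun s => a ρ θ s) t|
                  + |b ρ θ t| + |f ρ θ t| ≤ C₁) →
              -- the equation, pointwise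
              (∀ ρ θ t : ℝ, 0 < ρ → ρ < 1 → t ∈ Icc 0 T →
                dtime T (fun s => u ρ θ s) t
                  = a ρ θ t * coneLapT β u ρ θ t + b ρ θ t * u ρ θ t + f ρ θ t) →
              -- finiteness of sup_t ∫ |∇̃u|² dṼ
              (∃ E : ℝ≥0∞, E ≠ ⊤ ∧ ∀ t ∈ Icc (0:ℝ) T,
                (∫⁻ θ in Icc (0:ℝ) (2 * π), ∫⁻ ρ in Ioo (0:ℝ) 1,
                  ENNReal.ofReal (gradSq β u ρ θ t * ((β + 1) * ρ))) ≤ E) →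
              -- finiteness of ∫₀^T ∫ |∂_t u|² dṼ dt
              ((∫⁻ t in Icc (0:ℝ) T, ∫⁻ θ in Icc (0:ℝ) (2 * π), ∫⁻ ρ in Ioo (0:ℝ) 1,
                  ENNReal.ofReal ((dtime T (fun s => u ρ θ s) t) ^ 2 * ((β + 1) * ρ))) ≠ ⊤) →
              -- interior parabolic Hölder continuity
              ∀ ρ₁ θ₁ ρ₂ θ₂ t s : ℝ,
                ρ₁ ∈ Ioc (0:ℝ) (1 - δ) → ρ₂ ∈ Ioc (0:ℝ) (1 - δ) →
                t ∈ Icc δ T → s ∈ Icc δ T →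
                  |u ρ₁ θ₁ t - u ρ₂ θ₂ s| ≤
                    C₂ * (Real.sqrt ((ρ₁ * Real.cos θ₁ - ρ₂ * Real.cos θ₂) ^ 2
                            + (ρ₁ * Real.sin θ₁ - ρ₂ * Real.sin θ₂) ^ 2)
                          + Real.sqrt |t - s|) ^ α' := by
  have hκ : 0 < β + 1 := by linarith
  obtain ⟨α, α0, _, hp⟩ := ConeH.ptwise (β + 1) C₁ hκ hC₁
  refine ⟨α, α0, fun δ M hδ hM => ?_⟩
  obtain ⟨C, C0, hq⟩ := hp (C₁ * (1 + M)) M δ (by positivity) hM hδ.1 hδ.2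
  have hδ0 := hδ.1
  have hδ1 := hδ.2
  have r0 : 0 < ConeH.rz (β + 1) δ := lt_min (by positivity) hκ
  have r1 : ConeH.rz (β + 1) δ ≤ 1 := (min_le_left _ _).trans (by linarith)
  obtain ⟨C₂, hC₂⟩ := ConeH.Two_final hκ r0 r1 α0 C0 hδ1 hM
  refine ⟨C₂, fun T hT u a b f hper hbd h2 h1 hab heq hE hv ρ₁ θ₁ ρ₂ θ₂ t s hρ₁ hρ₂ ht hs => ?_⟩
  obtain ⟨g, v, hg, S⟩ := ConeH.Sol_exists hβ hC₁ hM hT (fun ρ θ t => (hper ρ θ t).1) hbd h2 h1 hab heq hE hv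
  obtain ⟨hA, hB⟩ := hq T g v S
  have hmem : ∀ ρ θ : ℝ, 0 < ρ → ρ ≤ 1 - δ → ((ρ, θ) : ℝ × ℝ) ∈ ConeH.B 1 := fun ρ θ h h' =>
    ⟨⟨h, by change ρ < 1; linarith⟩, Set.mem_univ _⟩
  have hI : ∀ t ∈ Icc δ T, t ∈ Icc (0:ℝ) T := fun t h => ⟨hδ0.le.trans h.1, h.2⟩
  have key := hC₂ (Icc δ T) _ (ConeH.Two_of_Sol hκ S hA hB)
    (fun ρ θ t h h' ht => S.sys.bd t (hI t ht) _ (hmem ρ θ h h')) ρ₁ θ₁ ρ₂ θ₂ t s hρ₁.1 hρ₁.2 hρ₂.1 hρ₂.2 ht hs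
  rw [← hg _ (hmem ρ₁ θ₁ hρ₁.1 hρ₁.2) t (hI t ht), ← hg _ (hmem ρ₂ θ₂ hρ₂.1 hρ₂.2) s (hI s hs)]
  exact key
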